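/- Let N ≥ 3 and 0 < R₀ < R₁ be fixed, and take a ≡ 1. There exists p_* > 2 such that for every p > p_*, every minimizer u ∈ N_K of I restricted to N_K is nonradial, i.e. there exist x, y ∈ A with |x| = |y| and u(x) ≠ u(y). In particular, for every p > p_*, the problem −Δu + u = |u|^{p−2}u in A, u > 0 in A, u = 0 on ∂A, admits a nonradial, axially symmetric weak solution. -/

import Mathlib

open MeasureTheory Real Set

noncomputable section

/-- The open annulus `{x : R₀ < |x| < R₁}` in `ℝ^N`. -/
def annulus (N : ℕ) (R₀ R₁ : ℝ) : Set (EuclideanSpace ℝ (Fin N)) :=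
  {x | R₀ < ‖x‖ ∧ ‖x‖ < R₁}

/-- The last coordinate `x_N` of a point of `ℝ^N`. -/
def lastCoord {N : ℕ} (x : EuclideanSpace ℝ (Fin N)) : ℝ :=
  if h : 0 < N then x ⟨N - 1, by omega⟩ else 0

/-- The polar angle `θ = arcsin (x_N / |x|)`. -/
def angleOf {N : ℕ} (x : EuclideanSpace ℝ (Fin N)) : ℝ :=
  Real.arcsin (lastCoord x / ‖x‖)

/-- `u` is axially symmetric on the closed annulus with representative `𝔲 = 𝔲(r,θ)`. -/
def IsAxiallySymmRep (N : ℕ) (R₀ R₁ : ℝ) (u : EuclideanSpace ℝ (Fin N) → ℝ)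
    (𝔲 : ℝ → ℝ → ℝ) : Prop :=
  ∀ x ∈ closure (annulus N R₀ R₁), u x = 𝔲 ‖x‖ (angleOf x)

/-- Membership in the cone `K̂`: `C¹` on the closed annulus, nonnegative, axially symmetric,
even in `θ` and nonincreasing in `θ` on `[0, π/2]`. -/
def memKhat (N : ℕ) (R₀ R₁ : ℝ) (u : EuclideanSpace ℝ (Fin N) → ℝ) : Prop :=
  ContDiffOn ℝ 1 u (closure (annulus N R₀ R₁)) ∧
  (∀ x ∈ closure (annulus N R₀ R₁), 0 ≤ u x) ∧
  ∃ 𝔲 : ℝ → ℝ → ℝ,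
    IsAxiallySymmRep N R₀ R₁ u 𝔲 ∧
    (∀ r ∈ Icc R₀ R₁, ∀ θ ∈ Icc (-(π / 2)) (π / 2), 𝔲 r (-θ) = 𝔲 r θ) ∧
    (∀ r ∈ Icc R₀ R₁, AntitoneOn (𝔲 r) (Icc 0 (π / 2)))

/-- `C¹₀(A)` : `C¹` on the closed annulus, vanishing on the boundary. -/
def memC10 (N : ℕ) (R₀ R₁ : ℝ) (u : EuclideanSpace ℝ (Fin N) → ℝ) : Prop :=
  ContDiffOn ℝ 1 u (closure (annulus N R₀ R₁)) ∧
  ∀ x : EuclideanSpace ℝ (Fin N), (‖x‖ = R₀ ∨ ‖x‖ = R₁) → u x = 0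

/-- The cone `K = K̂ ∩ C¹₀(A)`. -/
def memK (N : ℕ) (R₀ R₁ : ℝ) (u : EuclideanSpace ℝ (Fin N) → ℝ) : Prop :=
  memKhat N R₀ R₁ u ∧ ∀ x : EuclideanSpace ℝ (Fin N), (‖x‖ = R₀ ∨ ‖x‖ = R₁) → u x = 0

/-- The squared `H¹(A)`-norm `∫_A (|∇u|² + u²) dx`. -/
def H1sq (N : ℕ) (R₀ R₁ : ℝ) (u : EuclideanSpace ℝ (Fin N) → ℝ) : ℝ :=
  ∫ x in annulus N R₀ R₁,
    (‖fderivWithin ℝ u (closure (annulus N R₀ R₁)) x‖ ^ 2 + (u x) ^ 2)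

/-- The energy functional `I(u) = ½‖u‖²_{H¹} − (1/p) ∫_A a |u|^p`. -/
def funcI (N : ℕ) (R₀ R₁ : ℝ) (a : EuclideanSpace ℝ (Fin N) → ℝ) (p : ℝ)
    (u : EuclideanSpace ℝ (Fin N) → ℝ) : ℝ :=
  (1 / 2) * H1sq N R₀ R₁ u - (1 / p) * ∫ x in annulus N R₀ R₁, a x * |u x| ^ p

/-- The Nehari set `N_K`. -/
def memNehari (N : ℕ) (R₀ R₁ : ℝ) (a : EuclideanSpace ℝ (Fin N) → ℝ) (p : ℝ)
    (u : EuclideanSpace ℝ (Fin N) → ℝ) : Prop :=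
  memK N R₀ R₁ u ∧ (∃ x ∈ annulus N R₀ R₁, u x ≠ 0) ∧
  H1sq N R₀ R₁ u = ∫ x in annulus N R₀ R₁, a x * |u x| ^ p

/-- The Nehari level `c_I = inf_{N_K} I`. -/
def cI (N : ℕ) (R₀ R₁ : ℝ) (a : EuclideanSpace ℝ (Fin N) → ℝ) (p : ℝ) : ℝ :=
  sInf {c | ∃ u, memNehari N R₀ R₁ a p u ∧ c = funcI N R₀ R₁ a p u}

/-- Test functions `C_c^∞(A)`. -/
def IsTestFun (N : ℕ) (R₀ R₁ : ℝ) (φ : EuclideanSpace ℝ (Fin N) → ℝ) : Prop :=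
  ContDiff ℝ (⊤ : ℕ∞) φ ∧ HasCompactSupport φ ∧ tsupport φ ⊆ annulus N R₀ R₁

/-- Weak solution of `−Δu + u = a(x)|u|^{p−2}u` in `A`, `u = 0` on `∂A`. -/
def IsWeakSolution (N : ℕ) (R₀ R₁ : ℝ) (a : EuclideanSpace ℝ (Fin N) → ℝ) (p : ℝ)
    (u : EuclideanSpace ℝ (Fin N) → ℝ) : Prop :=
  memC10 N R₀ R₁ u ∧
  ∀ φ : EuclideanSpace ℝ (Fin N) → ℝ, IsTestFun N R₀ R₁ φ →
    (∫ x in annulus N R₀ R₁,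
      (fderivWithin ℝ u (closure (annulus N R₀ R₁)) x (gradient φ x) + u x * φ x))
    = ∫ x in annulus N R₀ R₁, a x * |u x| ^ (p - 2) * u x * φ x

/-- The (classical) Laplacian, as the sum of second partial derivatives. -/
def lapl {N : ℕ} (u : EuclideanSpace ℝ (Fin N) → ℝ) (x : EuclideanSpace ℝ (Fin N)) : ℝ :=
  ∑ i : Fin N,
    fderiv ℝ (fun y => fderiv ℝ u y (EuclideanSpace.single i 1)) x (EuclideanSpace.single i 1)

/-- The inclusion `ℝ^{N-1} → ℝ^N`, `x' ↦ (x',0)`. -/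
def embedHyper (N : ℕ) (x' : EuclideanSpace ℝ (Fin (N - 1))) : EuclideanSpace ℝ (Fin N) :=
  (WithLp.equiv 2 (Fin N → ℝ)).symm
    (fun j => if h : (j : ℕ) < N - 1 then x' ⟨j, h⟩ else 0)

/-- A `C¹` distance on the closed annulus. -/
def C1dist (N : ℕ) (R₀ R₁ : ℝ) (u v : EuclideanSpace ℝ (Fin N) → ℝ) : ℝ :=
  (⨆ x : closure (annulus N R₀ R₁), |u x - v x|) +
  (⨆ x : closure (annulus N R₀ R₁),
    ‖fderivWithin ℝ u (closure (annulus N R₀ R₁)) x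
      - fderivWithin ℝ v (closure (annulus N R₀ R₁)) x‖)

end

open MeasureTheory Real Set

namespace NR
open Filter Topology

abbrev E (N : ℕ) := EuclideanSpace ℝ (Fin N)

/-- regularised Newton kernel -/
noncomputable def Gam (N : ℕ) (a : ℝ) (x : E N) : ℝ := (‖x‖ ^ 2 + a) ^ (((2 : ℝ) - N) / 2)
noncomputable def dGam (N : ℕ) (a : ℝ) (x : E N) : E N :=
  (((2 : ℝ) - N) * (‖x‖ ^ 2 + a) ^ (-(N : ℝ) / 2)) • x

lemma hasFDerivAt_Gam (N : ℕ) {a : ℝ} (ha : 0 < a) (x : E N) :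
    HasFDerivAt (Gam N a) (innerSL ℝ (dGam N a x)) x := by
  have h1 : HasFDerivAt (fun x : E N => ‖x‖ ^ 2 + a) ((2 : ℝ) • innerSL ℝ x) x := by
    have := (hasStrictFDerivAt_norm_sq x).hasFDerivAt
    refine (this.add_const a).congr_fderiv ?_
    ext v; simp [two_smul]
  have h2 := h1.rpow_const (p := ((2 : ℝ) - N) / 2) (Or.inl (by positivity))
  refine h2.congr_fderiv ?_
  ext v
  simp only [dGam, map_smul, smul_apply, smul_eq_mul]
  have : ((2 : ℝ) - N) / 2 - 1 = -(N : ℝ) / 2 := by ring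
  rw [this]; ring

lemma Gam_nonneg (N : ℕ) {a : ℝ} (ha : 0 ≤ a) (x : E N) : 0 ≤ Gam N a x := by
  unfold Gam; positivity

lemma norm_rpow_aux {N : ℕ} (x : E N) (s : ℝ) : (‖x‖ ^ 2) ^ (s / 2) = ‖x‖ ^ s := by
  rw [← Real.rpow_natCast, ← Real.rpow_mul (norm_nonneg _)]; congr 1; push_cast; ring

lemma Gam_le {N : ℕ} (hN : 3 ≤ N) {a : ℝ} (ha : 0 ≤ a) {x : E N} (hx : x ≠ 0) :
    Gam N a x ≤ ‖x‖ ^ ((2 : ℝ) - N) := by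
  have hN' : (3 : ℝ) ≤ N := by exact_mod_cast hN
  have hx' : 0 < ‖x‖ := norm_pos_iff.mpr hx
  rw [← norm_rpow_aux]
  exact Real.rpow_le_rpow_of_nonpos (by positivity) (by linarith) (by linarith)

lemma Gam_zero {N : ℕ} (x : E N) : Gam N 0 x = ‖x‖ ^ ((2 : ℝ) - N) := by
  rw [← norm_rpow_aux]; simp [Gam]

lemma norm_dGam_le' {N : ℕ} (hN : 3 ≤ N) {a : ℝ} (ha : 0 ≤ a) {x : E N} (hx : 0 < ‖x‖ ^ 2 + a) :
    ‖dGam N a x‖ ≤ (N - 2) * (‖x‖ ^ 2 + a) ^ (((1 : ℝ) - N) / 2) := by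
  have hN' : (3 : ℝ) ≤ N := by exact_mod_cast hN
  rw [dGam, norm_smul, norm_mul, Real.norm_eq_abs, abs_of_neg (by linarith),
    Real.norm_of_nonneg (by positivity)]
  have h1 : ‖x‖ ≤ (‖x‖ ^ 2 + a) ^ ((1 : ℝ) / 2) := by
    rw [← Real.sqrt_eq_rpow]
    exact Real.le_sqrt_of_sq_le (by linarith)
  have h2 : (‖x‖ ^ 2 + a) ^ (((1 : ℝ) - N) / 2) =
      (‖x‖ ^ 2 + a) ^ (-(N : ℝ) / 2) * (‖x‖ ^ 2 + a) ^ ((1 : ℝ) / 2) := by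
    rw [← Real.rpow_add hx]; congr 1; ring
  rw [h2, ← mul_assoc, neg_sub]
  have : 0 ≤ (N - 2) * (‖x‖ ^ 2 + a) ^ (-(N : ℝ) / 2) := by
    have : (0 : ℝ) ≤ N - 2 := by linarith
    positivity
  gcongr

lemma norm_dGam_le {N : ℕ} (hN : 3 ≤ N) {a : ℝ} (ha : 0 ≤ a) {x : E N} (hx : x ≠ 0) :
    ‖dGam N a x‖ ≤ (N - 2) * ‖x‖ ^ ((1 : ℝ) - N) := by
  have hN' : (3 : ℝ) ≤ N := by exact_mod_cast hN
  have hx' : 0 < ‖x‖ := norm_pos_iff.mpr hx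
  refine (norm_dGam_le' hN ha (by positivity)).trans ?_
  have : (0 : ℝ) ≤ N - 2 := by linarith
  refine mul_le_mul_of_nonneg_left ?_ this
  rw [← norm_rpow_aux]
  exact Real.rpow_le_rpow_of_nonpos (by positivity) (by linarith) (by linarith)

lemma integrableOn_pow_ball {N : ℕ} (hN : 3 ≤ N) {α : ℝ} (hα : α < N) (R : ℝ) :
    IntegrableOn (fun x : E N => ‖x‖ ^ (-α)) (Metric.ball 0 R) := by
  have : Nonempty (Fin N) := ⟨⟨0, by omega⟩⟩
  rcases le_or_gt R 0 with hR | hR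
  · simp [Metric.ball_eq_empty.mpr hR]
  rw [integrableOn_fun_norm_addHaar volume (f := fun r => r ^ (-α))]
  simp only [finrank_euclideanSpace, Fintype.card_fin, smul_eq_mul]
  have h : IntegrableOn (fun y : ℝ => y ^ ((N : ℝ) - 1 - α)) (Ioo 0 R) :=
    (intervalIntegral.integrableOn_Ioo_rpow_iff hR).mpr (by linarith)
  refine h.congr_fun ?_ measurableSet_Ioo
  intro y hy
  have hy0 : 0 < y := hy.1
  simp only
  rw [← Real.rpow_natCast, ← Real.rpow_add hy0]
  congr 1
  rw [Nat.cast_sub (by omega)]; push_cast; ring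

/-- shifted kernel is integrable on balls with uniform bound -/
lemma kernel_shift {N : ℕ} (hN : 3 ≤ N) {α : ℝ} (h0 : 0 ≤ α) (hα : α < N) (R : ℝ) (x : E N) :
    IntegrableOn (fun y : E N => ‖x - y‖ ^ (-α)) (Metric.ball 0 R) ∧
    ∫ y in Metric.ball 0 R, ‖x - y‖ ^ (-α) ≤
      (∫ z in Metric.ball (0 : E N) 1, ‖z‖ ^ (-α)) + volume.real (Metric.ball (0 : E N) R) := by
  set h : E N → ℝ := (Metric.ball (0 : E N) 1).indicator (fun z => ‖z‖ ^ (-α)) with hh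
  have hintg : Integrable h := (integrableOn_pow_ball hN hα 1).integrable_indicator measurableSet_ball
  have hint2 : Integrable (fun y => h (x - y)) := hintg.comp_sub_left x
  have hle : ∀ y, ‖x - y‖ ^ (-α) ≤ h (x - y) + 1 := by
    intro y
    by_cases hy : x - y ∈ Metric.ball (0 : E N) 1
    · simp [hh, hy, Set.indicator_of_mem]
    · rw [hh, Set.indicator_of_notMem hy, zero_add]
      apply Real.rpow_le_one_of_one_le_of_nonpos
      · simpa using hy
      · linarith
  have hb : IntegrableOn (fun y => h (x - y) + 1) (Metric.ball (0 : E N) R) := by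
    apply hint2.integrableOn.add
    exact integrableOn_const (by exact measure_ball_lt_top.ne)
  have hmeas : Measurable (fun y : E N => ‖x - y‖ ^ (-α)) := by fun_prop
  have hi : IntegrableOn (fun y : E N => ‖x - y‖ ^ (-α)) (Metric.ball 0 R) := by
    refine hb.mono' hmeas.aestronglyMeasurable (ae_of_all _ fun y => ?_)
    rw [Real.norm_of_nonneg (by positivity)]; exact hle y
  refine ⟨hi, (setIntegral_mono hi hb hle).trans ?_⟩
  rw [integral_add hint2.integrableOn (integrableOn_const (by exact measure_ball_lt_top.ne))]
  have h1 : ∫ y in Metric.ball (0 : E N) R, h (x - y) ≤ ∫ y, h (x - y) :=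
    setIntegral_le_integral hint2 (ae_of_all _ fun y => by
      simp only [hh]; exact Set.indicator_nonneg (fun z _ => by positivity) _)
  have h2 : ∫ y, h (x - y) = ∫ z in Metric.ball (0 : E N) 1, ‖z‖ ^ (-α) := by
    rw [integral_sub_left_eq_self h, hh, integral_indicator measurableSet_ball]
  rw [h2] at h1
  have h3 : ∫ y in Metric.ball (0 : E N) R, (1 : ℝ) = volume.real (Metric.ball (0 : E N) R) := by simp
  linarith

/-- data of a bounded compactly supported density -/
structure Dens (N : ℕ) (g : E N → ℝ) (M R : ℝ) : Prop where
  meas : Measurable g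
  nn : 0 ≤ M
  bd : ∀ y, |g y| ≤ M
  supp : ∀ y, R ≤ ‖y‖ → g y = 0

lemma Dens.integrable_smul {N : ℕ} (hN : 3 ≤ N) {g : E N → ℝ} {M R : ℝ} (hg : Dens N g M R)
    {F : Type*} [NormedAddCommGroup F] [NormedSpace ℝ F] [MeasurableSpace F] [BorelSpace F]
    [SecondCountableTopology F]
    {k : E N → F} (hk : Measurable k) {α C : ℝ} (h0 : 0 ≤ α) (hα : α < N)
    (hkα : ∀ z, z ≠ 0 → ‖k z‖ ≤ C * ‖z‖ ^ (-α)) (x : E N) :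
    Integrable (fun y => g y • k (x - y)) ∧
    ∫ y, ‖g y • k (x - y)‖ ≤ ∫ y in Metric.ball 0 R, M * (C * ‖x - y‖ ^ (-α)) := by
  have : Nonempty (Fin N) := ⟨⟨0, by omega⟩⟩
  have hsupp : Function.support (fun y => g y • k (x - y)) ⊆ Metric.ball 0 R := by
    intro y hy
    by_contra hc
    apply hy
    simp only [Metric.mem_ball, dist_zero_right, not_lt] at hc
    simp [hg.supp y hc]
  have hae : ∀ᵐ y ∂(volume.restrict (Metric.ball (0 : E N) R)),
      ‖g y • k (x - y)‖ ≤ M * (C * ‖x - y‖ ^ (-α)) := by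
    have : ∀ᵐ y : E N, y ≠ x := by simp [ae_iff]
    refine ae_restrict_of_ae (this.mono fun y hy => ?_)
    rw [norm_smul]
    have := hkα (x - y) (sub_ne_zero.mpr hy.symm)
    exact mul_le_mul (hg.bd y) this (norm_nonneg _) hg.nn
  have hb : IntegrableOn (fun y => M * (C * ‖x - y‖ ^ (-α))) (Metric.ball (0 : E N) R) :=
    ((kernel_shift hN h0 hα R x).1.const_mul C).const_mul M
  have hm : Measurable (fun y => g y • k (x - y)) :=
    hg.meas.smul (hk.comp (measurable_const.sub measurable_id))
  have hi : IntegrableOn (fun y => g y • k (x - y)) (Metric.ball (0 : E N) R) :=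
    hb.mono' hm.aestronglyMeasurable hae
  refine ⟨(integrableOn_iff_integrable_of_support_subset hsupp).mp hi, ?_⟩
  rw [← setIntegral_eq_integral_of_forall_compl_eq_zero (s := Metric.ball 0 R)]
  · exact integral_mono_ae hi.norm hb hae
  · intro y hy
    have : g y • k (x - y) = 0 := by
      by_contra hc; exact hy (hsupp hc)
    rw [this, norm_zero]

lemma Dens.tendsto_unif {N : ℕ} (hN : 3 ≤ N) {g : E N → ℝ} {M R : ℝ} (hg : Dens N g M R)
    {F : Type*} [NormedAddCommGroup F] [NormedSpace ℝ F] [MeasurableSpace F] [BorelSpace F]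
    [SecondCountableTopology F]
    {k : E N → F} {kn : ℕ → E N → F} (hk : Measurable k) (hkn : ∀ n, Measurable (kn n))
    {α C : ℝ} (h0 : 0 ≤ α) (hα : α < N)
    (hkα : ∀ z, z ≠ 0 → ‖k z‖ ≤ C * ‖z‖ ^ (-α))
    (hknα : ∀ n z, z ≠ 0 → ‖kn n z‖ ≤ C * ‖z‖ ^ (-α))
    (hlim : ∀ z, z ≠ 0 → Tendsto (fun n => kn n z) atTop (𝓝 (k z))) (L : ℝ) :
    TendstoUniformlyOn (fun n x => ∫ y, g y • kn n (x - y)) (fun x => ∫ y, g y • k (x - y))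
      atTop (Metric.ball 0 L) := by
  have : Nonempty (Fin N) := ⟨⟨0, by omega⟩⟩
  have hne : ∀ᵐ z : E N, z ≠ 0 := by simp [ae_iff]
  have hball : IntegrableOn (fun z : E N => 2 * (C * ‖z‖ ^ (-α))) (Metric.ball 0 (L + R)) :=
    ((integrableOn_pow_ball hN hα _).const_mul C).const_mul 2
  have hbd : ∀ n, ∀ᵐ z ∂(volume.restrict (Metric.ball (0 : E N) (L + R))),
      ‖kn n z - k z‖ ≤ 2 * (C * ‖z‖ ^ (-α)) := fun n =>
    ae_restrict_of_ae (hne.mono fun z hz => (norm_sub_le _ _).trans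
      (by linarith [hkα z hz, hknα n z hz]))
  have hintd : ∀ n, IntegrableOn (fun z => ‖kn n z - k z‖) (Metric.ball (0 : E N) (L + R)) := fun n =>
    hball.mono' ((hkn n).sub hk).norm.aestronglyMeasurable (by simpa using hbd n)
  have hD : Tendsto (fun n => ∫ z in Metric.ball (0 : E N) (L + R), ‖kn n z - k z‖) atTop (𝓝 0) := by
    have := tendsto_integral_of_dominated_convergence (μ := volume.restrict (Metric.ball (0 : E N) (L + R)))
      (F := fun n z => ‖kn n z - k z‖) (f := fun _ => (0 : ℝ)) (fun z : E N => 2 * (C * ‖z‖ ^ (-α)))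
      (fun n => ((hkn n).sub hk).norm.aestronglyMeasurable) hball (fun n => by simpa using hbd n)
      (ae_restrict_of_ae (hne.mono fun z hz => by
        have := (hlim z hz).sub_const (k z)
        simpa using this.norm))
    simpa using this
  rw [Metric.tendstoUniformlyOn_iff]
  intro ε hε
  have hD' : Tendsto (fun n => M * ∫ z in Metric.ball (0 : E N) (L + R), ‖kn n z - k z‖) atTop (𝓝 0) := by
    simpa using hD.const_mul M
  filter_upwards [(tendsto_order.1 hD').2 ε hε] with n hn x hx
  rw [dist_eq_norm, ← integral_sub (hg.integrable_smul hN hk h0 hα hkα x).1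
    (hg.integrable_smul hN (hkn n) h0 hα (hknα n) x).1]
  refine lt_of_le_of_lt ?_ hn
  refine (norm_integral_le_integral_norm _).trans ?_
  set h : E N → ℝ := (Metric.ball (0 : E N) (L + R)).indicator (fun z => ‖kn n z - k z‖) with hh
  have hintg : Integrable h := (hintd n).integrable_indicator measurableSet_ball
  have hint2 : Integrable (fun y => h (x - y)) := hintg.comp_sub_left x
  have hle : ∀ y, ‖g y • k (x - y) - g y • kn n (x - y)‖ ≤ M * h (x - y) := by
    intro y
    rcases le_or_gt R ‖y‖ with hy | hy
    · rw [hg.supp y hy]; simp only [zero_smul, sub_zero, norm_zero]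
      exact mul_nonneg hg.nn (Set.indicator_nonneg (fun z _ => norm_nonneg _) _)
    · have : x - y ∈ Metric.ball (0 : E N) (L + R) := by
        simp only [Metric.mem_ball, dist_zero_right] at hx ⊢
        exact (norm_sub_le _ _).trans_lt (by linarith)
      rw [hh, Set.indicator_of_mem this, ← smul_sub, norm_smul, norm_sub_rev]
      exact mul_le_mul_of_nonneg_right (hg.bd y) (norm_nonneg _)
  calc _ ≤ ∫ y, M * h (x - y) := by
        refine integral_mono_of_nonneg (ae_of_all _ fun y => norm_nonneg _) (hint2.const_mul M)
          (ae_of_all _ hle)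
    _ = _ := by
        rw [integral_const_mul, integral_sub_left_eq_self h, hh, integral_indicator measurableSet_ball]

end NR

open MeasureTheory Real Set

namespace NR
open Filter Topology

lemma Dens.bound {N : ℕ} (hN : 3 ≤ N) {g : E N → ℝ} {M R : ℝ} (hg : Dens N g M R)
    {F : Type*} [NormedAddCommGroup F] [NormedSpace ℝ F] [MeasurableSpace F] [BorelSpace F]
    [SecondCountableTopology F]
    {k : E N → F} (hk : Measurable k) {α C : ℝ} (h0 : 0 ≤ α) (hα : α < N) (hC : 0 ≤ C)
    (hkα : ∀ z, z ≠ 0 → ‖k z‖ ≤ C * ‖z‖ ^ (-α)) (x : E N) :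
    ‖∫ y, g y • k (x - y)‖ ≤ M * (C * ((∫ z in Metric.ball (0 : E N) 1, ‖z‖ ^ (-α))
      + volume.real (Metric.ball (0 : E N) R))) := by
  refine (norm_integral_le_integral_norm _).trans
    ((hg.integrable_smul hN hk h0 hα hkα x).2.trans ?_)
  rw [integral_const_mul, integral_const_mul]
  have := hg.nn
  gcongr
  exact (kernel_shift hN h0 hα R x).2

lemma Dens.far {N : ℕ} (hN : 3 ≤ N) {g : E N → ℝ} {M R : ℝ} (hR : 0 < R) (hg : Dens N g M R)
    {F : Type*} [NormedAddCommGroup F] [NormedSpace ℝ F] [MeasurableSpace F] [BorelSpace F]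
    [SecondCountableTopology F]
    {k : E N → F} (hk : Measurable k) {α C : ℝ} (h0 : 0 ≤ α) (hα : α < N) (hC : 0 ≤ C)
    (hkα : ∀ z, z ≠ 0 → ‖k z‖ ≤ C * ‖z‖ ^ (-α)) (x : E N) (hx : 2 * R ≤ ‖x‖) :
    ‖∫ y, g y • k (x - y)‖ ≤ M * (C * ((‖x‖ / 2) ^ (-α)
      * volume.real (Metric.ball (0 : E N) R))) := by
  refine (norm_integral_le_integral_norm _).trans
    ((hg.integrable_smul hN hk h0 hα hkα x).2.trans ?_)
  rw [integral_const_mul, integral_const_mul]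
  have := hg.nn
  gcongr
  have h1 : ∀ y ∈ Metric.ball (0 : E N) R, ‖x - y‖ ^ (-α) ≤ (‖x‖ / 2) ^ (-α) := by
    intro y hy
    simp only [Metric.mem_ball, dist_zero_right] at hy
    apply Real.rpow_le_rpow_of_nonpos (by linarith) _ (by linarith)
    have := norm_sub_norm_le x y
    linarith
  calc _ ≤ ∫ y in Metric.ball (0 : E N) R, (‖x‖ / 2) ^ (-α) :=
        setIntegral_mono_on (kernel_shift hN h0 hα R x).1
          (integrableOn_const (by exact measure_ball_lt_top.ne)) measurableSet_ball h1
    _ = _ := by simp [mul_comm]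

noncomputable def NPa (N : ℕ) (a : ℝ) (g : E N → ℝ) (x : E N) : ℝ := ∫ y, g y • Gam N a (x - y)
noncomputable def dNPa (N : ℕ) (a : ℝ) (g : E N → ℝ) (x : E N) : E N := ∫ y, g y • dGam N a (x - y)

lemma measurable_Gam (N : ℕ) (a : ℝ) : Measurable (Gam N a) := by unfold Gam; fun_prop
lemma measurable_dGam (N : ℕ) (a : ℝ) : Measurable (dGam N a) := by unfold dGam; fun_prop

lemma Gam_le2 {N : ℕ} (hN : 3 ≤ N) {a : ℝ} (ha : 0 ≤ a) (x : E N) (hx : x ≠ 0) :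
    ‖Gam N a x‖ ≤ 1 * ‖x‖ ^ (-((N : ℝ) - 2)) := by
  rw [Real.norm_of_nonneg (Gam_nonneg N ha x), one_mul, neg_sub]; exact Gam_le hN ha hx

lemma dGam_le2 {N : ℕ} (hN : 3 ≤ N) {a : ℝ} (ha : 0 ≤ a) (x : E N) (hx : x ≠ 0) :
    ‖dGam N a x‖ ≤ (N - 2) * ‖x‖ ^ (-((N : ℝ) - 1)) := by
  rw [neg_sub]; exact norm_dGam_le hN ha hx

lemma continuous_Gam (N : ℕ) {a : ℝ} (ha : 0 < a) : Continuous (Gam N a) := by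
  unfold Gam
  exact (by fun_prop : Continuous fun x : E N => ‖x‖ ^ 2 + a).rpow_const
    (fun x => Or.inl (by positivity))

lemma continuous_dGam (N : ℕ) {a : ℝ} (ha : 0 < a) : Continuous (dGam N a) := by
  unfold dGam
  exact (continuous_const.mul ((by fun_prop : Continuous fun x : E N => ‖x‖ ^ 2 + a).rpow_const
    (fun x => Or.inl (by positivity)))).smul continuous_id

lemma dGam_bdd {N : ℕ} (hN : 3 ≤ N) {a : ℝ} (ha : 0 < a) (x : E N) :
    ‖dGam N a x‖ ≤ (N - 2) * a ^ (((1 : ℝ) - N) / 2) := by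
  have hN' : (3 : ℝ) ≤ N := by exact_mod_cast hN
  refine (norm_dGam_le' hN ha.le (by positivity)).trans ?_
  have : (0 : ℝ) ≤ N - 2 := by linarith
  refine mul_le_mul_of_nonneg_left ?_ this
  exact Real.rpow_le_rpow_of_nonpos ha (by nlinarith [sq_nonneg ‖x‖]) (by linarith)

lemma Dens.int_bound {N : ℕ} {g : E N → ℝ} {M R : ℝ} (hg : Dens N g M R) (C : ℝ) (hC : 0 ≤ C) :
    Integrable ((Metric.ball (0 : E N) R).indicator fun _ => M * C) ∧
    ∀ {F : Type} [NormedAddCommGroup F] [NormedSpace ℝ F] (v : F) (y : E N), ‖v‖ ≤ C →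
      ‖g y • v‖ ≤ (Metric.ball (0 : E N) R).indicator (fun _ => M * C) y := by
  refine ⟨(integrableOn_const (by exact measure_ball_lt_top.ne)).integrable_indicator
    measurableSet_ball, ?_⟩
  intro F _ _ v y hv
  rcases le_or_gt R ‖y‖ with h | h
  · simp only [hg.supp y h, zero_smul, norm_zero]
    exact indicator_nonneg (fun _ _ => mul_nonneg hg.nn hC) _
  · rw [indicator_of_mem (by simpa using h), norm_smul]
    exact mul_le_mul (hg.bd y) hv (norm_nonneg _) hg.nn

lemma Dens.continuous_dNPa {N : ℕ} (hN : 3 ≤ N) {g : E N → ℝ} {M R : ℝ} (hg : Dens N g M R)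
    {a : ℝ} (ha : 0 < a) : Continuous (dNPa N a g) := by
  have hN' : (3 : ℝ) ≤ N := by exact_mod_cast hN
  have hC : (0 : ℝ) ≤ (N - 2) * a ^ (((1 : ℝ) - N) / 2) := by
    have : (0 : ℝ) ≤ N - 2 := by linarith
    positivity
  refine continuous_of_dominated (bound := (Metric.ball (0 : E N) R).indicator
    (fun _ => M * ((N - 2) * a ^ (((1 : ℝ) - N) / 2)))) ?_ ?_ (hg.int_bound _ hC).1 ?_
  · intro x
    exact (hg.meas.smul ((measurable_dGam N a).comp
      (measurable_const.sub measurable_id))).aestronglyMeasurable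
  · intro x
    exact ae_of_all _ fun y => (hg.int_bound _ hC).2 _ y (dGam_bdd hN ha _)
  · exact ae_of_all _ fun y => (continuous_const (y := g y)).smul
      ((continuous_dGam N ha).comp (continuous_id.sub continuous_const))

lemma Dens.hasFDerivAt_NPa {N : ℕ} (hN : 3 ≤ N) {g : E N → ℝ} {M R : ℝ} (hg : Dens N g M R)
    {a : ℝ} (ha : 0 < a) (x : E N) : HasFDerivAt (NPa N a g) (innerSL ℝ (dNPa N a g x)) x := by
  have hN' : (3 : ℝ) ≤ N := by exact_mod_cast hN
  have hC : (0 : ℝ) ≤ (N - 2) * a ^ (((1 : ℝ) - N) / 2) := by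
    have : (0 : ℝ) ≤ N - 2 := by linarith
    positivity
  have hi1 := fun x => (hg.integrable_smul hN (measurable_Gam N a) (α := (N : ℝ) - 2) (by linarith)
    (by linarith) (fun z hz => Gam_le2 hN ha.le z hz) x).1
  have hi2 := (hg.integrable_smul hN (measurable_dGam N a) (α := (N : ℝ) - 1) (by linarith)
    (by linarith) (fun z hz => dGam_le2 hN ha.le z hz) x).1
  have hcd : Continuous fun y => innerSL ℝ (dGam N a (x - y)) :=
    (innerSL ℝ).continuous.comp ((continuous_dGam N ha).comp (by fun_prop))
  have hb : ∀ y z : E N, ‖g y • innerSL ℝ (dGam N a (z - y))‖ ≤ (Metric.ball (0 : E N) R).indicator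
      (fun _ => M * ((N - 2) * a ^ (((1 : ℝ) - N) / 2))) y := by
    intro y z
    have := (hg.int_bound _ hC).2 (dGam N a (z - y)) y (dGam_bdd hN ha _)
    rw [norm_smul] at this
    rw [norm_smul, innerSL_apply_norm]
    exact this
  have hder : ∀ y z : E N, HasFDerivAt (fun x => g y • Gam N a (x - y))
      (g y • innerSL ℝ (dGam N a (z - y))) z := by
    intro y z
    have h1 : HasFDerivAt (fun z : E N => z - y) (ContinuousLinearMap.id ℝ (E N)) z :=
      (hasFDerivAt_id z).sub_const y
    exact ((hasFDerivAt_Gam N ha (z - y)).comp z h1).const_smul (g y)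
  have key := hasFDerivAt_integral_of_dominated_of_fderiv_le (𝕜 := ℝ) (μ := volume)
    (F := fun x y => g y • Gam N a (x - y)) (F' := fun x y => g y • innerSL ℝ (dGam N a (x - y)))
    (x₀ := x) (s := univ) (bound := (Metric.ball (0 : E N) R).indicator
    (fun _ => M * ((N - 2) * a ^ (((1 : ℝ) - N) / 2)))) univ_mem
    (Eventually.of_forall fun x => (hi1 x).aestronglyMeasurable) (hi1 x)
    (hg.meas.aestronglyMeasurable.smul hcd.aestronglyMeasurable)
    (ae_of_all _ fun y z _ => hb y z) (hg.int_bound _ hC).1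
    (ae_of_all _ fun y z _ => hder y z)
  refine key.congr_fderiv ?_
  have hi3 : Integrable fun y => g y • innerSL ℝ (dGam N a (x - y)) := by
    refine hi2.mono (hg.meas.aestronglyMeasurable.smul hcd.aestronglyMeasurable)
      (ae_of_all _ fun y => ?_)
    rw [norm_smul, norm_smul, innerSL_apply_norm]
  ext v
  rw [ContinuousLinearMap.integral_apply hi3, innerSL_apply_apply, real_inner_comm, dNPa,
    ← integral_inner hi2]
  congr 1; ext y
  simp [real_inner_smul_right, real_inner_comm]

noncomputable def NP (N : ℕ) (g : E N → ℝ) (x : E N) : ℝ := NPa N 0 g x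
noncomputable def dNP (N : ℕ) (g : E N → ℝ) (x : E N) : E N := dNPa N 0 g x

noncomputable def an (n : ℕ) : ℝ := 1 / ((n : ℝ) + 1)
lemma an_pos (n : ℕ) : 0 < an n := by unfold an; positivity
lemma an_tendsto : Tendsto an atTop (𝓝 0) := tendsto_one_div_add_atTop_nhds_zero_nat

lemma Dens.tendsto_NP {N : ℕ} (hN : 3 ≤ N) {g : E N → ℝ} {M R : ℝ} (hg : Dens N g M R) (L : ℝ) :
    TendstoUniformlyOn (fun n => NPa N (an n) g) (NP N g) atTop (Metric.ball 0 L) := by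
  have hN' : (3 : ℝ) ≤ N := by exact_mod_cast hN
  refine hg.tendsto_unif hN (measurable_Gam N 0) (fun n => measurable_Gam N (an n))
    (α := (N : ℝ) - 2) (C := 1) (by linarith) (by linarith)
    (fun z hz => Gam_le2 hN le_rfl z hz) (fun n z hz => Gam_le2 hN (an_pos n).le z hz) ?_ L
  intro z hz
  have hz' : 0 < ‖z‖ := norm_pos_iff.mpr hz
  unfold Gam
  have : Tendsto (fun n => ‖z‖ ^ 2 + an n) atTop (𝓝 (‖z‖ ^ 2 + 0)) := an_tendsto.const_add _
  exact this.rpow_const (Or.inl (by positivity))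

lemma Dens.tendsto_dNP {N : ℕ} (hN : 3 ≤ N) {g : E N → ℝ} {M R : ℝ} (hg : Dens N g M R) (L : ℝ) :
    TendstoUniformlyOn (fun n => dNPa N (an n) g) (dNP N g) atTop (Metric.ball 0 L) := by
  have hN' : (3 : ℝ) ≤ N := by exact_mod_cast hN
  refine hg.tendsto_unif hN (measurable_dGam N 0) (fun n => measurable_dGam N (an n))
    (α := (N : ℝ) - 1) (C := N - 2) (by linarith) (by linarith)
    (fun z hz => dGam_le2 hN le_rfl z hz) (fun n z hz => dGam_le2 hN (an_pos n).le z hz) ?_ L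
  intro z hz
  have hz' : 0 < ‖z‖ := norm_pos_iff.mpr hz
  unfold dGam
  have : Tendsto (fun n => ‖z‖ ^ 2 + an n) atTop (𝓝 (‖z‖ ^ 2 + 0)) := an_tendsto.const_add _
  exact (((this.rpow_const (Or.inl (by positivity)))).const_mul _).smul_const z

lemma Dens.hasFDerivAt_NP {N : ℕ} (hN : 3 ≤ N) {g : E N → ℝ} {M R : ℝ} (hg : Dens N g M R)
    (x : E N) : HasFDerivAt (NP N g) (innerSL ℝ (dNP N g x)) x := by
  have hx : x ∈ Metric.ball (0 : E N) (‖x‖ + 1) := by simp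
  refine hasFDerivAt_of_tendstoUniformlyOn (l := atTop) (s := Metric.ball (0 : E N) (‖x‖ + 1))
    (f := fun n => NPa N (an n) g) (f' := fun n x => innerSL ℝ (dNPa N (an n) g x))
    (g' := fun x => innerSL ℝ (dNP N g x))
    Metric.isOpen_ball ?_ (fun n y _ => hg.hasFDerivAt_NPa hN (an_pos n) y)
    (fun y hy => (hg.tendsto_NP hN _).tendsto_at hy) hx
  exact ((innerSL ℝ (E := E N)).uniformContinuous).comp_tendstoUniformlyOn (hg.tendsto_dNP hN _)

lemma Dens.continuous_dNP {N : ℕ} (hN : 3 ≤ N) {g : E N → ℝ} {M R : ℝ} (hg : Dens N g M R) :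
    Continuous (dNP N g) := by
  rw [continuous_iff_continuousAt]
  intro x
  have := (hg.tendsto_dNP hN (‖x‖ + 1)).continuousOn
    (Frequently.of_forall fun n => (hg.continuous_dNPa hN (an_pos n)).continuousOn)
  exact this.continuousAt (Metric.isOpen_ball.mem_nhds (by simp))

lemma Dens.NP_bound {N : ℕ} (hN : 3 ≤ N) (R : ℝ) : ∃ C, 0 ≤ C ∧ ∀ {g : E N → ℝ} {M : ℝ},
    Dens N g M R → ∀ x, |NP N g x| ≤ C * M ∧ ‖dNP N g x‖ ≤ C * M := by
  have hN' : (3 : ℝ) ≤ N := by exact_mod_cast hN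
  have h2 : (0 : ℝ) ≤ N - 2 := by linarith
  set C1 := (∫ z in Metric.ball (0 : E N) 1, ‖z‖ ^ (-((N : ℝ) - 2)))
      + volume.real (Metric.ball (0 : E N) R)
  set C2 := (N - 2 : ℝ) * ((∫ z in Metric.ball (0 : E N) 1, ‖z‖ ^ (-((N : ℝ) - 1)))
      + volume.real (Metric.ball (0 : E N) R))
  have hC1 : 0 ≤ C1 := add_nonneg (integral_nonneg fun z => by positivity) measureReal_nonneg
  have hC2 : 0 ≤ C2 := mul_nonneg h2
    (add_nonneg (integral_nonneg fun z => by positivity) measureReal_nonneg)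
  refine ⟨C1 + C2, by positivity, fun {g M} hg x => ⟨?_, ?_⟩⟩
  · have := hg.bound hN (measurable_Gam N 0) (α := (N : ℝ) - 2) (by linarith)
      (by linarith) zero_le_one (fun z hz => Gam_le2 hN le_rfl z hz) x
    rw [one_mul] at this
    refine (this : |NP N g x| ≤ M * C1).trans ?_
    nlinarith [hg.nn]
  · have := hg.bound hN (measurable_dGam N 0) (α := (N : ℝ) - 1) (by linarith)
      (by linarith) h2 (fun z hz => dGam_le2 hN le_rfl z hz) x
    refine (this : ‖dNP N g x‖ ≤ M * C2).trans ?_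
    nlinarith [hg.nn]

lemma Dens.NP_far {N : ℕ} (hN : 3 ≤ N) {R : ℝ} (hR : 0 < R) : ∃ C, 0 ≤ C ∧ ∀ {g : E N → ℝ} {M : ℝ},
    Dens N g M R → ∀ x, 2 * R ≤ ‖x‖ → |NP N g x| ≤ C * M * ‖x‖ ^ ((2 : ℝ) - N) ∧
      ‖dNP N g x‖ ≤ C * M * ‖x‖ ^ ((1 : ℝ) - N) := by
  have hN' : (3 : ℝ) ≤ N := by exact_mod_cast hN
  have h2 : (0 : ℝ) ≤ N - 2 := by linarith
  set V := volume.real (Metric.ball (0 : E N) R)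
  have hV : 0 ≤ V := measureReal_nonneg
  set C1 := (2 : ℝ) ^ ((N : ℝ) - 2) * V
  set C2 := (N - 2 : ℝ) * ((2 : ℝ) ^ ((N : ℝ) - 1) * V)
  have hC1 : 0 ≤ C1 := by positivity
  have hC2 : 0 ≤ C2 := by positivity
  have hdiv : ∀ (x : E N) (α : ℝ), (‖x‖ / 2) ^ (-α) = 2 ^ α * ‖x‖ ^ (-α) := by
    intro x α
    rw [Real.div_rpow (norm_nonneg _) (by norm_num), Real.rpow_neg (by norm_num : (0:ℝ) ≤ 2)]
    field_simp
  refine ⟨C1 + C2, by positivity, fun {g M} hg x hx => ⟨?_, ?_⟩⟩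
  · have := hg.far hN hR (measurable_Gam N 0) (α := (N : ℝ) - 2) (by linarith)
      (by linarith) zero_le_one (fun z hz => Gam_le2 hN le_rfl z hz) x hx
    rw [one_mul, hdiv, neg_sub] at this
    have h3 : (0 : ℝ) ≤ ‖x‖ ^ ((2 : ℝ) - N) := by positivity
    refine (this : |NP N g x| ≤ _).trans ?_
    have : M * (2 ^ ((N : ℝ) - 2) * ‖x‖ ^ ((2 : ℝ) - N) * V) = C1 * (M * ‖x‖ ^ ((2 : ℝ) - N)) := by
      simp only [C1]; ring
    rw [this]
    nlinarith [mul_nonneg hC2 (mul_nonneg hg.nn h3)]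
  · have := hg.far hN hR (measurable_dGam N 0) (α := (N : ℝ) - 1) (by linarith)
      (by linarith) h2 (fun z hz => dGam_le2 hN le_rfl z hz) x hx
    rw [hdiv, neg_sub] at this
    have h3 : (0 : ℝ) ≤ ‖x‖ ^ ((1 : ℝ) - N) := by positivity
    refine (this : ‖dNP N g x‖ ≤ _).trans ?_
    have : M * ((N - 2) * (2 ^ ((N : ℝ) - 1) * ‖x‖ ^ ((1 : ℝ) - N) * V)) = C2 * (M * ‖x‖ ^ ((1 : ℝ) - N)) := by
      simp only [C2]; ring
    rw [this]
    nlinarith [mul_nonneg hC1 (mul_nonneg hg.nn h3)]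

end NR

open MeasureTheory Real Set

namespace NR
open Filter Topology

lemma inner_grad {N : ℕ} (u : E N → ℝ) (x v : E N) : inner ℝ (gradient u x) v = fderiv ℝ u x v := by
  unfold gradient; exact InnerProductSpace.toDual_symm_apply

lemma grad_of_hasFDerivAt {N : ℕ} {u : E N → ℝ} {x w : E N} (h : HasFDerivAt u (innerSL ℝ w) x) :
    gradient u x = w := by
  apply ext_inner_right ℝ
  intro v; rw [inner_grad, h.fderiv]; rfl

lemma continuous_grad {N : ℕ} {u : E N → ℝ} (h : ContDiff ℝ 1 u) : Continuous (gradient u) := by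
  unfold gradient
  exact (LinearIsometryEquiv.continuous _).comp (h.continuous_fderiv one_ne_zero)

lemma grad_zero_of_notMem {N : ℕ} {u : E N → ℝ} {x : E N} (h : x ∉ tsupport u) :
    gradient u x = 0 := by
  have : fderiv ℝ u x = 0 := by
    by_contra hc
    exact h (support_fderiv_subset ℝ hc)
  simp [gradient, this]

lemma cptsupp_grad {N : ℕ} {u : E N → ℝ} (h : HasCompactSupport u) :
    HasCompactSupport (gradient u) := by
  refine HasCompactSupport.intro h fun x hx => grad_zero_of_notMem hx

lemma norm_grad {N : ℕ} (u : E N → ℝ) (x : E N) : ‖gradient u x‖ = ‖fderiv ℝ u x‖ := by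
  unfold gradient; exact LinearIsometryEquiv.norm_map _ _

noncomputable def Psi (N : ℕ) (a : ℝ) (x : E N) : ℝ :=
  N * (N - 2) * a * (‖x‖ ^ 2 + a) ^ (-((N : ℝ) + 2) / 2)

noncomputable def Dg (N : ℕ) (a : ℝ) (i : Fin N) (z : E N) : ℝ :=
  (2 - N) * (‖z‖ ^ 2 + a) ^ (-(N : ℝ) / 2) + (2 - N) * (-(N : ℝ)) * (‖z‖ ^ 2 + a) ^ (-((N : ℝ) + 2) / 2) * z i ^ 2

lemma sum_Dg {N : ℕ} {a : ℝ} (ha : 0 < a) (z : E N) : ∑ i, Dg N a i z = - Psi N a z := by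
  unfold Dg Psi
  rw [Finset.sum_add_distrib, ← Finset.mul_sum _ _ ((2 - (N : ℝ)) * -(N : ℝ) * _), ← EuclideanSpace.real_norm_sq_eq]
  have : (‖z‖ ^ 2 + a) ^ (-(N : ℝ) / 2) = (‖z‖ ^ 2 + a) ^ (-((N : ℝ) + 2) / 2) * (‖z‖ ^ 2 + a) := by
    rw [← Real.rpow_add_one (by positivity)]; congr 1; ring
  rw [this]; simp; ring

lemma dGam_coord_deriv {N : ℕ} {a : ℝ} (ha : 0 < a) (y : E N) (i : Fin N) (x : E N) :
    DifferentiableAt ℝ (fun x => dGam N a (x - y) i) x ∧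
    fderiv ℝ (fun x => dGam N a (x - y) i) x (EuclideanSpace.single i 1) = Dg N a i (x - y) := by
  have h0 : HasFDerivAt (fun z : E N => z - y) (ContinuousLinearMap.id ℝ (E N)) x :=
      (hasFDerivAt_id x).sub_const y
  have h1 : HasFDerivAt (fun x : E N => ‖x‖ ^ 2 + a) ((2 : ℝ) • innerSL ℝ (x - y)) (x - y) := by
    have := (hasStrictFDerivAt_norm_sq (x - y)).hasFDerivAt
    refine (this.add_const a).congr_fderiv ?_
    ext v; simp [two_smul]
  have h2 := ((h1.rpow_const (p := -(N : ℝ) / 2) (Or.inl (by positivity))).const_mul (2 - (N : ℝ)))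
  have h3 : HasFDerivAt (fun z : E N => z i) (EuclideanSpace.proj i : E N →L[ℝ] ℝ) (x - y) :=
    (EuclideanSpace.proj i : E N →L[ℝ] ℝ).hasFDerivAt
  have h4 := (h2.mul h3).comp x h0
  have h5 : (fun x => dGam N a (x - y) i) = ((fun z => (2 - (N : ℝ)) * (‖z‖ ^ 2 + a) ^ (-(N : ℝ) / 2)) *
      fun z : E N => z i) ∘ fun z => z - y := by
    ext z; simp [dGam]
  rw [h5]
  refine ⟨h4.differentiableAt, ?_⟩
  rw [h4.fderiv]
  have : -(N : ℝ) / 2 - 1 = -((N : ℝ) + 2) / 2 := by ring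
  simp [Dg, this, EuclideanSpace.inner_single_right]
  ring

lemma continuous_Dg {N : ℕ} {a : ℝ} (ha : 0 < a) (i : Fin N) : Continuous (Dg N a i) := by
  have h : ∀ s : ℝ, Continuous fun x : E N => (‖x‖ ^ 2 + a) ^ s := fun s =>
    (by fun_prop : Continuous fun x : E N => ‖x‖ ^ 2 + a).rpow_const
    (fun x => Or.inl (by positivity))
  unfold Dg
  exact (continuous_const.mul (h _)).add ((continuous_const.mul (h _)).mul (by fun_prop))

lemma continuous_Psi {N : ℕ} {a : ℝ} (ha : 0 < a) : Continuous (Psi N a) := by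
  have h : ∀ s : ℝ, Continuous fun x : E N => (‖x‖ ^ 2 + a) ^ s := fun s =>
    (by fun_prop : Continuous fun x : E N => ‖x‖ ^ 2 + a).rpow_const
    (fun x => Or.inl (by positivity))
  unfold Psi
  exact (continuous_const.mul (h _))

lemma fderiv_sum {N : ℕ} (L : E N →L[ℝ] ℝ) (v : E N) :
    L v = ∑ i, v i * L (EuclideanSpace.single i 1) := by
  conv_lhs => rw [← (EuclideanSpace.basisFun (Fin N) ℝ).sum_repr v]
  simp

lemma divergence_step {N : ℕ} {a : ℝ} (ha : 0 < a) (y : E N) {φ : E N → ℝ}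
    (hφ : ContDiff ℝ 1 φ) (hc : HasCompactSupport φ) :
    ∫ x, inner ℝ (dGam N a (x - y)) (gradient φ x) = ∫ x, Psi N a (x - y) * φ x := by
  have hcd : Continuous fun x => dGam N a (x - y) := (continuous_dGam N ha).comp (by fun_prop)
  have hcf : ∀ i : Fin N, Continuous fun x => fderiv ℝ φ x (EuclideanSpace.single i 1) := fun i =>
    (hφ.continuous_fderiv one_ne_zero).clm_apply continuous_const
  have hcs : ∀ i : Fin N, HasCompactSupport fun x => fderiv ℝ φ x (EuclideanSpace.single i 1) :=
    fun i => hc.fderiv_apply ℝ _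
  have hDg : ∀ i, Continuous fun x => Dg N a i (x - y) := fun i =>
    (continuous_Dg ha i).comp (by fun_prop)
  have hco : ∀ i, Continuous fun x => dGam N a (x - y) i := fun i =>
    (EuclideanSpace.proj i : E N →L[ℝ] ℝ).continuous.comp hcd
  have hi1 : ∀ i : Fin N, Integrable fun x => dGam N a (x - y) i * fderiv ℝ φ x (EuclideanSpace.single i 1) :=
    fun i => ((hco i).mul (hcf i)).integrable_of_hasCompactSupport (hcs i).mul_left
  have hi2 : ∀ i : Fin N, Integrable fun x => Dg N a i (x - y) * φ x := fun i =>
    ((hDg i).mul hφ.continuous).integrable_of_hasCompactSupport hc.mul_left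
  have hi3 : ∀ i : Fin N, Integrable fun x => dGam N a (x - y) i * φ x := fun i =>
    ((hco i).mul hφ.continuous).integrable_of_hasCompactSupport hc.mul_left
  have hfd : ∀ i, (fun x => fderiv ℝ (fun x => dGam N a (x - y) i) x (EuclideanSpace.single i 1) * φ x)
      = fun x => Dg N a i (x - y) * φ x := fun i => by
    ext x; rw [(dGam_coord_deriv ha y i x).2]
  calc ∫ x, inner ℝ (dGam N a (x - y)) (gradient φ x)
      = ∫ x, ∑ i, dGam N a (x - y) i * fderiv ℝ φ x (EuclideanSpace.single i 1) := by
        congr 1; ext x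
        rw [real_inner_comm, inner_grad, fderiv_sum]
    _ = ∑ i, ∫ x, dGam N a (x - y) i * fderiv ℝ φ x (EuclideanSpace.single i 1) :=
        integral_finsetSum _ fun i _ => hi1 i
    _ = ∑ i, - ∫ x, Dg N a i (x - y) * φ x := by
        refine Finset.sum_congr rfl fun i _ => ?_
        rw [integral_mul_fderiv_eq_neg_fderiv_mul_of_integrable (by rw [hfd]; exact hi2 i) (hi1 i)
          (hi3 i) (fun x _ => (dGam_coord_deriv ha y i x).1)
          (fun x _ => (hφ.differentiable one_ne_zero) x), hfd]
    _ = - ∫ x, ∑ i, Dg N a i (x - y) * φ x := by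
        rw [integral_finsetSum _ fun i _ => hi2 i, Finset.sum_neg_distrib]
    _ = _ := by
        rw [← integral_neg]; congr 1; ext x
        rw [← Finset.sum_mul, sum_Dg ha]; ring

noncomputable def cN (N : ℕ) : ℝ := ∫ z : E N, Psi N 1 z

lemma integrable_Psi (N : ℕ) : Integrable (Psi N 1) := by
  unfold Psi
  refine Integrable.const_mul ?_ _
  have := integrable_rpow_neg_one_add_norm_sq (E := E N) (μ := volume) (r := (N : ℝ) + 2) (by simp)
  simpa [add_comm] using this

lemma Psi_pos {N : ℕ} (hN : 3 ≤ N) {a : ℝ} (ha : 0 < a) (z : E N) : 0 < Psi N a z := by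
  have hN' : (3 : ℝ) ≤ N := by exact_mod_cast hN
  have : (0 : ℝ) < N - 2 := by linarith
  unfold Psi; positivity

lemma cN_pos {N : ℕ} (hN : 3 ≤ N) : 0 < cN N := by
  unfold cN
  rw [integral_pos_iff_support_of_nonneg (fun z => (Psi_pos hN one_pos z).le) (integrable_Psi N)]
  have : Function.support (Psi N 1) = univ := by
    ext z; simp [(Psi_pos hN one_pos z).ne']
  rw [this]; exact Measure.measure_univ_pos.mpr (NeZero.ne _)

lemma Psi_scale {N : ℕ} {b : ℝ} (hb : 0 < b) (z : E N) :
    Psi N (b ^ 2) (b • z) = (b ^ N)⁻¹ * Psi N 1 z := by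
  unfold Psi
  have h1 : ‖b • z‖ ^ 2 + b ^ 2 = b ^ 2 * (‖z‖ ^ 2 + 1) := by
    rw [norm_smul, Real.norm_of_nonneg hb.le]; ring
  rw [h1, Real.mul_rpow (by positivity) (by positivity)]
  have h2 : (b ^ 2) ^ (-((N : ℝ) + 2) / 2) = (b ^ N)⁻¹ * (b ^ 2)⁻¹ := by
    rw [← Real.rpow_natCast b 2, ← Real.rpow_mul hb.le, ← Real.rpow_natCast b N,
      ← Real.rpow_neg hb.le, ← Real.rpow_neg hb.le, ← Real.rpow_add hb]
    congr 1; push_cast; ring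
  rw [h2]; field_simp

lemma Psi_integral_scale {N : ℕ} {b : ℝ} (hb : 0 < b) (y : E N) (φ : E N → ℝ) :
    ∫ x, Psi N (b ^ 2) (x - y) * φ x = ∫ z, Psi N 1 z * φ (y + b • z) := by
  have h1 := integral_add_right_eq_self (μ := volume) (fun x => Psi N (b ^ 2) (x - y) * φ x) y
  rw [← h1]
  simp only [add_sub_cancel_right]
  have h2 := Measure.integral_comp_smul (volume : Measure (E N))
    (fun x => Psi N (b ^ 2) x * φ (x + y)) b
  simp only [Psi_scale hb, finrank_euclideanSpace, Fintype.card_fin, smul_eq_mul] at h2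
  have hb' : (0 : ℝ) < b ^ N := by positivity
  have h3 : ∫ x : E N, (b ^ N)⁻¹ * Psi N 1 x * φ (b • x + y) =
      (b ^ N)⁻¹ * ∫ x : E N, Psi N 1 x * φ (y + b • x) := by
    rw [← integral_const_mul]; congr 1; ext x; rw [add_comm y]; ring
  rw [h3, abs_of_pos (by positivity)] at h2
  exact (mul_left_cancel₀ (by positivity) h2).symm

lemma Psi_lim {N : ℕ} (hN : 3 ≤ N) {φ : E N → ℝ} (hφ : Continuous φ) {B : ℝ} (hB : ∀ x, |φ x| ≤ B)
    (y : E N) :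
    Tendsto (fun n => ∫ x, Psi N (an n) (x - y) * φ x) atTop (𝓝 (cN N * φ y)) ∧
    ∀ n, |∫ x, Psi N (an n) (x - y) * φ x| ≤ cN N * B := by
  have hs : ∀ n, an n = (√(an n)) ^ 2 := fun n => (Real.sq_sqrt (an_pos n).le).symm
  have hsp : ∀ n, 0 < √(an n) := fun n => Real.sqrt_pos.mpr (an_pos n)
  have heq : ∀ n, ∫ x, Psi N (an n) (x - y) * φ x = ∫ z, Psi N 1 z * φ (y + √(an n) • z) := by
    intro n
    conv_lhs => rw [hs n]
    exact Psi_integral_scale (hsp n) y φ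
  simp only [heq]
  have hc : ∀ n, Continuous fun z : E N => Psi N 1 z * φ (y + √(an n) • z) := fun n =>
    (continuous_Psi one_pos).mul (hφ.comp (by fun_prop))
  have hb : ∀ n, ∀ z : E N, ‖Psi N 1 z * φ (y + √(an n) • z)‖ ≤ Psi N 1 z * B := by
    intro n z
    rw [norm_mul, Real.norm_of_nonneg (Psi_pos hN one_pos z).le]
    exact mul_le_mul_of_nonneg_left (hB _) (Psi_pos hN one_pos z).le
  constructor
  · rw [cN, ← integral_mul_const]
    refine tendsto_integral_of_dominated_convergence (fun z => Psi N 1 z * B)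
      (fun n => (hc n).aestronglyMeasurable) ((integrable_Psi N).mul_const B)
      (fun n => ae_of_all _ (hb n)) (ae_of_all _ fun z => ?_)
    have : Tendsto (fun n => √(an n)) atTop (𝓝 0) := by
      have := (Real.continuous_sqrt.tendsto 0).comp an_tendsto
      rw [Real.sqrt_zero] at this
      exact this
    have h2 : Tendsto (fun n => y + √(an n) • z) atTop (𝓝 y) := by
      simpa using (this.smul_const z).const_add y
    exact ((hφ.tendsto y).comp h2).const_mul _
  · intro n
    refine (norm_integral_le_of_norm_le ((integrable_Psi N).mul_const B)
      (ae_of_all _ (hb n))).trans ?_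
    rw [integral_mul_const, cN]

lemma Dens.integrable_mul {N : ℕ} {g : E N → ℝ} {M R : ℝ} (hg : Dens N g M R) {h : E N → ℝ}
    (hm : AEStronglyMeasurable h) {C : ℝ} (hC : ∀ y, |h y| ≤ C) : Integrable fun y => g y * h y := by
  have h0 : 0 ≤ C := (abs_nonneg _).trans (hC 0)
  exact (hg.int_bound C h0).1.mono' (hg.meas.aestronglyMeasurable.mul hm)
    (ae_of_all _ fun y => (hg.int_bound C h0).2 (h y) y (hC y))

lemma Dens.fubini {N : ℕ} (hN : 3 ≤ N) {g : E N → ℝ} {M R : ℝ} (hg : Dens N g M R) {a : ℝ}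
    (ha : 0 < a) {φ : E N → ℝ} (hφ : ContDiff ℝ 1 φ) (hc : HasCompactSupport φ) :
    ∫ x, inner ℝ (dNPa N a g x) (gradient φ x) = ∫ y, g y * ∫ x, Psi N a (x - y) * φ x := by
  have hN' : (3 : ℝ) ≤ N := by exact_mod_cast hN
  have hgi : Integrable g := by
    have := hg.integrable_mul (h := fun _ => 1) aestronglyMeasurable_const (C := 1) (by simp)
    simpa using this
  have hgr : Integrable fun x => ‖gradient φ x‖ :=
    ((continuous_grad hφ).norm).integrable_of_hasCompactSupport (cptsupp_grad hc).norm
  have hprod : Integrable (Function.uncurry fun x y => g y * inner ℝ (dGam N a (x - y)) (gradient φ x))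
      ((volume : Measure (E N)).prod volume) := by
    have hb := ((hgr.mul_prod hgi).norm).const_mul ((N - 2) * a ^ (((1 : ℝ) - N) / 2))
    refine hb.mono' ?_ (ae_of_all _ fun z => ?_)
    · refine ((hg.meas.comp measurable_snd).aestronglyMeasurable).mul ?_
      refine Continuous.aestronglyMeasurable ?_
      exact ((continuous_dGam N ha).comp (by fun_prop)).inner
        ((continuous_grad hφ).comp continuous_fst)
    · obtain ⟨x, y⟩ := z
      simp only [Function.uncurry, norm_mul, norm_norm]
      have h1 := norm_inner_le_norm (𝕜 := ℝ) (dGam N a (x - y)) (gradient φ x)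
      have h2 := dGam_bdd hN ha (x - y)
      calc ‖g y‖ * ‖inner ℝ (dGam N a (x - y)) (gradient φ x)‖
          ≤ ‖g y‖ * (((N - 2) * a ^ (((1 : ℝ) - N) / 2)) * ‖gradient φ x‖) := by
            gcongr; exact h1.trans (by gcongr)
        _ = _ := by ring
  calc _ = ∫ x, ∫ y, g y * inner ℝ (dGam N a (x - y)) (gradient φ x) := by
        congr 1; ext x
        have hi := (hg.integrable_smul hN (measurable_dGam N a) (α := (N : ℝ) - 1) (by linarith)
          (by linarith) (fun z hz => dGam_le2 hN ha.le z hz) x).1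
        rw [real_inner_comm, dNPa, ← integral_inner hi]
        congr 1; ext y; rw [real_inner_smul_right, real_inner_comm]
    _ = ∫ y, ∫ x, g y * inner ℝ (dGam N a (x - y)) (gradient φ x) := integral_integral_swap hprod
    _ = _ := by
        congr 1; ext y; rw [integral_const_mul, divergence_step ha y hφ hc]

theorem Dens.weak {N : ℕ} (hN : 3 ≤ N) {g : E N → ℝ} {M R : ℝ} (hg : Dens N g M R)
    {φ : E N → ℝ} (hφ : ContDiff ℝ 1 φ) (hc : HasCompactSupport φ) :
    ∫ x, inner ℝ (dNP N g x) (gradient φ x) = cN N * ∫ y, g y * φ y := by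
  obtain ⟨B, hB⟩ := hφ.continuous.bounded_above_of_compact_support hc
  have hgr : Integrable fun x => ‖gradient φ x‖ :=
    ((continuous_grad hφ).norm).integrable_of_hasCompactSupport (cptsupp_grad hc).norm
  have hL := fun y => (Psi_lim hN hφ.continuous hB y).1
  have hBd := fun y => (Psi_lim hN hφ.continuous hB y).2
  have hc0 := (cN_pos hN).le
  have hB0 : 0 ≤ B := (norm_nonneg _).trans (hB 0)
  have hmeas : ∀ n, AEStronglyMeasurable (fun y => ∫ x, Psi N (an n) (x - y) * φ x) := by
    intro n
    have : StronglyMeasurable (fun y => ∫ x, Psi N (an n) (x - y) * φ x) := by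
      refine StronglyMeasurable.integral_prod_right (f := fun y x => Psi N (an n) (x - y) * φ x) ?_
      refine Continuous.stronglyMeasurable ?_
      exact ((continuous_Psi (an_pos n)).comp (by fun_prop)).mul (hφ.continuous.comp continuous_snd)
    exact this.aestronglyMeasurable
  have h1 : Tendsto (fun n => ∫ y, g y * ∫ x, Psi N (an n) (x - y) * φ x) atTop
      (𝓝 (∫ y, g y * (cN N * φ y))) := by
    refine tendsto_integral_of_dominated_convergence
      ((Metric.ball (0 : E N) R).indicator fun _ => M * (cN N * B))
      (fun n => hg.meas.aestronglyMeasurable.mul (hmeas n))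
      (hg.int_bound _ (by positivity)).1
      (fun n => ae_of_all _ fun y => (hg.int_bound _ (by positivity)).2 _ y (hBd y n))
      (ae_of_all _ fun y => (hL y).const_mul (g y))
  have h2 : Tendsto (fun n => ∫ x, inner ℝ (dNPa N (an n) g x) (gradient φ x)) atTop
      (𝓝 (∫ x, inner ℝ (dNP N g x) (gradient φ x))) := by
    obtain ⟨L, hL'⟩ := hc.isCompact.isBounded.subset_ball (0 : E N)
    have hu := hg.tendsto_dNP hN L
    rw [Metric.tendstoUniformlyOn_iff] at hu
    have hci : ∀ v : E N → E N, Continuous v → Integrable fun x => inner ℝ (v x) (gradient φ x) := by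
      intro v hv
      refine (hv.inner (continuous_grad hφ)).integrable_of_hasCompactSupport ?_
      refine HasCompactSupport.intro hc fun x hx => ?_
      rw [grad_zero_of_notMem hx, inner_zero_right]
    rw [Metric.tendsto_atTop]
    intro ε hε
    set I := ∫ x, ‖gradient φ x‖ with hI
    have hI0 : 0 ≤ I := integral_nonneg fun x => norm_nonneg _
    have hd : 0 < ε / (I + 1) := by positivity
    obtain ⟨n0, hn0⟩ := eventually_atTop.1 (hu _ hd)
    refine ⟨n0, fun n hn => ?_⟩
    rw [dist_eq_norm, ← integral_sub (hci _ (hg.continuous_dNPa hN (an_pos n)))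
      (hci _ (hg.continuous_dNP hN))]
    have hle : ∀ x, ‖inner ℝ (dNPa N (an n) g x) (gradient φ x) - inner ℝ (dNP N g x) (gradient φ x)‖
        ≤ ε / (I + 1) * ‖gradient φ x‖ := by
      intro x
      by_cases hx : x ∈ tsupport φ
      · rw [← inner_sub_left]
        refine (norm_inner_le_norm _ _).trans ?_
        have := (hn0 n hn x (hL' hx)).le
        rw [dist_comm, dist_eq_norm] at this
        gcongr
      · simp [grad_zero_of_notMem hx]
    refine (norm_integral_le_of_norm_le (hgr.const_mul _) (ae_of_all _ hle)).trans_lt ?_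
    rw [integral_const_mul, ← hI, div_mul_eq_mul_div, div_lt_iff₀ (by positivity)]
    nlinarith
  have h3 : (fun n => ∫ x, inner ℝ (dNPa N (an n) g x) (gradient φ x)) =
      fun n => ∫ y, g y * ∫ x, Psi N (an n) (x - y) * φ x := by
    ext n; exact hg.fubini hN (an_pos n) hφ hc
  rw [h3] at h2
  rw [tendsto_nhds_unique h2 h1, ← integral_const_mul]
  congr 1; ext y; ring

end NR

open MeasureTheory Real Set

namespace NR
open Filter Topology EuclideanGeometry

lemma integral_inversion {N : ℕ} (hN : 3 ≤ N) {R : ℝ} (hR : 0 < R) (h : E N → ℝ) :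
    ∫ y, h y = ∫ z, (R / ‖z‖) ^ (2 * N) * h (inversion 0 R z) := by
  have : Nonempty (Fin N) := ⟨⟨0, by omega⟩⟩
  have hms : MeasurableSet ({0}ᶜ : Set (E N)) := (measurableSet_singleton 0).compl
  have him : inversion (0 : E N) R '' {0}ᶜ = {0}ᶜ := by
    ext y; constructor
    · rintro ⟨x, hx, rfl⟩
      simpa [inversion_eq_center hR.ne'] using hx
    · intro hy
      exact ⟨inversion 0 R y, by simpa [inversion_eq_center hR.ne'] using hy,
        inversion_inversion 0 hR.ne' y⟩
  have key := integral_image_eq_integral_abs_det_fderiv_smul (volume : Measure (E N)) hms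
    (f := inversion (0 : E N) R)
    (f' := fun x => ((R / dist x 0) ^ 2 • ((ℝ ∙ (x - 0))ᗮ.reflection : E N →L[ℝ] E N)))
    (fun x hx => (hasFDerivAt_inversion hx).hasFDerivWithinAt)
    ((inversion_injective 0 hR.ne').injOn) h
  rw [him] at key
  have hnull : ∀ k : E N → ℝ, ∫ x in ({0}ᶜ : Set (E N)), k x = ∫ x, k x := by
    intro k
    rw [restrict_compl_singleton]
  rw [hnull, hnull] at key
  rw [key]
  congr 1; ext z
  have hdet : |((R / dist z 0) ^ 2 • ((ℝ ∙ (z - 0))ᗮ.reflection : E N →L[ℝ] E N)).det| =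
      (R / ‖z‖) ^ (2 * N) := by
    have h1 : (((R / dist z 0) ^ 2 • ((ℝ ∙ (z - 0))ᗮ.reflection : E N →L[ℝ] E N)) : E N →L[ℝ] E N).det
       = LinearMap.det ((R / dist z 0) ^ 2 • ((ℝ ∙ (z - 0))ᗮ.reflection.toLinearEquiv : E N →ₗ[ℝ] E N)) := rfl
    rw [h1, LinearMap.det_smul]
    have h2 := ((ℝ ∙ (z - 0))ᗮ).det_reflection
    have h3 : |LinearMap.det ((ℝ ∙ (z - 0))ᗮ.reflection.toLinearEquiv : E N →ₗ[ℝ] E N)| = 1 := by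
      rw [h2]; simp
    rw [abs_mul, h3, mul_one, dist_zero_right, finrank_euclideanSpace, Fintype.card_fin,
      ← pow_mul, abs_of_nonneg (by positivity)]
  rw [hdet, smul_eq_mul]

lemma norm_inversion {N : ℕ} (R : ℝ) (y : E N) : ‖inversion (0 : E N) R y‖ = R ^ 2 / ‖y‖ := by
  have := dist_inversion_center (0 : E N) y R
  simpa using this

/-- Kelvin-odd extension of the density -/
noncomputable def kden (N : ℕ) (R₀ R₁ : ℝ) (f : E N → ℝ) (y : E N) : ℝ :=
  (annulus N R₀ R₁).indicator f y
    - (R₀ / ‖y‖) ^ (N + 2) * (annulus N R₀ R₁).indicator f (inversion 0 R₀ y)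

lemma isOpen_annulus (N : ℕ) (R₀ R₁ : ℝ) : IsOpen (annulus N R₀ R₁) :=
  (isOpen_lt continuous_const continuous_norm).inter (isOpen_lt continuous_norm continuous_const)

lemma meas_annulus (N : ℕ) (R₀ R₁ : ℝ) : MeasurableSet (annulus N R₀ R₁) :=
  (isOpen_annulus N R₀ R₁).measurableSet

lemma measurable_inversion (N : ℕ) (R : ℝ) : Measurable (inversion (0 : E N) R) := by
  have : inversion (0 : E N) R = fun x => (R / ‖x‖) ^ 2 • x := by
    ext x; simp [inversion]
  rw [this]; fun_prop

lemma measurable_ind {N : ℕ} {R₀ R₁ : ℝ} {f : E N → ℝ} (hf : ContinuousOn f (annulus N R₀ R₁)) :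
    Measurable ((annulus N R₀ R₁).indicator f) := by
  classical
  rw [← Set.piecewise_eq_indicator]
  exact hf.measurable_piecewise continuousOn_const (meas_annulus N R₀ R₁)

lemma kden_dens {N : ℕ} {R₀ R₁ : ℝ} (h0 : 0 < R₀) (h1 : R₀ < R₁) {f : E N → ℝ} {M : ℝ} (hM : 0 ≤ M)
    (hf : ContinuousOn f (annulus N R₀ R₁)) (hb : ∀ x ∈ annulus N R₀ R₁, |f x| ≤ M) :
    Dens N (kden N R₀ R₁ f) ((1 + (R₁ / R₀) ^ (N + 2)) * M) R₁ := by
  have hR1 : 0 < R₁ := h0.trans h1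
  have hm := measurable_ind hf
  have hib : ∀ y, |(annulus N R₀ R₁).indicator f y| ≤ M := by
    intro y
    by_cases hy : y ∈ annulus N R₀ R₁
    · rw [indicator_of_mem hy]; exact hb y hy
    · rw [indicator_of_notMem hy]; simpa
  refine ⟨?_, by positivity, ?_, ?_⟩
  · unfold kden
    exact hm.sub ((by fun_prop : Measurable fun y : E N => (R₀ / ‖y‖) ^ (N + 2)).mul
      (hm.comp (measurable_inversion N R₀)))
  · intro y
    have h2 : |(R₀ / ‖y‖) ^ (N + 2) * (annulus N R₀ R₁).indicator f (inversion 0 R₀ y)|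
        ≤ (R₁ / R₀) ^ (N + 2) * M := by
      by_cases hy : inversion 0 R₀ y ∈ annulus N R₀ R₁
      · rw [abs_mul, abs_of_nonneg (by positivity)]
        have h3 := hy.2
        rw [norm_inversion] at h3
        have : R₀ / ‖y‖ ≤ R₁ / R₀ := by
          rw [le_div_iff₀ h0]
          calc R₀ / ‖y‖ * R₀ = R₀ ^ 2 / ‖y‖ := by ring
            _ ≤ R₁ := h3.le
        exact mul_le_mul (pow_le_pow_left₀ (by positivity) this _) (hib _) (abs_nonneg _)
          (by positivity)
      · rw [indicator_of_notMem hy, mul_zero, abs_zero]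
        have : 0 < R₁ := h0.trans h1
        positivity
    unfold kden
    refine (abs_sub _ _).trans ?_
    have := hib y
    linarith
  · intro y hy
    have hy0 : 0 < ‖y‖ := lt_of_lt_of_le (h0.trans h1) hy
    have e1 : y ∉ annulus N R₀ R₁ := fun h => absurd h.2 (not_lt.mpr hy)
    have e2 : inversion 0 R₀ y ∉ annulus N R₀ R₁ := by
      intro h
      have h3 := h.1
      rw [norm_inversion, lt_div_iff₀ hy0] at h3
      nlinarith
    simp [kden, indicator_of_notMem e1, indicator_of_notMem e2]

lemma kden_supp {N : ℕ} {R₀ R₁ : ℝ} (h0 : 0 < R₀) (h1 : R₀ < R₁) {f : E N → ℝ} {y : E N}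
    (hy : kden N R₀ R₁ f y ≠ 0) : R₀ ^ 2 / R₁ < ‖y‖ ∧ ‖y‖ < R₁ := by
  have h1' := h0.trans h1
  by_cases e1 : y ∈ annulus N R₀ R₁
  · refine ⟨lt_of_le_of_lt ?_ e1.1, e1.2⟩
    rw [div_le_iff₀ h1']; nlinarith
  · by_cases e2 : inversion 0 R₀ y ∈ annulus N R₀ R₁
    · have := e2.1
      have h3 := e2.2
      rw [norm_inversion] at this h3
      have hy0 : 0 < ‖y‖ := by
        rcases (norm_nonneg y).eq_or_lt with h | h
        · rw [← h, div_zero] at this; linarith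
        · exact h
      rw [lt_div_iff₀ hy0] at this
      rw [div_lt_iff₀ hy0] at h3
      rw [div_lt_iff₀ h1']
      constructor
      · linarith
      · nlinarith
    · simp [kden, indicator_of_notMem e1, indicator_of_notMem e2] at hy

lemma kden_on {N : ℕ} {R₀ R₁ : ℝ} (h0 : 0 < R₀) {f : E N → ℝ} {y : E N}
    (hy : y ∈ annulus N R₀ R₁) : kden N R₀ R₁ f y = f y := by
  have e2 : inversion 0 R₀ y ∉ annulus N R₀ R₁ := by
      intro h
      have h3 := h.1
      rw [norm_inversion, lt_div_iff₀ (h0.trans hy.1)] at h3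
      nlinarith [hy.1]
  simp [kden, indicator_of_mem hy, indicator_of_notMem e2]

lemma kden_inv {N : ℕ} {R₀ R₁ : ℝ} (h0 : 0 < R₀) {f : E N → ℝ} {z : E N} (hz : z ≠ 0) :
    kden N R₀ R₁ f (inversion 0 R₀ z) = - (‖z‖ / R₀) ^ (N + 2) * kden N R₀ R₁ f z := by
  have hz' : 0 < ‖z‖ := norm_pos_iff.mpr hz
  unfold kden
  rw [inversion_inversion _ h0.ne', norm_inversion]
  have h1 : R₀ / (R₀ ^ 2 / ‖z‖) = ‖z‖ / R₀ := by field_simp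
  have h2 : (‖z‖ / R₀) ^ (N + 2) * (R₀ / ‖z‖) ^ (N + 2) = 1 := by
    rw [← mul_pow]; field_simp; simp
  rw [h1]
  linear_combination - (annulus N R₀ R₁).indicator f (inversion 0 R₀ z) * h2

lemma NP_inv {N : ℕ} (hN : 3 ≤ N) {R₀ R₁ : ℝ} (h0 : 0 < R₀) (f : E N → ℝ) {x : E N} (hx : x ≠ 0) :
    NP N (kden N R₀ R₁ f) (inversion 0 R₀ x) =
      - (‖x‖ / R₀) ^ (N - 2) * NP N (kden N R₀ R₁ f) x := by
  have : Nonempty (Fin N) := ⟨⟨0, by omega⟩⟩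
  have hx' : 0 < ‖x‖ := norm_pos_iff.mpr hx
  unfold NP NPa
  rw [integral_inversion hN h0, ← integral_const_mul]
  have hne : ∀ᵐ z : E N, z ≠ 0 := by simp [ae_iff]
  refine integral_congr_ae (hne.mono fun z hz => ?_)
  have hz' : 0 < ‖z‖ := norm_pos_iff.mpr hz
  simp only [smul_eq_mul]
  rw [kden_inv h0 hz, Gam_zero, Gam_zero, ← dist_eq_norm, dist_inversion_inversion hx hz,
    dist_zero_right, dist_zero_right, Real.mul_rpow (by positivity) (by positivity), dist_eq_norm]
  have hp : (R₀ ^ 2 / (‖x‖ * ‖z‖)) ^ ((2 : ℝ) - N) = (‖x‖ * ‖z‖ / R₀ ^ 2) ^ (N - 2) := by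
    rw [← Real.rpow_natCast (‖x‖ * ‖z‖ / R₀ ^ 2), Nat.cast_sub (by omega), ← inv_div,
      Real.inv_rpow (by positivity), ← Real.rpow_neg (by positivity)]
    congr 1; push_cast; ring
  rw [hp]
  have hal : (R₀ / ‖z‖) ^ (2 * N) * ((‖z‖ / R₀) ^ (N + 2) * (‖x‖ * ‖z‖ / R₀ ^ 2) ^ (N - 2))
      = (‖x‖ / R₀) ^ (N - 2) := by
    obtain ⟨m, rfl⟩ : ∃ m, N = m + 2 := ⟨N - 2, by omega⟩
    have e1 : ‖x‖ * ‖z‖ / R₀ ^ 2 = (‖x‖ / R₀) * (‖z‖ / R₀) := by ring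
    have e2 : R₀ / ‖z‖ = (‖z‖ / R₀)⁻¹ := by rw [inv_div]
    rw [e1, e2, mul_pow, Nat.add_sub_cancel]
    have ht : ‖z‖ / R₀ ≠ 0 := by positivity
    generalize ‖z‖ / R₀ = t at *
    have : t ^ (m + 2 + 2) * t ^ m = t ^ (2 * (m + 2)) := by ring
    rw [inv_pow]
    field_simp
    rw [← this]
  rw [← hal]; ring

end NR

open MeasureTheory Real Set

namespace NR
open Filter Topology EuclideanGeometry

lemma contDiffOn_one_of {N : ℕ} {u : E N → ℝ} {G : E N → E N} {s : Set (E N)} (hs : IsOpen s)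
    (h : ∀ x ∈ s, HasFDerivAt u (innerSL ℝ (G x)) x) (hG : ContinuousOn G s) :
    ContDiffOn ℝ 1 u s := by
  have : (1 : WithTop ℕ∞) = 0 + 1 := by simp
  rw [this, contDiffOn_succ_iff_fderiv_of_isOpen hs]
  refine ⟨fun x hx => (h x hx).differentiableAt.differentiableWithinAt, by simp, ?_⟩
  rw [contDiffOn_zero]
  exact ((innerSL ℝ (E := E N)).continuous.comp_continuousOn hG).congr fun x hx => (h x hx).fderiv

lemma Dens.NP_glob {N : ℕ} (hN : 3 ≤ N) {R : ℝ} (hR : 0 < R) : ∃ C, 0 ≤ C ∧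
    ∀ {g : E N → ℝ} {M : ℝ}, Dens N g M R → ∀ x, |NP N g x| ≤ C * M ∧ ‖dNP N g x‖ ≤ C * M ∧
      ‖x‖ ^ (N - 2) * |NP N g x| ≤ C * M ∧ ‖x‖ ^ (N - 1) * ‖dNP N g x‖ ≤ C * M := by
  obtain ⟨C1, hC1, h1⟩ := Dens.NP_bound hN R
  obtain ⟨C2, hC2, h2⟩ := Dens.NP_far hN hR
  have hP1 : 0 ≤ (2 * R) ^ (N - 2) * C1 := by positivity
  have hP2 : 0 ≤ (2 * R) ^ (N - 1) * C1 := by positivity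
  refine ⟨C1 + C2 + (2 * R) ^ (N - 2) * C1 + (2 * R) ^ (N - 1) * C1, by positivity, ?_⟩
  intro g M hg x
  have hM := hg.nn
  obtain ⟨a1, a2⟩ := h1 hg x
  have b1 := mul_nonneg hC1 hM
  have b2 := mul_nonneg hC2 hM
  have b3 := mul_nonneg hP1 hM
  have b4 := mul_nonneg hP2 hM
  refine ⟨by nlinarith, by nlinarith, ?_⟩
  rcases le_or_gt (2 * R) ‖x‖ with hx | hx
  · obtain ⟨c1, c2⟩ := h2 hg x hx
    have hx0 : 0 < ‖x‖ := lt_of_lt_of_le (by positivity) hx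
    have e1 : ‖x‖ ^ (N - 2) * ‖x‖ ^ ((2 : ℝ) - N) = 1 := by
      rw [← Real.rpow_natCast, ← Real.rpow_add hx0, Nat.cast_sub (by omega)]; simp
    have e2 : ‖x‖ ^ (N - 1) * ‖x‖ ^ ((1 : ℝ) - N) = 1 := by
      rw [← Real.rpow_natCast, ← Real.rpow_add hx0, Nat.cast_sub (by omega)]; simp
    constructor
    · have := mul_le_mul_of_nonneg_left c1 (by positivity : 0 ≤ ‖x‖ ^ (N - 2))
      have e3 : ‖x‖ ^ (N - 2) * (C2 * M * ‖x‖ ^ ((2 : ℝ) - N)) = C2 * M := by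
        linear_combination (C2 * M) * e1
      nlinarith
    · have := mul_le_mul_of_nonneg_left c2 (by positivity : 0 ≤ ‖x‖ ^ (N - 1))
      have e3 : ‖x‖ ^ (N - 1) * (C2 * M * ‖x‖ ^ ((1 : ℝ) - N)) = C2 * M := by
        linear_combination (C2 * M) * e2
      nlinarith
  · have d : ∀ n, ‖x‖ ^ n ≤ (2 * R) ^ n := fun n => pow_le_pow_left₀ (norm_nonneg _) hx.le _
    constructor
    · have := mul_le_mul (d (N - 2)) a1 (abs_nonneg _) (by positivity)
      nlinarith
    · have := mul_le_mul (d (N - 1)) a2 (norm_nonneg _) (by positivity)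
      nlinarith

/-- image terms -/
noncomputable def TT (N : ℕ) (g : E N → ℝ) (q : ℝ) (x : E N) : ℝ := q ^ (N - 2) * NP N g (q ^ 2 • x)
noncomputable def dTT (N : ℕ) (g : E N → ℝ) (q : ℝ) (x : E N) : E N := q ^ N • dNP N g (q ^ 2 • x)

lemma Dens.hasFDerivAt_TT {N : ℕ} (hN : 3 ≤ N) {g : E N → ℝ} {M R : ℝ} (hg : Dens N g M R) (q : ℝ)
    (x : E N) : HasFDerivAt (TT N g q) (innerSL ℝ (dTT N g q x)) x := by
  have h1 : HasFDerivAt (fun x : E N => q ^ 2 • x) (q ^ 2 • ContinuousLinearMap.id ℝ (E N)) x :=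
    (hasFDerivAt_id x).const_smul (q ^ 2)
  have h2 := ((hg.hasFDerivAt_NP hN (q ^ 2 • x)).comp x h1).const_mul (q ^ (N - 2))
  refine h2.congr_fderiv ?_
  ext v
  have : q ^ N = q ^ (N - 2) * q ^ 2 := by rw [← pow_add]; congr 1; omega
  simp [dTT, this]; ring

lemma Dens.continuous_dTT {N : ℕ} (hN : 3 ≤ N) {g : E N → ℝ} {M R : ℝ} (hg : Dens N g M R) (q : ℝ) :
    Continuous (dTT N g q) := by
  unfold dTT
  exact ((hg.continuous_dNP hN).comp (continuous_const_smul (q ^ 2))).const_smul (q ^ N)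

lemma TT_bound {N : ℕ} (hN : 3 ≤ N) {R r0 : ℝ} (hR : 0 < R) (hr : 0 < r0) : ∃ C, 0 ≤ C ∧
    ∀ {g : E N → ℝ} {M : ℝ}, Dens N g M R → ∀ x, r0 ≤ ‖x‖ → ∀ q, 0 < q → ∀ w, (w = q ∧ q ≤ 1 ∨
      w = q⁻¹ ∧ 1 ≤ q) → |TT N g q x| ≤ C * M * w ∧ ‖dTT N g q x‖ ≤ C * M * w := by
  obtain ⟨C, hC, h⟩ := Dens.NP_glob hN hR
  refine ⟨C + C * (r0 ^ (N - 2))⁻¹ + C * (r0 ^ (N - 1))⁻¹, by positivity, ?_⟩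
  intro g M hg x hx q hq w hw
  have hM := hg.nn
  obtain ⟨h1, h2, h3, h4⟩ := h hg (q ^ 2 • x)
  obtain ⟨m, rfl⟩ : ∃ m, N = m + 3 := ⟨N - 3, by omega⟩
  have e2 : m + 3 - 2 = m + 1 := rfl
  have e1 : m + 3 - 1 = m + 2 := rfl
  have b1 := mul_nonneg hC hM
  have b2 := mul_nonneg b1 (by positivity : 0 ≤ (r0 ^ (m + 1))⁻¹)
  have b3 := mul_nonneg b1 (by positivity : 0 ≤ (r0 ^ (m + 2))⁻¹)
  simp only [TT, dTT, e1, e2, norm_smul, abs_mul, abs_pow, abs_of_pos hq, norm_pow,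
    Real.norm_of_nonneg hq.le] at *
  rcases hw with ⟨rfl, hq1⟩ | ⟨rfl, hq1⟩
  · have p1 : w ^ (m + 1) ≤ w := by
      simpa using pow_le_pow_of_le_one hq.le hq1 (by omega : 1 ≤ m + 1)
    have p2 : w ^ (m + 3) ≤ w := by
      simpa using pow_le_pow_of_le_one hq.le hq1 (by omega : 1 ≤ m + 3)
    have k1 := mul_le_mul p1 h1 (abs_nonneg _) hq.le
    have k2 := mul_le_mul p2 h2 (norm_nonneg _) hq.le
    have c2 := mul_nonneg b2 hq.le
    have c3 := mul_nonneg b3 hq.le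
    constructor <;> nlinarith
  · have hx0 : 0 < ‖x‖ := lt_of_lt_of_le hr hx
    have p1 : q⁻¹ ^ (m + 1) ≤ q⁻¹ := by
      simpa using pow_le_pow_of_le_one (inv_pos.mpr hq).le (inv_le_one_of_one_le₀ hq1) (by omega : 1 ≤ m + 1)
    have k1 : q ^ (m + 1) * |NP (m + 3) g (q ^ 2 • x)| ≤ C * M * (r0 ^ (m + 1))⁻¹ * q⁻¹ := by
      have e : q ^ (m + 1) * |NP (m + 3) g (q ^ 2 • x)| =
        ((q ^ 2 * ‖x‖) ^ (m + 1) * |NP (m + 3) g (q ^ 2 • x)|) * ((‖x‖ ^ (m + 1))⁻¹ * q⁻¹ ^ (m + 1)) := by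
        rw [mul_pow, inv_pow]; field_simp; ring
      rw [e, mul_assoc (C * M)]
      refine mul_le_mul h3 ?_ (by positivity) b1
      gcongr
    have k2 : q ^ (m + 3) * ‖dNP (m + 3) g (q ^ 2 • x)‖ ≤ C * M * (r0 ^ (m + 2))⁻¹ * q⁻¹ := by
      have e : q ^ (m + 3) * ‖dNP (m + 3) g (q ^ 2 • x)‖ =
        ((q ^ 2 * ‖x‖) ^ (m + 2) * ‖dNP (m + 3) g (q ^ 2 • x)‖) * ((‖x‖ ^ (m + 2))⁻¹ * q⁻¹ ^ (m + 1)) := by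
        rw [mul_pow, inv_pow]; field_simp; ring
      rw [e, mul_assoc (C * M)]
      refine mul_le_mul h4 ?_ (by positivity) b1
      gcongr
    have c1 := mul_nonneg b1 (inv_pos.mpr hq).le
    have c2 := mul_nonneg b2 (inv_pos.mpr hq).le
    have c3 := mul_nonneg b3 (inv_pos.mpr hq).le
    constructor <;> nlinarith

lemma TT_odd {N : ℕ} (hN : 3 ≤ N) {R₀ R₁ : ℝ} (h0 : 0 < R₀) (f : E N → ℝ) {x : E N} {s q : ℝ}
    (hs : 0 < s) (hq : 0 < q) (hx : ‖x‖ = R₀ * s) :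
    TT N (kden N R₀ R₁ f) (q⁻¹ * s⁻¹) x = - TT N (kden N R₀ R₁ f) q x := by
  have hx0 : x ≠ 0 := by
    rw [← norm_pos_iff, hx]; positivity
  have h := NP_inv hN (R₁ := R₁) h0 f (x := q ^ 2 • x) (smul_ne_zero (by positivity) hx0)
  have e1 : inversion 0 R₀ (q ^ 2 • x) = (q⁻¹ * s⁻¹) ^ 2 • x := by
    simp only [inversion, dist_zero_right, norm_smul, hx, norm_pow, Real.norm_of_nonneg hq.le,
      vsub_eq_sub, sub_zero, vadd_eq_add, add_zero, smul_smul]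
    congr 1; field_simp
  have e2 : ‖q ^ 2 • x‖ / R₀ = q ^ 2 * s := by
    rw [norm_smul, hx, norm_pow, Real.norm_of_nonneg hq.le]; field_simp
  rw [e1, e2] at h
  unfold TT
  rw [h]
  have : (q⁻¹ * s⁻¹) ^ (N - 2) * (q ^ 2 * s) ^ (N - 2) = q ^ (N - 2) := by
    rw [← mul_pow]; congr 1; field_simp
  linear_combination - NP N (kden N R₀ R₁ f) (q ^ 2 • x) * this

lemma summable_w {r : ℝ} (h0 : 0 ≤ r) (h1 : r < 1) : Summable fun k : ℤ => r ^ k.natAbs := by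
  apply Summable.of_nat_of_neg
  · simpa using summable_geometric_of_lt_one h0 h1
  · simpa using summable_geometric_of_lt_one h0 h1

lemma w_cases {ρ : ℝ} (hρ : 1 < ρ) (k : ℤ) :
    (ρ⁻¹ ^ k.natAbs = ρ ^ (-k) ∧ ρ ^ (-k) ≤ 1 ∨ ρ⁻¹ ^ k.natAbs = (ρ ^ (-k))⁻¹ ∧ 1 ≤ ρ ^ (-k)) := by
  have hρ0 : 0 < ρ := by linarith
  rcases Int.natAbs_eq k with h | h
  · left
    rw [h]
    simp only [Int.natAbs_natCast, zpow_neg, zpow_natCast, inv_pow, true_and]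
    exact inv_le_one_of_one_le₀ (one_le_pow₀ hρ.le)
  · right
    rw [h]
    simp only [Int.natAbs_neg, Int.natAbs_natCast, neg_neg, zpow_natCast, inv_pow, true_and]
    exact one_le_pow₀ hρ.le

lemma TT_weak {N : ℕ} (hN : 3 ≤ N) {g : E N → ℝ} {M R : ℝ} (hg : Dens N g M R) {q : ℝ} (hq : 0 < q)
    {φ : E N → ℝ} (hφ : ContDiff ℝ 1 φ) (hc : HasCompactSupport φ) :
    ∃ c : ℝ, (q = 1 → c = cN N) ∧
    ∫ x, inner ℝ (dTT N g q x) (gradient φ x) = c * ∫ y, g y * φ ((q ^ 2)⁻¹ • y) := by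
  set b := (q ^ 2)⁻¹ with hb
  have hb0 : 0 < b := by positivity
  set ψ : E N → ℝ := fun y => φ (b • y) with hψ
  have hψ1 : ContDiff ℝ 1 ψ := hφ.comp (contDiff_const_smul b)
  have hψc : HasCompactSupport ψ := hc.comp_smul hb0.ne'
  have hgr : ∀ y, gradient ψ y = b • gradient φ (b • y) := by
    intro y
    apply grad_of_hasFDerivAt
    have h1 : HasFDerivAt (fun x : E N => b • x) (b • ContinuousLinearMap.id ℝ (E N)) y :=
      (hasFDerivAt_id y).const_smul b
    have h2 := ((hφ.differentiable one_ne_zero) (b • y)).hasFDerivAt.comp y h1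
    refine h2.congr_fderiv ?_
    ext v; simp [inner_grad, inner_smul_left]
  have h2 := Measure.integral_comp_smul (volume : Measure (E N))
    (fun x => inner ℝ (dTT N g q x) (gradient φ x)) b
  have h3 : ∀ x : E N, inner ℝ (dTT N g q (b • x)) (gradient φ (b • x)) =
      (q ^ N * b⁻¹) * inner ℝ (dNP N g x) (gradient ψ x) := by
    intro x
    have : q ^ 2 • b • x = x := by rw [smul_smul, hb, mul_inv_cancel₀ (by positivity), one_smul]
    rw [hgr, dTT, this, real_inner_smul_left, real_inner_smul_right]
    field_simp
  simp only [h3, integral_const_mul] at h2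
  rw [hg.weak hN hψ1 hψc] at h2
  rw [abs_of_pos (by positivity)] at h2
  simp only [finrank_euclideanSpace, Fintype.card_fin, smul_eq_mul] at h2
  refine ⟨b ^ N * (q ^ N * b⁻¹) * cN N, ?_, ?_⟩
  · rintro rfl; simp [hb]
  · have hbN : b ^ N ≠ 0 := by positivity
    field_simp at h2 ⊢
    linarith

theorem G0_exists {N : ℕ} (hN : 3 ≤ N) {R₀ R₁ : ℝ} (h0 : 0 < R₀) (h1 : R₀ < R₁) : ∃ C, 0 ≤ C ∧
    ∀ (f : E N → ℝ) (M : ℝ), 0 ≤ M → ContinuousOn f (annulus N R₀ R₁) →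
      (∀ x ∈ annulus N R₀ R₁, |f x| ≤ M) → ∃ u : E N → ℝ,
      ContDiffOn ℝ 1 u {x | R₀ / 2 < ‖x‖} ∧ (∀ x : E N, ‖x‖ = R₀ ∨ ‖x‖ = R₁ → u x = 0) ∧
      (∀ x : E N, R₀ / 2 < ‖x‖ → ‖gradient u x‖ ≤ C * M) ∧
      ∀ φ : E N → ℝ, ContDiff ℝ 1 φ → HasCompactSupport φ → tsupport φ ⊆ annulus N R₀ R₁ →
        ∫ x, inner ℝ (gradient u x) (gradient φ x) = ∫ x in annulus N R₀ R₁, f x * φ x := by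
  have hR1 : 0 < R₁ := h0.trans h1
  obtain ⟨C, hC, hTT⟩ := TT_bound hN (R := R₁) (r0 := R₀ / 2) hR1 (by positivity)
  set ρ := R₁ / R₀ with hρ
  have hρ1 : 1 < ρ := by rw [hρ, lt_div_iff₀ h0]; linarith
  have hρ0 : 0 < ρ := by linarith
  have hsum := summable_w (inv_pos.mpr hρ0).le (inv_lt_one_of_one_lt₀ hρ1)
  set W := ∑' k : ℤ, ρ⁻¹ ^ k.natAbs with hW
  have hW0 : 0 ≤ W := tsum_nonneg fun k => by positivity
  have hc := cN_pos hN
  refine ⟨(cN N)⁻¹ * (C * (1 + ρ ^ (N + 2)) * W), by positivity, ?_⟩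
  intro f M hM hf hfM
  set g := kden N R₀ R₁ f with hgdef
  have hg : Dens N g ((1 + ρ ^ (N + 2)) * M) R₁ := kden_dens h0 h1 hM hf hfM
  set M' := (1 + ρ ^ (N + 2)) * M with hM'
  set AO : Set (E N) := {x | R₀ / 2 < ‖x‖} with hAO
  have hAOo : IsOpen AO := isOpen_lt continuous_const continuous_norm
  set t : ℤ → E N → ℝ := fun k => TT N g (ρ ^ (-k)) with ht
  set d : ℤ → E N → E N := fun k => dTT N g (ρ ^ (-k)) with hd
  set w : ℤ → ℝ := fun k => C * M' * ρ⁻¹ ^ k.natAbs with hw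
  have hws : Summable w := hsum.mul_left _
  have htb : ∀ k, ∀ x ∈ AO, |t k x| ≤ w k ∧ ‖d k x‖ ≤ w k := fun k x hx =>
    hTT hg x (le_of_lt hx) _ (zpow_pos hρ0 _) _ (w_cases hρ1 k)
  have hder : ∀ k x, HasFDerivAt (t k) (innerSL ℝ (d k x)) x := fun k x => hg.hasFDerivAt_TT hN _ x
  have htsum : ∀ x ∈ AO, Summable fun k => t k x := fun x hx =>
    Summable.of_norm_bounded hws fun k => (htb k x hx).1
  have hdsum : ∀ x ∈ AO, Summable fun k => d k x := fun x hx =>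
    Summable.of_norm_bounded hws fun k => (htb k x hx).2
  have hUder : ∀ x ∈ AO, HasFDerivAt (fun y => ∑' k, t k y) (innerSL ℝ (∑' k, d k x)) x := by
    intro x hx
    obtain ⟨ε, hε, hball⟩ := Metric.isOpen_iff.1 hAOo x hx
    have := hasFDerivAt_tsum_of_isPreconnected hws (Metric.isOpen_ball (x := x) (ε := ε))
      (convex_ball x ε).isPreconnected (f := t) (f' := fun k x => innerSL ℝ (d k x))
      (fun k y _ => hder k y) (fun k y hy => by
        rw [innerSL_apply_norm]; exact (htb k y (hball hy)).2)
      (Metric.mem_ball_self hε) (htsum x hx) (Metric.mem_ball_self hε)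
    refine this.congr_fderiv ?_
    exact ((innerSL ℝ (E := E N)).map_tsum (hdsum x hx)).symm
  have hdc : ContinuousOn (fun x => ∑' k, d k x) AO :=
    continuousOn_tsum (fun k => (hg.continuous_dTT hN _).continuousOn) hws
      fun k x hx => (htb k x hx).2
  set u : E N → ℝ := fun x => (cN N)⁻¹ * ∑' k, t k x with hu
  have huder : ∀ x ∈ AO, HasFDerivAt u (innerSL ℝ ((cN N)⁻¹ • ∑' k, d k x)) x := by
    intro x hx
    refine ((hUder x hx).const_mul _).congr_fderiv ?_
    ext v; simp
  have hgrad : ∀ x ∈ AO, gradient u x = (cN N)⁻¹ • ∑' k, d k x := fun x hx =>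
    grad_of_hasFDerivAt (huder x hx)
  refine ⟨u, contDiffOn_one_of hAOo huder (hdc.const_smul (cN N)⁻¹), ?_, ?_, ?_⟩
  · have odd : ∀ (x : E N) (j : ℤ), ‖x‖ = R₀ * ρ ^ j → u x = 0 := by
      intro x j hx
      have h3 : ∀ k, t (j - k) x = - t k x := by
        intro k
        have := TT_odd hN (R₁ := R₁) h0 f (zpow_pos hρ0 j) (zpow_pos hρ0 (-k)) hx
        simp only [ht]
        rw [hgdef, ← this]; congr 1
        rw [← zpow_neg, ← zpow_neg, ← zpow_add₀ hρ0.ne']; congr 1; ring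
      have h4 := (Equiv.subLeft j).tsum_eq (fun k => t k x)
      simp only [Equiv.subLeft_apply, h3, tsum_neg] at h4
      have : ∑' k, t k x = 0 := by linarith
      simp [hu, this]
    rintro x (hx | hx)
    · exact odd x 0 (by simpa using hx)
    · refine odd x 1 ?_
      rw [hx, hρ, zpow_one]; field_simp
  · intro x hx
    rw [hgrad x hx, norm_smul, Real.norm_of_nonneg (inv_pos.mpr hc).le, mul_assoc]
    refine mul_le_mul_of_nonneg_left ?_ (inv_pos.mpr hc).le
    have := tsum_of_norm_bounded hws.hasSum fun k => (htb k x hx).2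
    refine this.trans (le_of_eq ?_)
    rw [hw, tsum_mul_left]; ring
  · intro φ hφ hφc hφA
    have hsub : ∀ x, x ∉ AO → gradient φ x = 0 := by
      intro x hx
      apply grad_zero_of_notMem
      intro h
      apply hx
      have := (hφA h).1
      simp only [hAO, mem_setOf_eq]; linarith
    have hintg : HasSum (fun k => ∫ x, inner ℝ (d k x) (gradient φ x))
        (∫ x, inner ℝ (∑' k, d k x) (gradient φ x)) := by
      refine hasSum_integral_of_dominated_convergence (fun k x => w k * ‖gradient φ x‖) ?_ ?_ ?_ ?_ ?_
      · intro k
        exact ((hg.continuous_dTT hN _).inner (continuous_grad hφ)).aestronglyMeasurable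
      · intro k
        refine ae_of_all _ fun x => ?_
        by_cases hx : x ∈ AO
        · refine (norm_inner_le_norm _ _).trans ?_
          exact mul_le_mul_of_nonneg_right (htb k x hx).2 (norm_nonneg _)
        · simp [hsub x hx]
      · exact ae_of_all _ fun x => hws.mul_right _
      · simp only [tsum_mul_right]
        exact (((continuous_grad hφ).norm).integrable_of_hasCompactSupport
          (cptsupp_grad hφc).norm).const_mul _
      · refine ae_of_all _ fun x => ?_
        by_cases hx : x ∈ AO
        · have h5 := (hdsum x hx).hasSum.mapL ((innerSL ℝ (E := E N)) (gradient φ x))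
          simpa [real_inner_comm] using h5
        · simp only [hsub x hx, inner_zero_right]; exact hasSum_zero
    have hz : ∀ k : ℤ, k ≠ 0 → ∫ x, inner ℝ (d k x) (gradient φ x) = 0 := by
      intro k hk
      obtain ⟨c, _, hcw⟩ := TT_weak hN hg (zpow_pos hρ0 (-k)) hφ hφc
      rw [hd, hcw]
      have : (fun y => g y * φ (((ρ ^ (-k)) ^ 2)⁻¹ • y)) = fun _ => 0 := by
        ext y
        by_contra hne
        rw [mul_eq_zero, not_or] at hne
        obtain ⟨s1, s2⟩ := kden_supp h0 h1 hne.1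
        have s3 := hφA (subset_tsupport _ hne.2)
        obtain ⟨s3, s4⟩ := s3
        have e : ‖((ρ ^ (-k)) ^ 2)⁻¹ • y‖ = (ρ ^ k) ^ 2 * ‖y‖ := by
          rw [norm_smul, norm_inv, norm_pow, Real.norm_of_nonneg (zpow_pos hρ0 _).le, zpow_neg,
            inv_pow, inv_inv]
        rw [e] at s3 s4
        rcases lt_or_gt_of_ne hk with hneg | hpos
        · have : ρ ^ k ≤ ρ⁻¹ := by
            rw [← zpow_neg_one]; exact zpow_le_zpow_right₀ hρ1.le (by omega)
          have h6 : (ρ ^ k) ^ 2 ≤ ρ⁻¹ ^ 2 := pow_le_pow_left₀ (zpow_pos hρ0 _).le this 2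
          have h7 : (ρ ^ k) ^ 2 * ‖y‖ ≤ ρ⁻¹ ^ 2 * R₁ :=
            mul_le_mul h6 s2.le (norm_nonneg _) (by positivity)
          have h8 : ρ⁻¹ ^ 2 * R₁ = R₀ * (R₀ / R₁) := by rw [hρ]; field_simp
          have h9 : R₀ / R₁ < 1 := by rw [div_lt_one hR1]; exact h1
          nlinarith
        · have : ρ ≤ ρ ^ k := by
            conv_lhs => rw [← zpow_one ρ]
            exact zpow_le_zpow_right₀ hρ1.le (by omega)
          have h6 : ρ ^ 2 ≤ (ρ ^ k) ^ 2 := pow_le_pow_left₀ hρ0.le this 2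
          have h7 : ρ ^ 2 * (R₀ ^ 2 / R₁) ≤ (ρ ^ k) ^ 2 * ‖y‖ :=
            mul_le_mul h6 s1.le (by positivity) (by positivity)
          have h8 : ρ ^ 2 * (R₀ ^ 2 / R₁) = R₁ := by rw [hρ]; field_simp
          linarith
      rw [this]; simp
    have h5 := hintg.unique (hasSum_single 0 hz)
    have h6 : ∫ x, inner ℝ (gradient u x) (gradient φ x) =
        (cN N)⁻¹ * ∫ x, inner ℝ (∑' k, d k x) (gradient φ x) := by
      rw [← integral_const_mul]
      congr 1; ext x
      by_cases hx : x ∈ AO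
      · rw [hgrad x hx, real_inner_smul_left]
      · simp [hsub x hx]
    obtain ⟨c, hc1, hcw⟩ := TT_weak hN hg (zpow_pos hρ0 (-0)) hφ hφc
    rw [h6, h5, hd, hcw, hc1 (by simp), ← mul_assoc, inv_mul_cancel₀ hc.ne', one_mul]
    rw [← integral_indicator (meas_annulus N R₀ R₁)]
    congr 1; ext y
    by_cases hy : y ∈ annulus N R₀ R₁
    · rw [indicator_of_mem hy, hgdef, kden_on h0 hy]; simp
    · have : φ y = 0 := by
        by_contra hne
        exact hy (hφA (subset_tsupport _ hne))
      rw [indicator_of_notMem hy]; simp [this]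

end NR

open MeasureTheory Real Set
namespace NR
open Filter Topology

lemma cont_of_cpt {N : ℕ} {F : Type*} [TopologicalSpace F] [Zero F] {Ω K : Set (E N)} (hΩ : IsOpen Ω)
    (hK : IsClosed K) (hKΩ : K ⊆ Ω) {h : E N → F} (hc : ContinuousOn h Ω) (h0 : ∀ x, x ∉ K → h x = 0) :
    Continuous h := by
  rw [continuous_iff_continuousAt]
  intro x
  by_cases hx : x ∈ Ω
  · exact hc.continuousAt (hΩ.mem_nhds hx)
  · have hxK : x ∉ K := fun h => hx (hKΩ h)
    have : h =ᶠ[𝓝 x] fun _ => 0 := by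
      filter_upwards [hK.isOpen_compl.mem_nhds hxK] with y hy using h0 y hy
    exact this.continuousAt

lemma cpt_of_zero {N : ℕ} {F : Type*} [Zero F] {K : Set (E N)}
    (hK : IsCompact K) {h : E N → F} (h0 : ∀ x, x ∉ K → h x = 0) : HasCompactSupport h :=
  HasCompactSupport.intro hK h0

/-- C¹ compactly supported test functions in an open set -/
structure Tst {N : ℕ} (Ω : Set (E N)) (φ : E N → ℝ) : Prop where
  c1 : ContDiff ℝ 1 φ
  cs : HasCompactSupport φ
  ts : tsupport φ ⊆ Ω

lemma Tst.mono {N : ℕ} {Ω Ω' : Set (E N)} {φ : E N → ℝ} (h : Tst Ω φ) (h' : Ω ⊆ Ω') : Tst Ω' φ :=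
  ⟨h.c1, h.cs, h.ts.trans h'⟩

lemma Tst.zero {N : ℕ} {Ω : Set (E N)} {φ : E N → ℝ} (h : Tst Ω φ) {x : E N} (hx : x ∉ Ω) : φ x = 0 :=
  image_eq_zero_of_notMem_tsupport fun h' => hx (h.ts h')

lemma continuousOn_grad {N : ℕ} {u : E N → ℝ} {s : Set (E N)} (hs : IsOpen s) (hu : ContDiffOn ℝ 1 u s) :
    ContinuousOn (fun x => gradient u x) s := by
  have := (hu.continuousOn_fderiv_of_isOpen hs le_rfl)
  exact (InnerProductSpace.toDual ℝ (E N)).symm.continuous.comp_continuousOn this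

/-- products with gradients of test functions are continuous with compact support -/
lemma Tst.inner_cont {N : ℕ} {Ω : Set (E N)} (hΩ : IsOpen Ω) {φ : E N → ℝ} (h : Tst Ω φ) {V : E N → E N}
    (hV : ContinuousOn V Ω) :
    Continuous (fun x => inner ℝ (V x) (gradient φ x)) ∧
    HasCompactSupport (fun x => inner ℝ (V x) (gradient φ x)) := by
  have h0 : ∀ x, x ∉ tsupport φ → inner ℝ (V x) (gradient φ x) = 0 := by
    intro x hx; rw [grad_zero_of_notMem hx, inner_zero_right]
  exact ⟨cont_of_cpt hΩ (isClosed_tsupport φ) h.ts (hV.inner (continuous_grad h.c1).continuousOn) h0,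
    cpt_of_zero h.cs h0⟩

lemma Tst.mul_cont {N : ℕ} {Ω : Set (E N)} (hΩ : IsOpen Ω) {φ : E N → ℝ} (h : Tst Ω φ) {f : E N → ℝ}
    (hf : ContinuousOn f Ω) :
    Continuous (fun x => f x * φ x) ∧ HasCompactSupport (fun x => f x * φ x) := by
  have h0 : ∀ x, x ∉ tsupport φ → f x * φ x = 0 := by
    intro x hx; rw [image_eq_zero_of_notMem_tsupport hx, mul_zero]
  exact ⟨cont_of_cpt hΩ (isClosed_tsupport φ) h.ts (hf.mul h.c1.continuous.continuousOn) h0,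
    cpt_of_zero h.cs h0⟩

lemma Tst.inner_int {N : ℕ} {Ω : Set (E N)} (hΩ : IsOpen Ω) {φ : E N → ℝ} (h : Tst Ω φ) {V : E N → E N}
    (hV : ContinuousOn V Ω) : Integrable (fun x => inner ℝ (V x) (gradient φ x)) :=
  (h.inner_cont hΩ hV).1.integrable_of_hasCompactSupport (h.inner_cont hΩ hV).2

lemma Tst.mul_int {N : ℕ} {Ω : Set (E N)} (hΩ : IsOpen Ω) {φ : E N → ℝ} (h : Tst Ω φ) {f : E N → ℝ}
    (hf : ContinuousOn f Ω) : Integrable (fun x => f x * φ x) :=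
  (h.mul_cont hΩ hf).1.integrable_of_hasCompactSupport (h.mul_cont hΩ hf).2

lemma testfun {N : ℕ} {Ω : Set (E N)} (hΩ : IsOpen Ω) (hb : Bornology.IsBounded Ω) {v : E N → ℝ}
    (hv : ContinuousOn v (closure Ω)) (hv1 : ContDiffOn ℝ 1 v Ω) (hfr : ∀ x ∈ frontier Ω, v x ≤ 0)
    {Θ : ℝ → ℝ} (hΘ : ContDiff ℝ 1 Θ) {δ : ℝ} (hδ : 0 < δ) (hΘ0 : ∀ t ≤ δ, Θ t = 0) :
    Tst Ω (Ω.indicator fun x => Θ (v x)) ∧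
    ∀ x ∈ Ω, gradient (Ω.indicator fun x => Θ (v x)) x = deriv Θ (v x) • gradient v x := by
  set ψ := Ω.indicator fun x => Θ (v x)
  set K := closure Ω ∩ v ⁻¹' (Ici δ)
  have hKc : IsClosed K := hv.preimage_isClosed_of_isClosed isClosed_closure isClosed_Ici
  have hcpt : IsCompact K := hb.isCompact_closure.of_isClosed_subset hKc inter_subset_left
  have hKΩ : K ⊆ Ω := by
    intro x hx
    by_contra h
    have : x ∈ frontier Ω := ⟨hx.1, fun h' => h (interior_subset h')⟩
    have h1 := hfr x this
    have h2 : δ ≤ v x := hx.2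
    linarith
  have h0 : ∀ x, x ∉ K → ψ x = 0 := by
    intro x hx
    by_cases hxΩ : x ∈ Ω
    · have : ¬ δ ≤ v x := fun h => hx ⟨subset_closure hxΩ, h⟩
      simp only [ψ, indicator_of_mem hxΩ]
      exact hΘ0 _ (by linarith)
    · simp [ψ, hxΩ]
  have heq : ∀ x ∈ Ω, ψ =ᶠ[𝓝 x] fun x => Θ (v x) := by
    intro x hx
    filter_upwards [hΩ.mem_nhds hx] with y hy
    simp [ψ, hy]
  refine ⟨⟨?_, cpt_of_zero hcpt h0, ?_⟩, ?_⟩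
  · rw [contDiff_iff_contDiffAt]
    intro x
    by_cases hx : x ∈ Ω
    · have h1 : ContDiffAt ℝ 1 v x := hv1.contDiffAt (hΩ.mem_nhds hx)
      exact (hΘ.contDiffAt.comp x h1).congr_of_eventuallyEq (heq x hx)
    · have hxK : x ∉ K := fun h => hx (hKΩ h)
      have : ψ =ᶠ[𝓝 x] fun _ => 0 := by
        filter_upwards [hKc.isOpen_compl.mem_nhds hxK] with y hy using h0 y hy
      exact contDiffAt_const.congr_of_eventuallyEq this
  · refine (closure_minimal ?_ hKc).trans hKΩ
    intro x hx
    by_contra h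
    exact hx (h0 x h)
  · intro x hx
    have h1 : HasFDerivAt v (fderiv ℝ v x) x :=
      ((hv1.contDiffAt (hΩ.mem_nhds hx)).differentiableAt one_ne_zero).hasFDerivAt
    have h2 : HasDerivAt Θ (deriv Θ (v x)) (v x) := (hΘ.differentiable one_ne_zero _).hasDerivAt
    have h3 := (h2.comp_hasFDerivAt x h1).congr_of_eventuallyEq (heq x hx)
    apply grad_of_hasFDerivAt
    refine h3.congr_fderiv ?_
    ext w
    simp [inner_smul_left, inner_grad]

lemma sqpos_c1 (δ : ℝ) : ContDiff ℝ 1 (fun t : ℝ => (max (t - δ) 0) ^ 2) ∧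
    ∀ t, deriv (fun t : ℝ => (max (t - δ) 0) ^ 2) t = 2 * max (t - δ) 0 := by
  have h : ∀ t, HasDerivAt (fun t : ℝ => (max (t - δ) 0) ^ 2) (2 * max (t - δ) 0) t := by
    intro t
    rcases lt_trichotomy t δ with h | h | h
    · have : (fun t : ℝ => (max (t - δ) 0) ^ 2) =ᶠ[𝓝 t] fun _ => 0 := by
        filter_upwards [Iio_mem_nhds h] with y hy
        rw [max_eq_right (by simp at hy; linarith)]; norm_num
      rw [max_eq_right (by linarith)]
      simpa using (hasDerivAt_const t (0 : ℝ)).congr_of_eventuallyEq this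
    · subst h
      simp only [sub_self, max_self, mul_zero]
      rw [hasDerivAt_iff_isLittleO]
      simp only [sub_self, max_self, smul_zero, sub_zero]
      have : (fun x : ℝ => (max (x - t) 0) ^ 2 - 0 ^ 2) =O[𝓝 t] fun x => (x - t) ^ 2 := by
        refine Asymptotics.IsBigO.of_bound 1 (Eventually.of_forall fun x => ?_)
        rw [Real.norm_of_nonneg (by simp), Real.norm_of_nonneg (by positivity)]
        rcases le_total (x - t) 0 with h | h
        · rw [max_eq_right h]; nlinarith
        · rw [max_eq_left h]; linarith
      refine this.trans_isLittleO ?_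
      have : (fun x : ℝ => (x - t) ^ 2) = fun x => (x - t) * (x - t) := by ext; ring
      rw [this]
      have h2 : (fun x : ℝ => x - t) =o[𝓝 t] (fun _ => (1 : ℝ)) := by
        rw [Asymptotics.isLittleO_one_iff]
        have : Tendsto (fun x : ℝ => x - t) (𝓝 t) (𝓝 (t - t)) := (continuous_id.sub continuous_const).tendsto t
        simpa using this
      simpa using h2.mul_isBigO (Asymptotics.isBigO_refl (fun x : ℝ => x - t) (𝓝 t))
    · have : (fun t : ℝ => (max (t - δ) 0) ^ 2) =ᶠ[𝓝 t] fun t => (t - δ) ^ 2 := by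
        filter_upwards [Ioi_mem_nhds h] with y hy
        rw [max_eq_left (by simp at hy; linarith)]
      rw [max_eq_left (by linarith)]
      have h3 := (((hasDerivAt_id t).sub_const δ).pow 2).congr_of_eventuallyEq this
      simpa using h3
  refine ⟨?_, fun t => (h t).deriv⟩
  rw [contDiff_one_iff_deriv]
  refine ⟨fun t => (h t).differentiableAt, ?_⟩
  rw [show deriv (fun t : ℝ => (max (t - δ) 0) ^ 2) = fun t => 2 * max (t - δ) 0 from
    funext fun t => (h t).deriv]
  fun_prop

set_option maxHeartbeats 1000000 in
lemma MP {N : ℕ} (hN : 3 ≤ N) {Ω : Set (E N)} (hΩ : IsOpen Ω) (hb : Bornology.IsBounded Ω) {u : E N → ℝ}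
    (hv : ContinuousOn u (closure Ω)) (hv1 : ContDiffOn ℝ 1 u Ω) (hfr : ∀ x ∈ frontier Ω, 0 ≤ u x)
    {s : ℝ} (hs : 0 ≤ s) (hw : ∀ φ, Tst Ω φ → (∀ x, 0 ≤ φ x) →
      0 ≤ ∫ x, (inner ℝ (gradient u x) (gradient φ x) + s * (u x * φ x))) :
    ∀ x ∈ closure Ω, 0 ≤ u x := by
  have hne : Nonempty (Fin N) := ⟨⟨0, by omega⟩⟩
  have key : ∀ x ∈ Ω, 0 ≤ u x := by
    intro x hx
    by_contra! hneg
    set δ := - u x / 2 with hδ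
    have hδ0 : 0 < δ := by linarith
    obtain ⟨hc, hd⟩ := sqpos_c1 δ
    obtain ⟨ht, hg⟩ := testfun hΩ hb (v := fun x => - u x) hv.neg hv1.neg
      (fun x hx => by linarith [hfr x hx]) hc hδ0 (fun t ht => by
        simp only [max_eq_right (by linarith : t - δ ≤ 0)]; norm_num)
    set φ := Ω.indicator fun x => (max (- u x - δ) 0) ^ 2 with hφ
    have hgn : ∀ y ∈ Ω, gradient (fun x => - u x) y = - gradient u y := by
      intro y hy
      apply grad_of_hasFDerivAt
      have h1 : HasFDerivAt u (fderiv ℝ u y) y :=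
        ((hv1.contDiffAt (hΩ.mem_nhds hy)).differentiableAt one_ne_zero).hasFDerivAt
      refine h1.neg.congr_fderiv ?_
      ext w; simp [inner_grad]
    have hpos : ∀ y, 0 ≤ φ y := fun y => indicator_nonneg (fun _ _ => by positivity) y
    have h1 := hw φ ht hpos
    have hgu := continuousOn_grad hΩ hv1
    have hcu : ContinuousOn u Ω := hv.mono subset_closure
    obtain ⟨c1, c2⟩ := ht.inner_cont hΩ hgu
    obtain ⟨c3, c4⟩ := ht.mul_cont hΩ hcu
    set F := fun y => inner ℝ (gradient u y) (gradient φ y) + s * (u y * φ y) with hF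
    have cF : Continuous F := c1.add (c3.const_mul s)
    have cFs : HasCompactSupport F := cpt_of_zero ht.cs fun y hy => by
      simp only [hF, grad_zero_of_notMem hy, image_eq_zero_of_notMem_tsupport hy, inner_zero_right,
        mul_zero, add_zero]
    have hgy : ∀ y ∈ Ω, gradient φ y = (2 * max (-u y - δ) 0) • - gradient u y := by
      intro y hy
      rw [hg y hy, hgn y hy, hd]
    have hneg1 : ∀ y ∈ Ω, inner ℝ (gradient u y) (gradient φ y) =
        - (2 * max (-u y - δ) 0 * ‖gradient u y‖ ^ 2) := by
      intro y hy
      rw [hgy y hy, inner_smul_right, inner_neg_right, real_inner_self_eq_norm_sq]; ring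
    have hsneg : ∀ y ∈ Ω, s * (u y * φ y) ≤ 0 := by
      intro y hy
      simp only [hφ, indicator_of_mem hy]
      rcases le_total (- u y - δ) 0 with h | h
      · rw [max_eq_right h]; simp
      · have : u y ≤ 0 := by linarith
        exact mul_nonpos_of_nonneg_of_nonpos hs (mul_nonpos_of_nonpos_of_nonneg this (by positivity))
    have hFneg : ∀ y, F y ≤ 0 := by
      intro y
      by_cases hy : y ∈ Ω
      · have := hneg1 y hy
        have h2 := hsneg y hy
        have h3 : 0 ≤ 2 * max (-u y - δ) 0 * ‖gradient u y‖ ^ 2 := by positivity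
        simp only [hF]; linarith
      · have h2 : y ∉ tsupport φ := fun h => hy (ht.ts h)
        simp only [hF, grad_zero_of_notMem h2, image_eq_zero_of_notMem_tsupport h2, inner_zero_right,
          mul_zero, add_zero, le_refl]
    have hF0 : (fun y => - F y) = 0 := by
      have h3 : 0 ≤ fun y => - F y := fun y => by simpa using hFneg y
      have hi : Integrable (fun y => - F y) := (cF.integrable_of_hasCompactSupport cFs).neg
      have h4 : ∫ y, - F y = 0 := by
        refine le_antisymm ?_ (integral_nonneg h3)
        rw [integral_neg]; linarith
      have h5 := (integral_eq_zero_iff_of_nonneg h3 hi).1 h4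
      exact (Continuous.ae_eq_iff_eq volume cF.neg continuous_const).1 h5
    have hgz : ∀ y, fderiv ℝ φ y = 0 := by
      intro y
      have hz : gradient φ y = 0 := by
        by_cases hy : y ∈ Ω
        · have h6 : F y = 0 := by simpa using congrFun hF0 y
          have h2 := hsneg y hy
          have h3 : 0 ≤ max (-u y - δ) 0 := by positivity
          have h7 : max (-u y - δ) 0 * ‖gradient u y‖ ^ 2 = 0 := by
            have h8 : 0 ≤ max (-u y - δ) 0 * ‖gradient u y‖ ^ 2 := by positivity
            simp only [hF, hneg1 y hy] at h6; linarith
          rw [hgy y hy]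
          rcases mul_eq_zero.1 h7 with h | h
          · rw [h]; simp
          · have : gradient u y = 0 := by simpa using h
            rw [this]; simp
        · have h2 : y ∉ tsupport φ := fun h => hy (ht.ts h)
          exact grad_zero_of_notMem h2
      ext w
      rw [← inner_grad, hz]; simp
    obtain ⟨z, hz⟩ : ∃ z, z ∉ Ω := by
      by_contra! h
      have : Ω = univ := eq_univ_of_forall h
      rw [this] at hb
      exact NormedSpace.unbounded_univ ℝ (E N) hb
    have h8 := is_const_of_fderiv_eq_zero (ht.c1.differentiable one_ne_zero) hgz x z
    rw [ht.zero hz] at h8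
    simp only [hφ, indicator_of_mem hx] at h8
    have : 0 < max (-u x - δ) 0 := lt_max_of_lt_left (by linarith)
    have h9 : 0 < (max (-u x - δ) 0) ^ 2 := by positivity
    linarith
  intro x hx
  by_cases h : x ∈ Ω
  · exact key x h
  · exact hfr x ⟨hx, fun h' => h (interior_subset h')⟩

end NR

open MeasureTheory Real Set
namespace NR
open Filter Topology

/-- closed annulus -/
def cA (N : ℕ) (R₀ R₁ : ℝ) : Set (E N) := {x | R₀ ≤ ‖x‖ ∧ ‖x‖ ≤ R₁}

/-- neighbourhood of the closed annulus -/
def AO (N : ℕ) (R₀ : ℝ) : Set (E N) := {x | R₀ / 2 < ‖x‖}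

lemma isOpen_AO (N : ℕ) (R₀ : ℝ) : IsOpen (AO N R₀) := isOpen_lt continuous_const continuous_norm

lemma isClosed_cA (N : ℕ) (R₀ R₁ : ℝ) : IsClosed (cA N R₀ R₁) :=
  (isClosed_le continuous_const continuous_norm).inter (isClosed_le continuous_norm continuous_const)

lemma isCompact_cA (N : ℕ) (R₀ R₁ : ℝ) : IsCompact (cA N R₀ R₁) := by
  refine (isCompact_closedBall (0 : E N) R₁).of_isClosed_subset (isClosed_cA _ _ _) ?_
  intro x hx
  simpa using hx.2

lemma ann_sub_cA (N : ℕ) (R₀ R₁ : ℝ) : annulus N R₀ R₁ ⊆ cA N R₀ R₁ := fun _ hx => ⟨hx.1.le, hx.2.le⟩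

lemma cA_sub_AO {N : ℕ} {R₀ R₁ : ℝ} (h0 : 0 < R₀) : cA N R₀ R₁ ⊆ AO N R₀ := by
  intro x hx
  have := hx.1
  show R₀ / 2 < ‖x‖
  linarith

lemma bdd_annulus (N : ℕ) (R₀ R₁ : ℝ) : Bornology.IsBounded (annulus N R₀ R₁) :=
  (isCompact_cA N R₀ R₁).isBounded.subset (ann_sub_cA _ _ _)

lemma closure_annulus {N : ℕ} {R₀ R₁ : ℝ} (h0 : 0 < R₀) (h1 : R₀ < R₁) :
    closure (annulus N R₀ R₁) = cA N R₀ R₁ := by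
  refine subset_antisymm (closure_minimal (ann_sub_cA _ _ _) (isClosed_cA _ _ _)) ?_
  intro x hx
  have hx0 : 0 < ‖x‖ := lt_of_lt_of_le h0 hx.1
  have hc : Continuous (fun t : ℝ => ((1 - t) + t * ((R₀ + R₁) / 2 / ‖x‖)) • x) := by fun_prop
  have ht := (hc.tendsto 0).mono_left (nhdsWithin_le_nhds (s := Ioi 0))
  simp only [sub_zero, zero_mul, add_zero, one_smul] at ht
  refine mem_closure_of_tendsto ht ?_
  filter_upwards [Ioo_mem_nhdsGT (zero_lt_one : (0 : ℝ) < 1)] with t ht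
  have e : ‖((1 - t) + t * ((R₀ + R₁) / 2 / ‖x‖)) • x‖ = (1 - t) * ‖x‖ + t * ((R₀ + R₁) / 2) := by
    rw [norm_smul, Real.norm_of_nonneg]
    · field_simp
    · have : 0 ≤ 1 - t := by linarith [ht.2]
      have := ht.1
      have : 0 < R₁ := by linarith
      positivity
  have := hx.1
  have := hx.2
  constructor
  · rw [e]; nlinarith [ht.1, ht.2]
  · rw [e]; nlinarith [ht.1, ht.2]

lemma frontier_annulus {N : ℕ} {R₀ R₁ : ℝ} (h0 : 0 < R₀) (h1 : R₀ < R₁) {x : E N}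
    (hx : x ∈ frontier (annulus N R₀ R₁)) : ‖x‖ = R₀ ∨ ‖x‖ = R₁ := by
  rw [frontier, closure_annulus h0 h1, (isOpen_annulus _ _ _).interior_eq] at hx
  obtain ⟨⟨h2, h3⟩, h4⟩ := hx
  by_contra! h
  exact h4 ⟨lt_of_le_of_ne h2 (Ne.symm h.1), lt_of_le_of_ne h3 h.2⟩

lemma grad_sub {N : ℕ} {u v : E N → ℝ} {x : E N} (hu : DifferentiableAt ℝ u x)
    (hv : DifferentiableAt ℝ v x) : gradient (fun x => u x - v x) x = gradient u x - gradient v x := by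
  apply grad_of_hasFDerivAt
  refine (hu.hasFDerivAt.sub hv.hasFDerivAt).congr_fderiv ?_
  ext w; simp only [ContinuousLinearMap.sub_apply, innerSL_apply_apply, inner_sub_left, inner_grad]

lemma grad_smul {N : ℕ} {u : E N → ℝ} {x : E N} (c : ℝ) (hu : DifferentiableAt ℝ u x) :
    gradient (fun x => c * u x) x = c • gradient u x := by
  apply grad_of_hasFDerivAt
  refine (hu.hasFDerivAt.const_mul c).congr_fderiv ?_
  ext w; simp only [ContinuousLinearMap.smul_apply, innerSL_apply_apply, real_inner_smul_left, inner_grad,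
    smul_eq_mul]

/-- weak form of `-Δ u = F` in `Ω` -/
structure WS {N : ℕ} (Ω : Set (E N)) (u F : E N → ℝ) : Prop where
  c1 : ContDiffOn ℝ 1 u Ω
  fc : ContinuousOn F Ω
  wk : ∀ φ, Tst Ω φ → ∫ x, inner ℝ (gradient u x) (gradient φ x) = ∫ x, F x * φ x

lemma WS.diff {N : ℕ} {Ω : Set (E N)} (hΩ : IsOpen Ω) {u F : E N → ℝ} (h : WS Ω u F) {x : E N} (hx : x ∈ Ω) :
    DifferentiableAt ℝ u x :=
  (h.c1.contDiffAt (hΩ.mem_nhds hx)).differentiableAt one_ne_zero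

lemma WS.mono {N : ℕ} {Ω Ω' : Set (E N)} {u F : E N → ℝ} (h : WS Ω u F) (h' : Ω' ⊆ Ω) : WS Ω' u F :=
  ⟨h.c1.mono h', h.fc.mono h', fun φ hφ => h.wk φ (hφ.mono h')⟩

lemma WS.sub {N : ℕ} {Ω : Set (E N)} (hΩ : IsOpen Ω) {u F v G : E N → ℝ} (h : WS Ω u F) (h' : WS Ω v G) :
    WS Ω (fun x => u x - v x) (fun x => F x - G x) := by
  refine ⟨h.c1.sub h'.c1, h.fc.sub h'.fc, fun φ hφ => ?_⟩
  have e1 : ∀ x, inner ℝ (gradient (fun x => u x - v x) x) (gradient φ x) =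
      inner ℝ (gradient u x) (gradient φ x) - inner ℝ (gradient v x) (gradient φ x) := by
    intro x
    by_cases hx : x ∈ Ω
    · rw [grad_sub (h.diff hΩ hx) (h'.diff hΩ hx), inner_sub_left]
    · rw [grad_zero_of_notMem (fun h => hx (hφ.ts h))]; simp
  simp_rw [e1, sub_mul]
  rw [integral_sub (hφ.inner_int hΩ (continuousOn_grad hΩ h.c1)) (hφ.inner_int hΩ (continuousOn_grad hΩ h'.c1)),
    integral_sub (hφ.mul_int hΩ h.fc) (hφ.mul_int hΩ h'.fc), h.wk φ hφ, h'.wk φ hφ]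

lemma WS.smul {N : ℕ} {Ω : Set (E N)} (hΩ : IsOpen Ω) {u F : E N → ℝ} (h : WS Ω u F) (c : ℝ) :
    WS Ω (fun x => c * u x) (fun x => c * F x) := by
  refine ⟨contDiffOn_const.mul h.c1, continuousOn_const.mul h.fc, fun φ hφ => ?_⟩
  have e1 : ∀ x, inner ℝ (gradient (fun x => c * u x) x) (gradient φ x) =
      c * inner ℝ (gradient u x) (gradient φ x) := by
    intro x
    by_cases hx : x ∈ Ω
    · rw [grad_smul _ (h.diff hΩ hx), real_inner_smul_left]
    · rw [grad_zero_of_notMem (fun h => hx (hφ.ts h))]; simp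
  simp_rw [e1, mul_assoc]
  rw [integral_const_mul, integral_const_mul, h.wk φ hφ]

lemma WS.congr {N : ℕ} {Ω : Set (E N)} (hΩ : IsOpen Ω) {u F v G : E N → ℝ} (h : WS Ω u F)
    (hu : ∀ x ∈ Ω, v x = u x) (hF : ∀ x ∈ Ω, G x = F x) : WS Ω v G := by
  refine ⟨h.c1.congr hu, h.fc.congr hF, fun φ hφ => ?_⟩
  have e1 : ∀ x, inner ℝ (gradient v x) (gradient φ x) = inner ℝ (gradient u x) (gradient φ x) := by
    intro x
    by_cases hx : x ∈ Ω
    · have : v =ᶠ[𝓝 x] u := by filter_upwards [hΩ.mem_nhds hx] with y hy using hu y hy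
      rw [gradient, gradient, this.fderiv_eq]; rfl
    · rw [grad_zero_of_notMem (fun h => hx (hφ.ts h))]; simp
  have e2 : ∀ x, G x * φ x = F x * φ x := by
    intro x
    by_cases hx : x ∈ Ω
    · rw [hF x hx]
    · rw [hφ.zero hx]; simp
  simp_rw [e1, e2]
  exact h.wk φ hφ

lemma WS.MP {N : ℕ} (hN : 3 ≤ N) {Ω : Set (E N)} (hΩ : IsOpen Ω) (hb : Bornology.IsBounded Ω) {u F : E N → ℝ}
    (h : WS Ω u F) (hv : ContinuousOn u (closure Ω)) (hfr : ∀ x ∈ frontier Ω, 0 ≤ u x)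
    {s : ℝ} (hs : 0 ≤ s) (hF : ∀ x ∈ Ω, 0 ≤ F x + s * u x) :
    ∀ x ∈ closure Ω, 0 ≤ u x := by
  refine NR.MP hN hΩ hb hv h.c1 hfr hs fun φ hφ hφ0 => ?_
  have hcu : ContinuousOn u Ω := hv.mono subset_closure
  rw [integral_add (hφ.inner_int hΩ (continuousOn_grad hΩ h.c1)) ((hφ.mul_int hΩ hcu).const_mul s),
    h.wk φ hφ, ← integral_add (hφ.mul_int hΩ h.fc) ((hφ.mul_int hΩ hcu).const_mul s)]
  refine integral_nonneg fun x => ?_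
  by_cases hx : x ∈ Ω
  · have := mul_nonneg (hF x hx) (hφ0 x)
    simp only [Pi.zero_apply]; nlinarith
  · simp [hφ.zero hx]

/-- weak form of `-Δ u + s u = f` with zero boundary values -/
structure Sol (N : ℕ) (R₀ R₁ s : ℝ) (f u : E N → ℝ) : Prop where
  c1 : ContDiffOn ℝ 1 u (AO N R₀)
  bd : ∀ x : E N, ‖x‖ = R₀ ∨ ‖x‖ = R₁ → u x = 0
  ws : WS (annulus N R₀ R₁) u (fun x => f x - s * u x)

section
variable {N : ℕ} {R₀ R₁ : ℝ}

lemma Sol.cont {s : ℝ} {f u : E N → ℝ} (h : Sol N R₀ R₁ s f u) (h0 : 0 < R₀) : ContinuousOn u (cA N R₀ R₁) :=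
  h.c1.continuousOn.mono (cA_sub_AO h0)

/-- comparison principle -/
lemma Sol.comp (hN : 3 ≤ N) (h0 : 0 < R₀) (h1 : R₀ < R₁) {s t : ℝ} {f u g v : E N → ℝ}
    (h : Sol N R₀ R₁ s f u) (h' : Sol N R₀ R₁ t g v) {a : ℝ} (ha : 0 ≤ a)
    (hfg : ∀ x ∈ annulus N R₀ R₁, 0 ≤ (f x - s * u x) - (g x - t * v x) + a * (u x - v x)) :
    ∀ x ∈ cA N R₀ R₁, v x ≤ u x := by
  have hw := h.ws.sub (isOpen_annulus _ _ _) h'.ws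
  intro x hx
  have := hw.MP hN (isOpen_annulus _ _ _) (bdd_annulus _ _ _)
    (by rw [closure_annulus h0 h1]; exact (h.cont h0).sub (h'.cont h0))
    (fun x hx => by rw [h.bd x (frontier_annulus h0 h1 hx), h'.bd x (frontier_annulus h0 h1 hx)]; simp) ha hfg x
    (by rw [closure_annulus h0 h1]; exact hx)
  linarith

lemma Sol.mono (hN : 3 ≤ N) (h0 : 0 < R₀) (h1 : R₀ < R₁) {s : ℝ} (hs : 0 ≤ s) {f u g v : E N → ℝ}
    (h : Sol N R₀ R₁ s f u) (h' : Sol N R₀ R₁ s g v)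
    (hfg : ∀ x ∈ annulus N R₀ R₁, g x ≤ f x) : ∀ x ∈ cA N R₀ R₁, v x ≤ u x :=
  h.comp hN h0 h1 h' hs fun x hx => by linarith [hfg x hx]

lemma Sol.uniq (hN : 3 ≤ N) (h0 : 0 < R₀) (h1 : R₀ < R₁) {s : ℝ} (hs : 0 ≤ s) {f u g v : E N → ℝ}
    (h : Sol N R₀ R₁ s f u) (h' : Sol N R₀ R₁ s g v)
    (hfg : ∀ x ∈ annulus N R₀ R₁, f x = g x) : ∀ x ∈ cA N R₀ R₁, u x = v x := fun x hx =>
  le_antisymm (h'.mono hN h0 h1 hs h (fun x hx => (hfg x hx).le) x hx)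
    (h.mono hN h0 h1 hs h' (fun x hx => (hfg x hx).ge) x hx)

lemma Sol.smul {s : ℝ} {f u : E N → ℝ} (h : Sol N R₀ R₁ s f u) (c : ℝ) :
    Sol N R₀ R₁ s (fun x => c * f x) (fun x => c * u x) :=
  ⟨contDiffOn_const.mul h.c1, fun x hx => by rw [h.bd x hx, mul_zero],
    (h.ws.smul (isOpen_annulus _ _ _) c).congr (isOpen_annulus _ _ _) (fun _ _ => rfl) fun x _ => by ring⟩

lemma Sol.sub {s : ℝ} {f u g v : E N → ℝ} (h : Sol N R₀ R₁ s f u) (h' : Sol N R₀ R₁ s g v) :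
    Sol N R₀ R₁ s (fun x => f x - g x) (fun x => u x - v x) :=
  ⟨h.c1.sub h'.c1, fun x hx => by rw [h.bd x hx, h'.bd x hx, sub_zero],
    (h.ws.sub (isOpen_annulus _ _ _) h'.ws).congr (isOpen_annulus _ _ _) (fun _ _ => rfl) fun x _ => by ring⟩

lemma Sol.nonneg (hN : 3 ≤ N) (h0 : 0 < R₀) (h1 : R₀ < R₁) {s : ℝ} (hs : 0 ≤ s) {f u : E N → ℝ}
    (h : Sol N R₀ R₁ s f u) (hf : ∀ x ∈ annulus N R₀ R₁, 0 ≤ f x) : ∀ x ∈ cA N R₀ R₁, 0 ≤ u x := by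
  intro x hx
  simpa using h.mono hN h0 h1 hs (h.smul 0) (fun x hx => by simpa using hf x hx) x hx

/-- solvability for `s = 0`, with gradient bound -/
lemma Sol.exists0 (hN : 3 ≤ N) (h0 : 0 < R₀) (h1 : R₀ < R₁) : ∃ C, 0 ≤ C ∧ ∀ (f : E N → ℝ) M, 0 ≤ M →
    ContinuousOn f (annulus N R₀ R₁) → (∀ x ∈ annulus N R₀ R₁, |f x| ≤ M) →
    ∃ u, Sol N R₀ R₁ 0 f u ∧ ∀ x ∈ AO N R₀, ‖gradient u x‖ ≤ C * M := by
  obtain ⟨C, hC, h⟩ := G0_exists hN h0 h1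
  refine ⟨C, hC, fun f M hM hf hb => ?_⟩
  obtain ⟨u, a, b, c, d⟩ := h f M hM hf hb
  refine ⟨u, ⟨a, b, a.mono ((ann_sub_cA _ _ _).trans (cA_sub_AO h0)), by simpa using hf, ?_⟩, c⟩
  intro φ hφ
  rw [d φ hφ.c1 hφ.cs hφ.ts, setIntegral_eq_integral_of_forall_compl_eq_zero]
  · simp
  · intro x hx; rw [hφ.zero hx, mul_zero]

lemma Sol.sup_bound (hN : 3 ≤ N) (h0 : 0 < R₀) (h1 : R₀ < R₁) : ∃ C, 0 < C ∧ ∀ s, 0 ≤ s →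
    ∀ (f u : E N → ℝ) M, (∀ x ∈ annulus N R₀ R₁, |f x| ≤ M) → 0 ≤ M →
    Sol N R₀ R₁ s f u → ∀ x ∈ cA N R₀ R₁, |u x| ≤ C * M := by
  obtain ⟨C, hC, h⟩ := Sol.exists0 hN h0 h1
  obtain ⟨z, hz, -⟩ := h (fun _ => 1) 1 zero_le_one continuousOn_const (by simp)
  have hz0 := hz.nonneg hN h0 h1 le_rfl (by simp)
  obtain ⟨B, hB⟩ := (isCompact_cA N R₀ R₁).exists_bound_of_continuousOn (hz.cont h0)
  refine ⟨|B| + 1, by positivity, fun s hs f u M hf hM hu x hx => ?_⟩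
  have hzx : z x ≤ |B| + 1 := by
    have := hB x hx
    rw [Real.norm_eq_abs] at this
    linarith [le_abs_self (z x), le_abs_self B]
  have k1 : ∀ x ∈ annulus N R₀ R₁, 0 ≤ s * (M * z x) := fun x hx =>
    mul_nonneg hs (mul_nonneg hM (hz0 x (ann_sub_cA _ _ _ hx)))
  have a1 := (hz.smul M).comp hN h0 h1 hu hs (fun x hx => by
    have := k1 x hx
    have := abs_le.1 (hf x hx)
    nlinarith) x hx
  have a2 := (hz.smul M).comp hN h0 h1 (hu.smul (-1)) hs (fun x hx => by
    have := k1 x hx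
    have := abs_le.1 (hf x hx)
    nlinarith) x hx
  have a3 : M * z x ≤ (|B| + 1) * M := by nlinarith
  rw [abs_le]; constructor <;> linarith

end
end NR

open MeasureTheory Real Set
namespace NR
open Filter Topology

section
variable {N : ℕ} {R₀ R₁ : ℝ}

lemma ext_cont (w : C(cA N R₀ R₁, ℝ)) :
    ContinuousOn (Function.extend Subtype.val w (0 : E N → ℝ)) (cA N R₀ R₁) := by
  rw [continuousOn_iff_continuous_domRestrict]
  have : (cA N R₀ R₁).domRestrict (Function.extend Subtype.val w (0 : E N → ℝ)) = w := by
    ext x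
    exact Subtype.val_injective.extend_apply w 0 x
  rw [this]; exact w.continuous

lemma ext_eq (w : C(cA N R₀ R₁, ℝ)) (x : cA N R₀ R₁) :
    Function.extend Subtype.val w (0 : E N → ℝ) (x : E N) = w x :=
  Subtype.val_injective.extend_apply w 0 x

lemma Sol.step (hN : 3 ≤ N) (h0 : 0 < R₀) (h1 : R₀ < R₁) {s δ C : ℝ} (hs : 0 ≤ s) (hδ : 0 ≤ δ) (hC : 0 ≤ C)
    (hCδ : C * δ ≤ 1 / 2) (hb : ∀ (f u : E N → ℝ) M, (∀ x ∈ annulus N R₀ R₁, |f x| ≤ M) → 0 ≤ M →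
    Sol N R₀ R₁ s f u → ∀ x ∈ cA N R₀ R₁, |u x| ≤ C * M)
    (hex : ∀ f : E N → ℝ, ContinuousOn f (cA N R₀ R₁) → ∃ u, Sol N R₀ R₁ s f u) :
    ∀ f : E N → ℝ, ContinuousOn f (cA N R₀ R₁) → ∃ u, Sol N R₀ R₁ (s + δ) f u := by
  intro f hf
  have hcs : CompactSpace (cA N R₀ R₁) := isCompact_iff_compactSpace.1 (isCompact_cA _ _ _)
  choose! S hS using hex
  set ex : C(cA N R₀ R₁, ℝ) → E N → ℝ := fun w => Function.extend Subtype.val w (0 : E N → ℝ) with hex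
  have hcont : ∀ w, ContinuousOn (fun x => f x - δ * ex w x) (cA N R₀ R₁) := fun w =>
    hf.sub (continuousOn_const.mul (ext_cont w))
  have hSw := fun w => hS _ (hcont w)
  set T : C(cA N R₀ R₁, ℝ) → C(cA N R₀ R₁, ℝ) := fun w =>
    ⟨(cA N R₀ R₁).domRestrict (S fun x => f x - δ * ex w x),
      continuousOn_iff_continuous_domRestrict.1 ((hSw w).cont h0)⟩ with hT
  have hTc : ContractingWith (1 / 2) T := by
    refine ⟨by norm_num, LipschitzWith.of_dist_le_mul fun w1 w2 => ?_⟩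
    rw [ContinuousMap.dist_le (by positivity)]
    intro x
    have h2 := hb _ _ (δ * dist w1 w2) ?_ (by positivity) ((hSw w1).sub (hSw w2)) x x.2
    · rw [Real.dist_eq]
      have hd : 0 ≤ dist w1 w2 := dist_nonneg
      calc _ ≤ C * (δ * dist w1 w2) := h2
        _ = C * δ * dist w1 w2 := by ring
        _ ≤ 1 / 2 * dist w1 w2 := by gcongr
        _ = _ := by simp
    · intro y hy
      have hy' := ann_sub_cA _ _ _ hy
      have e1 := ext_eq w1 ⟨y, hy'⟩
      have e2 := ext_eq w2 ⟨y, hy'⟩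
      simp only [hex] at *
      have : f y - δ * Function.extend Subtype.val w1 (0 : E N → ℝ) y -
          (f y - δ * Function.extend Subtype.val w2 (0 : E N → ℝ) y) = - δ * (w1 ⟨y, hy'⟩ - w2 ⟨y, hy'⟩) := by
        rw [e1, e2]; ring
      rw [this, abs_mul, abs_neg, abs_of_nonneg hδ]
      gcongr
      rw [← Real.dist_eq]
      exact ContinuousMap.dist_apply_le_dist _
  have hne : Nonempty C(cA N R₀ R₁, ℝ) := ⟨0⟩
  set w := ContractingWith.fixedPoint T hTc
  have hw : T w = w := hTc.fixedPoint_isFixedPt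
  have hu := hSw w
  refine ⟨S fun x => f x - δ * ex w x, hu.c1, hu.bd, ?_⟩
  refine hu.ws.congr (isOpen_annulus _ _ _) (fun _ _ => rfl) fun x hx => ?_
  have hx' := ann_sub_cA _ _ _ hx
  have e1 := ext_eq w ⟨x, hx'⟩
  have e2 : S (fun x => f x - δ * ex w x) x = w ⟨x, hx'⟩ := by
    conv_rhs => rw [← hw]
    rfl
  have e3 : ex w x = w ⟨x, hx'⟩ := e1
  rw [e2, e3]; ring

/-- solvability of `-Δ u + u = f` -/
theorem Sol.exists1 (hN : 3 ≤ N) (h0 : 0 < R₀) (h1 : R₀ < R₁) : ∃ C, 0 ≤ C ∧ ∀ (f : E N → ℝ) M, 0 ≤ M →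
    ContinuousOn f (cA N R₀ R₁) → (∀ x ∈ annulus N R₀ R₁, |f x| ≤ M) →
    ∃ u, Sol N R₀ R₁ 1 f u ∧ (∀ x ∈ AO N R₀, ‖gradient u x‖ ≤ C * M) ∧ ∀ x ∈ cA N R₀ R₁, |u x| ≤ C * M := by
  obtain ⟨C, hC, hb⟩ := Sol.sup_bound hN h0 h1
  obtain ⟨C', hC', hex⟩ := Sol.exists0 hN h0 h1
  obtain ⟨n, hn⟩ := exists_nat_ge (2 * C)
  have hn0 : (0 : ℝ) < n := by linarith
  have hind : ∀ k : ℕ, ∀ f : E N → ℝ, ContinuousOn f (cA N R₀ R₁) → ∃ u, Sol N R₀ R₁ (k * (n : ℝ)⁻¹) f u := by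
    intro k
    induction k with
    | zero =>
      intro f hf
      obtain ⟨M, hM⟩ := (isCompact_cA N R₀ R₁).exists_bound_of_continuousOn hf
      obtain ⟨u, hu, -⟩ := hex f |M| (abs_nonneg _) (hf.mono (ann_sub_cA _ _ _))
        (fun x hx => (hM x (ann_sub_cA _ _ _ hx)).trans (le_abs_self M))
      exact ⟨u, by simpa using hu⟩
    | succ k ih =>
      have := Sol.step hN h0 h1 (s := k * (n : ℝ)⁻¹) (δ := (n : ℝ)⁻¹) (by positivity) (by positivity) hC.le
        (by rw [← div_eq_mul_inv, div_le_iff₀ hn0]; linarith) (hb _ (by positivity)) ih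
      intro f hf
      obtain ⟨u, hu⟩ := this f hf
      refine ⟨u, ?_⟩
      convert hu using 1
      push_cast; ring
  refine ⟨C' * (1 + C) + C, by positivity, fun f M hM hf hfb => ?_⟩
  obtain ⟨w, hw⟩ := hind n f hf
  rw [mul_inv_cancel₀ hn0.ne'] at hw
  have hwb := hb 1 zero_le_one f w M hfb hM hw
  obtain ⟨u, hu, hg⟩ := hex (fun x => f x - w x) (M + C * M) (by positivity)
    ((hf.sub (hw.cont h0)).mono (ann_sub_cA _ _ _)) (fun x hx => by
      have a1 := abs_le.1 (hfb x hx)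
      have a2 := abs_le.1 (hwb x (ann_sub_cA _ _ _ hx))
      rw [abs_le]; constructor <;> linarith)
  have hw' : Sol N R₀ R₁ 0 (fun x => f x - w x) w :=
    ⟨hw.c1, hw.bd, hw.ws.congr (isOpen_annulus _ _ _) (fun _ _ => rfl) fun x _ => by ring⟩
  have he := hu.uniq hN h0 h1 le_rfl hw' (fun _ _ => rfl)
  have hCM : 0 ≤ C * M := by positivity
  have hCM' : 0 ≤ C' * (1 + C) * M := by positivity
  refine ⟨u, ⟨hu.c1, hu.bd, hu.ws.congr (isOpen_annulus _ _ _) (fun _ _ => rfl) fun x hx => ?_⟩,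
    fun x hx => ?_, fun x hx => ?_⟩
  · rw [he x (ann_sub_cA _ _ _ hx)]; ring
  · have := hg x hx
    nlinarith
  · rw [he x hx]
    have := hwb x hx
    nlinarith

end
end NR

open MeasureTheory Real Set
namespace NR
open Filter Topology

section
variable {N : ℕ} {R₀ R₁ : ℝ}

lemma grad_comp (σ : E N ≃ₗᵢ[ℝ] E N) (u : E N → ℝ) (x : E N) :
    gradient (fun x => u (σ x)) x = σ.symm (gradient u (σ x)) := by
  apply ext_inner_right ℝ
  intro v
  rw [inner_grad]
  have h := σ.toContinuousLinearEquiv.comp_right_fderiv (f := u) (x := x)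
  have h2 : fderiv ℝ (fun x => u (σ x)) x v = fderiv ℝ u (σ x) (σ v) := by
    change fderiv ℝ (u ∘ σ.toContinuousLinearEquiv) x v = _
    rw [h]; rfl
  rw [h2, ← inner_grad, ← σ.inner_map_map (σ.symm _) v, σ.apply_symm_apply]

lemma WS.comp {Ω : Set (E N)} {u F : E N → ℝ} (h : WS Ω u F) (σ : E N ≃ₗᵢ[ℝ] E N) :
    WS (σ ⁻¹' Ω) (fun x => u (σ x)) (fun x => F (σ x)) := by
  refine ⟨h.c1.comp σ.contDiff.contDiffOn (mapsTo_preimage _ _),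
    h.fc.comp σ.continuous.continuousOn (mapsTo_preimage _ _), fun φ hφ => ?_⟩
  set ψ : E N → ℝ := fun x => φ (σ.symm x) with hψ
  have hφψ : φ = fun x => ψ (σ x) := by ext x; simp [hψ]
  have hT : Tst Ω ψ := by
    have h0 : ∀ x, x ∉ σ '' tsupport φ → ψ x = 0 := by
      intro x hx
      refine image_eq_zero_of_notMem_tsupport (f := φ) fun h' => ?_
      exact hx ⟨_, h', by simp⟩
    have hcp : IsCompact (σ '' tsupport φ) := hφ.cs.isCompact.image σ.continuous
    refine ⟨hφ.c1.comp σ.symm.contDiff, cpt_of_zero hcp h0, ?_⟩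
    refine (closure_minimal ?_ hcp.isClosed).trans (image_subset_iff.2 hφ.ts)
    intro x hx
    by_contra h'
    exact hx (h0 x h')
  have hm := σ.measurePreserving
  have hme : MeasurableEmbedding σ := σ.toHomeomorph.measurableEmbedding
  have e1 := hm.integral_comp hme (fun x => inner ℝ (gradient u x) (gradient ψ x))
  have e2 := hm.integral_comp hme (fun x => F x * ψ x)
  rw [hφψ]
  simp_rw [grad_comp, LinearIsometryEquiv.inner_map_map]
  rw [e1, e2]
  exact h.wk ψ hT

lemma ann_pre (σ : E N ≃ₗᵢ[ℝ] E N) : σ ⁻¹' (annulus N R₀ R₁) = annulus N R₀ R₁ := by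
  ext x; simp [annulus]

lemma Sol.isom {s : ℝ} {f u : E N → ℝ} (h : Sol N R₀ R₁ s f u) (σ : E N ≃ₗᵢ[ℝ] E N) :
    Sol N R₀ R₁ s (fun x => f (σ x)) (fun x => u (σ x)) := by
  refine ⟨h.c1.comp σ.contDiff.contDiffOn fun x hx => ?_, fun x hx => h.bd _ (by simpa using hx), ?_⟩
  · show R₀ / 2 < ‖σ x‖
    rw [σ.norm_map]; exact hx
  · have := h.ws.comp σ
    rwa [ann_pre] at this

/-- the last basis vector -/
noncomputable def eL (N : ℕ) (hN : 3 ≤ N) : E N := EuclideanSpace.single ⟨N - 1, by omega⟩ 1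

lemma lastCoord_eq (hN : 3 ≤ N) (x : E N) : lastCoord x = inner ℝ (eL N hN) x := by
  have : 0 < N := by omega
  simp [lastCoord, eL, this, EuclideanSpace.inner_single_left]

lemma lastCoord_coe (hN : 3 ≤ N) (x : E N) : lastCoord x = x ⟨N - 1, by omega⟩ := by
  have : 0 < N := by omega
  simp [lastCoord, this]

lemma continuous_lastCoord (hN : 3 ≤ N) : Continuous (lastCoord : E N → ℝ) := by
  have : (lastCoord : E N → ℝ) = fun x => inner ℝ (eL N hN) x := funext fun x => lastCoord_eq hN x
  rw [this]; fun_prop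

/-- monotonicity property of the cone -/
def PC (N : ℕ) (R₀ R₁ : ℝ) (u : E N → ℝ) : Prop :=
  ∀ x ∈ cA N R₀ R₁, ∀ x' ∈ cA N R₀ R₁, ‖x‖ = ‖x'‖ → |lastCoord x| ≤ |lastCoord x'| → u x' ≤ u x

lemma PC.eq {u : E N → ℝ} (h : PC N R₀ R₁ u) {x x' : E N} (hx : x ∈ cA N R₀ R₁) (hn : ‖x'‖ = ‖x‖)
    (hl : |lastCoord x'| = |lastCoord x|) : u x' = u x := by
  have hx' : x' ∈ cA N R₀ R₁ := by rw [cA, mem_ofPred_eq, hn]; exact hx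
  exact le_antisymm (h x hx x' hx' hn.symm hl.symm.le) (h x' hx' x hx hn hl.le)

lemma mem_cA_of_norm {x x' : E N} (hx : x ∈ cA N R₀ R₁) (hn : ‖x'‖ = ‖x‖) : x' ∈ cA N R₀ R₁ := by
  rw [cA, mem_ofPred_eq, hn]; exact hx

lemma mem_ann_of_norm {x x' : E N} (hx : x ∈ annulus N R₀ R₁) (hn : ‖x'‖ = ‖x‖) : x' ∈ annulus N R₀ R₁ := by
  rw [annulus, mem_ofPred_eq, hn]; exact hx

lemma Sol.sym (hN : 3 ≤ N) (h0 : 0 < R₀) (h1 : R₀ < R₁) {f u : E N → ℝ} (h : Sol N R₀ R₁ 1 f u)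
    (hf : PC N R₀ R₁ f) {x x' : E N} (hx : x ∈ cA N R₀ R₁) (hn : ‖x'‖ = ‖x‖)
    (hl : |lastCoord x'| = |lastCoord x|) : u x' = u x := by
  have inv : ∀ σ : E N ≃ₗᵢ[ℝ] E N, (∀ y, |lastCoord (σ y)| = |lastCoord y|) → ∀ x ∈ cA N R₀ R₁,
      u (σ x) = u x := fun σ hσ => (h.isom σ).uniq hN h0 h1 zero_le_one h fun y hy =>
        hf.eq (ann_sub_cA _ _ _ hy) (σ.norm_map y) (hσ y)
  have key : ∀ x x' : E N, x ∈ cA N R₀ R₁ → ‖x'‖ = ‖x‖ → lastCoord x' = lastCoord x → u x' = u x := by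
    intro x x' hx hn hl
    have hr := inv (ℝ ∙ (x - x'))ᗮ.reflection (fun y => by
      have he : eL N hN ∈ (ℝ ∙ (x - x'))ᗮ := by
        rw [Submodule.mem_orthogonal_singleton_iff_inner_left, inner_sub_right, ← lastCoord_eq, ← lastCoord_eq, hl,
          sub_self]
      have he2 := Submodule.reflection_mem_subspace_eq_self he
      rw [lastCoord_eq hN, lastCoord_eq hN]
      conv_lhs => rw [← he2]
      rw [LinearIsometryEquiv.inner_map_map]) x hx
    rwa [Submodule.reflection_sub hn.symm] at hr
  rcases abs_eq_abs.1 hl with h2 | h2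
  · exact key x x' hx hn h2
  · set ρ := (ℝ ∙ (eL N hN))ᗮ.reflection with hρ
    have hρl : ∀ y, lastCoord (ρ y) = - lastCoord y := by
      intro y
      rw [lastCoord_eq hN, lastCoord_eq hN, ← ρ.inner_map_map (eL N hN) y,
        hρ, Submodule.reflection_orthogonalComplement_singleton_eq_neg, inner_neg_left, neg_neg]
    have h3 := inv ρ (fun y => by rw [hρl, abs_neg]) x hx
    rw [← h3]
    exact key _ _ (mem_cA_of_norm hx (ρ.norm_map x)) (by rw [ρ.norm_map, hn]) (by rw [hρl, h2])

lemma Sol.PC (hN : 3 ≤ N) (h0 : 0 < R₀) (h1 : R₀ < R₁) {f u : E N → ℝ} (h : Sol N R₀ R₁ 1 f u)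
    (hf : PC N R₀ R₁ f) : PC N R₀ R₁ u := by
  intro x hx x' hx' hn hl
  rcases hl.eq_or_lt with hl | hl
  · exact (h.sym hN h0 h1 hf hx hn.symm hl.symm).le
  by_cases hxb : ‖x‖ = R₀ ∨ ‖x‖ = R₁
  · rw [h.bd x hxb, h.bd x' (by rwa [← hn])]
  have hxA : x ∈ annulus N R₀ R₁ := by
    push Not at hxb
    exact ⟨lt_of_le_of_ne hx.1 hxb.1.symm, lt_of_le_of_ne hx.2 hxb.2⟩
  set σ := (ℝ ∙ (x - x'))ᗮ.reflection
  set Ω := annulus N R₀ R₁ ∩ {y | |lastCoord y| < |lastCoord (σ y)|} with hΩ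
  have hlc := continuous_lastCoord hN
  have hlcs : Continuous fun y => lastCoord (σ y) := hlc.comp σ.continuous
  have hΩo : IsOpen Ω := (isOpen_annulus _ _ _).inter (isOpen_lt hlc.abs hlcs.abs)
  have hsub : Ω ⊆ annulus N R₀ R₁ := inter_subset_left
  have hcl : closure Ω ⊆ cA N R₀ R₁ := (closure_mono hsub).trans (closure_annulus h0 h1).le
  have hcl2 : closure Ω ⊆ {y | |lastCoord y| ≤ |lastCoord (σ y)|} :=
    closure_minimal (fun y hy => (le_of_lt hy.2 : |lastCoord y| ≤ |lastCoord (σ y)|)) (isClosed_le hlc.abs hlcs.abs)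
  have hw := ((h.sub (h.isom σ)).ws).mono hsub
  have hs := h.sub (h.isom σ)
  have := hw.MP hN hΩo ((bdd_annulus _ _ _).subset hsub) ((hs.cont h0).mono hcl) (s := 1) (fun y hy => ?_)
    zero_le_one (fun y hy => ?_) x (subset_closure ⟨hxA, ?_⟩)
  · have e : σ x = x' := Submodule.reflection_sub hn
    rw [e] at this; linarith
  · have hy1 := hcl hy.1
    by_cases hyb : ‖y‖ = R₀ ∨ ‖y‖ = R₁
    · rw [hs.bd y hyb]
    · push Not at hyb
      have hyA : y ∈ annulus N R₀ R₁ := ⟨lt_of_le_of_ne hy1.1 hyb.1.symm, lt_of_le_of_ne hy1.2 hyb.2⟩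
      have hny : y ∉ Ω := fun h' => hy.2 (hΩo.interior_eq.symm ▸ h')
      have hle : |lastCoord y| ≤ |lastCoord (σ y)| := hcl2 hy.1
      have hge : ¬ |lastCoord y| < |lastCoord (σ y)| := fun h' => hny ⟨hyA, h'⟩
      rw [h.sym hN h0 h1 hf hy1 (σ.norm_map y) (le_antisymm (not_lt.1 hge) hle)]; simp
  · have hyc := ann_sub_cA _ _ _ hy.1
    have := hf y hyc (σ y) (mem_cA_of_norm hyc (σ.norm_map y)) (σ.norm_map y).symm (le_of_lt hy.2)
    linarith
  · have e : σ x = x' := Submodule.reflection_sub hn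
    simp only [mem_ofPred_eq, e]; exact hl

end
end NR

open MeasureTheory Real Set
namespace NR
open Filter Topology

section
variable {N : ℕ} {R₀ R₁ : ℝ}

/-- gaussian barrier -/
noncomputable def gau (α : ℝ) (x₀ : E N) (x : E N) : ℝ := Real.exp (- α * ‖x - x₀‖ ^ 2)

lemma gau_deriv (α : ℝ) (x₀ x : E N) :
    HasFDerivAt (gau α x₀) (innerSL ℝ ((- 2 * α * gau α x₀ x) • (x - x₀))) x := by
  have h1 : HasFDerivAt (fun x : E N => ‖x - x₀‖ ^ 2) (2 • (innerSL ℝ (x - x₀))) x := by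
    have := ((hasFDerivAt_id x).sub_const x₀).norm_sq
    refine this.congr_fderiv ?_
    ext v; simp
  have h2 := (h1.const_mul (- α)).exp
  refine h2.congr_fderiv ?_
  ext v
  simp [gau]; ring

lemma gau_contDiff (α : ℝ) (x₀ : E N) : ContDiff ℝ 1 (gau α x₀) := by
  unfold gau
  exact Real.contDiff_exp.comp (contDiff_const.mul ((contDiff_id.sub contDiff_const).norm_sq ℝ))

lemma gau_WS (α : ℝ) (x₀ : E N) (c : ℝ) :
    WS univ (fun x => gau α x₀ x - c) (fun x => gau α x₀ x * (2 * α * N - 4 * α ^ 2 * ‖x - x₀‖ ^ 2)) := by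
  have hgc := gau_contDiff α x₀
  refine ⟨(hgc.sub contDiff_const).contDiffOn, ?_, fun φ hφ => ?_⟩
  · have := hgc.continuous
    exact Continuous.continuousOn (by fun_prop)
  have e1 : ∀ x, gradient (fun x => gau α x₀ x - c) x = (- 2 * α * gau α x₀ x) • (x - x₀) := fun x =>
    grad_of_hasFDerivAt ((gau_deriv α x₀ x).sub_const c)
  have e2 : ∀ x, inner ℝ (gradient (fun x => gau α x₀ x - c) x) (gradient φ x) =
      ∑ i, (- 2 * α * (gau α x₀ x * (x i - x₀ i))) * fderiv ℝ φ x (EuclideanSpace.single i 1) := by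
    intro x
    rw [e1, real_inner_comm, inner_grad, fderiv_sum]
    refine Finset.sum_congr rfl fun i _ => ?_
    congr 1
    simp; ring
  have hd : ∀ i x, HasFDerivAt (fun x : E N => - 2 * α * (gau α x₀ x * (x i - x₀ i)))
      ((- 2 * α) • (gau α x₀ x • (EuclideanSpace.proj i : E N →L[ℝ] ℝ) +
        (x i - x₀ i) • innerSL ℝ ((- 2 * α * gau α x₀ x) • (x - x₀)))) x := by
    intro i x
    have hp : HasFDerivAt (fun x : E N => x i - x₀ i) (EuclideanSpace.proj i : E N →L[ℝ] ℝ) x :=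
      (EuclideanSpace.proj i : E N →L[ℝ] ℝ).hasFDerivAt.sub_const _
    exact ((gau_deriv α x₀ x).mul hp).const_mul _
  have hd2 : ∀ i x, fderiv ℝ (fun x : E N => - 2 * α * (gau α x₀ x * (x i - x₀ i))) x
      (EuclideanSpace.single i 1) = - 2 * α * gau α x₀ x * (1 - 2 * α * (x i - x₀ i) ^ 2) := by
    intro i x
    rw [(hd i x).fderiv]
    simp [EuclideanSpace.inner_single_right]; ring
  have cs1 : ∀ g : E N → ℝ, Continuous g → Integrable (fun x => g x * φ x) := fun g hg =>
    hφ.mul_int isOpen_univ hg.continuousOn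
  have cs2 : ∀ (g : E N → ℝ) (i : Fin N), Continuous g →
      Integrable (fun x => g x * fderiv ℝ φ x (EuclideanSpace.single i 1)) := by
    intro g i hg
    have := hφ.inner_int isOpen_univ (V := fun x => g x • EuclideanSpace.single i 1)
      (hg.smul continuous_const).continuousOn
    refine this.congr (Eventually.of_forall fun x => ?_)
    simp only
    rw [real_inner_smul_left, real_inner_comm, inner_grad]
  have hgcc := hgc.continuous
  have hco : ∀ i : Fin N, Continuous fun x : E N => x i := fun i => (EuclideanSpace.proj i : E N →L[ℝ] ℝ).continuous
  have hi1 : ∀ i, Integrable (fun x : E N => (- 2 * α * (gau α x₀ x * (x i - x₀ i))) *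
      fderiv ℝ φ x (EuclideanSpace.single i 1)) := fun i => by
    have := hco i
    exact cs2 _ i (by fun_prop)
  have hi2 : ∀ i, Integrable (fun x : E N => (- 2 * α * gau α x₀ x * (1 - 2 * α * (x i - x₀ i) ^ 2)) * φ x) :=
    fun i => by
    have := hco i
    exact cs1 _ (by fun_prop)
  simp_rw [e2]
  rw [integral_finsetSum _ fun i _ => hi1 i]
  have e3 : ∀ i, ∫ x, (- 2 * α * (gau α x₀ x * (x i - x₀ i))) * fderiv ℝ φ x (EuclideanSpace.single i 1) =
      - ∫ x, (- 2 * α * gau α x₀ x * (1 - 2 * α * (x i - x₀ i) ^ 2)) * φ x := by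
    intro i
    have := integral_mul_fderiv_eq_neg_fderiv_mul_of_integrable (μ := (volume : Measure (E N)))
      (f := fun x : E N => - 2 * α * (gau α x₀ x * (x i - x₀ i))) (g := φ) (v := EuclideanSpace.single i 1)
      (by simp_rw [hd2]; exact hi2 i) (hi1 i)
      (by have := hco i; exact cs1 _ (by fun_prop)) (fun x _ => (hd i x).differentiableAt)
      (fun x _ => hφ.c1.differentiable one_ne_zero x)
    rw [this]; simp_rw [hd2]
  simp_rw [e3]
  rw [Finset.sum_neg_distrib, ← integral_finsetSum _ fun i _ => hi2 i, ← integral_neg]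
  congr 1; ext x
  rw [← Finset.sum_mul, ← Finset.mul_sum, Finset.sum_sub_distrib, ← Finset.mul_sum]
  have : ‖x - x₀‖ ^ 2 = ∑ i, (x i - x₀ i) ^ 2 := by
    rw [EuclideanSpace.real_norm_sq_eq]; simp
  rw [← this]; simp only [Finset.sum_const, Finset.card_univ, Fintype.card_fin, nsmul_eq_mul]; ring

lemma barrier (hN : 3 ≤ N) {A : Set (E N)} (hA : IsOpen A) {u F : E N → ℝ} (h : WS A u F)
    (hu : ∀ x ∈ A, 0 ≤ u x) (hF : ∀ x ∈ A, 0 ≤ F x + u x) {x₀ : E N} {R : ℝ} (hR : 0 < R)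
    (hb : Metric.closedBall x₀ R ⊆ A) (hx : 0 < u x₀) : ∀ x ∈ Metric.ball x₀ R, 0 < u x := by
  have hne : Nonempty (Fin N) := ⟨⟨0, by omega⟩⟩
  have hx0A : x₀ ∈ A := hb (Metric.mem_closedBall_self hR.le)
  have hca : ContinuousAt u x₀ := h.c1.continuousOn.continuousAt (hA.mem_nhds hx0A)
  obtain ⟨ρ', hρ', hρ2⟩ := Metric.eventually_nhds_iff.1 (hca.eventually (lt_mem_nhds (half_lt_self hx)))
  set ρ := min (ρ' / 2) (R / 2) with hρ
  have hρ0 : 0 < ρ := by positivity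
  have hρR : ρ < R := lt_of_le_of_lt (min_le_right _ _) (by linarith)
  have hin : ∀ x, ‖x - x₀‖ ≤ ρ → u x₀ / 2 < u x := by
    intro x hx
    apply hρ2
    rw [dist_eq_norm]
    exact lt_of_le_of_lt (hx.trans (min_le_left _ _)) (by linarith)
  obtain ⟨α, hα0, hα⟩ : ∃ α : ℝ, 0 < α ∧ 2 * α * N + 1 ≤ 4 * α ^ 2 * ρ ^ 2 := by
    refine ⟨(N + 1) / ρ ^ 2 + 1, by positivity, ?_⟩
    set β : ℝ := (N + 1) / ρ ^ 2 + 1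
    have hβ : (N + 1 : ℝ) ≤ β * ρ ^ 2 := by
      simp only [β]; rw [add_mul, div_mul_cancel₀ _ (by positivity)]; nlinarith [sq_nonneg ρ]
    have hβ1 : 1 ≤ β := by simp only [β]; linarith [show (0:ℝ) ≤ (N + 1) / ρ ^ 2 by positivity]
    nlinarith
  set ε := u x₀ / 2 with hε
  have hε0 : 0 < ε := by positivity
  set Ω := Metric.ball x₀ R \ Metric.closedBall x₀ ρ with hΩ
  have hΩo : IsOpen Ω := Metric.isOpen_ball.sdiff Metric.isClosed_closedBall
  have hΩA : Ω ⊆ A := fun x hx => hb (Metric.ball_subset_closedBall hx.1)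
  have hclA : closure Ω ⊆ Metric.closedBall x₀ R :=
    closure_minimal (fun x hx => Metric.ball_subset_closedBall hx.1) Metric.isClosed_closedBall
  have hcl2 : closure Ω ⊆ {x | ρ ≤ ‖x - x₀‖} := by
    refine closure_minimal (fun x hx => ?_) (isClosed_le continuous_const (by fun_prop))
    have := hx.2
    rw [Metric.mem_closedBall, dist_eq_norm, not_le] at this
    exact this.le
  set c := Real.exp (- α * R ^ 2)
  have hw := (h.mono hΩA).sub hΩo (((gau_WS α x₀ c).mono (subset_univ Ω)).smul hΩo ε)
  have hgle : ∀ x, gau α x₀ x ≤ 1 := fun x => by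
    unfold gau; rw [Real.exp_le_one_iff]
    have : 0 ≤ α * ‖x - x₀‖ ^ 2 := by positivity
    linarith
  have hc0 : 0 < c := Real.exp_pos _
  have key := hw.MP hN hΩo (Metric.isBounded_ball.subset diff_subset)
    ((h.c1.continuousOn.mono (hclA.trans hb)).sub
      (continuousOn_const.mul (((gau_contDiff α x₀).continuous.sub continuous_const).continuousOn)))
    (s := 1) (fun x hx => ?_) zero_le_one (fun x hx => ?_)
  · intro x hx
    rw [Metric.mem_ball, dist_eq_norm] at hx
    by_cases hxρ : ‖x - x₀‖ ≤ ρ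
    · linarith [hin x hxρ]
    · have hxΩ : x ∈ Ω := ⟨by rwa [Metric.mem_ball, dist_eq_norm], by
        rw [Metric.mem_closedBall, dist_eq_norm]; exact hxρ⟩
      have := key x (subset_closure hxΩ)
      have h2 : c < gau α x₀ x := by
        unfold gau
        apply Real.exp_lt_exp.2
        have : ‖x - x₀‖ ^ 2 < R ^ 2 := by gcongr
        nlinarith
      nlinarith
  · have h1 := hclA hx.1
    have h2 : ρ ≤ ‖x - x₀‖ := hcl2 hx.1
    rw [Metric.mem_closedBall, dist_eq_norm] at h1
    have hnΩ : x ∉ Ω := fun h' => hx.2 (hΩo.interior_eq.symm ▸ h')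
    rcases h1.eq_or_lt with h3 | h3
    · have : gau α x₀ x = c := by simp only [gau, c, h3]
      rw [this]
      have := hu x (hb (by rw [Metric.mem_closedBall, dist_eq_norm]; exact h1))
      simpa using this
    · have h4 : ‖x - x₀‖ ≤ ρ := by
        by_contra h5
        exact hnΩ ⟨by rwa [Metric.mem_ball, dist_eq_norm], by
          rw [Metric.mem_closedBall, dist_eq_norm]; exact h5⟩
      have h5 := hin x h4
      have h6 := hgle x
      nlinarith
  · have h1 := hF x (hΩA hx)
    have h2 : ρ ≤ ‖x - x₀‖ := hcl2 (subset_closure hx)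
    have h3 : ρ ^ 2 ≤ ‖x - x₀‖ ^ 2 := by gcongr
    have h4 : 0 < gau α x₀ x := Real.exp_pos _
    have h5 : gau α x₀ x * (2 * α * N - 4 * α ^ 2 * ‖x - x₀‖ ^ 2) + (gau α x₀ x - c) ≤ 0 := by
      have : 4 * α ^ 2 * ρ ^ 2 ≤ 4 * α ^ 2 * ‖x - x₀‖ ^ 2 := by gcongr
      nlinarith
    nlinarith

lemma conn_annulus (hN : 3 ≤ N) (h0 : 0 < R₀) : IsPreconnected (annulus N R₀ R₁) := by
  have hr : 1 < Module.rank ℝ (E N) := by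
    rw [rank_eq_card_basis (EuclideanSpace.basisFun (Fin N) ℝ).toBasis]
    simp only [Fintype.card_fin]
    exact_mod_cast (by omega : 1 < N)
  have hs := (isConnected_sphere hr (0 : E N) zero_le_one).isPreconnected
  have hp := (isPreconnected_Ioo (a := R₀) (b := R₁)).prod hs
  have := hp.image (fun q : ℝ × E N => q.1 • q.2) (by fun_prop)
  convert this using 1
  ext x
  constructor
  · intro hx
    have hx0 : 0 < ‖x‖ := h0.trans hx.1
    refine ⟨(‖x‖, ‖x‖⁻¹ • x), ⟨hx, ?_⟩, ?_⟩
    · simp [norm_smul, hx0.ne']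
    · simp [smul_smul, hx0.ne']
  · rintro ⟨⟨r, w⟩, ⟨hr, hw⟩, rfl⟩
    have hw' : ‖w‖ = 1 := by simpa using hw
    have : 0 < r := h0.trans hr.1
    simp only [annulus, mem_ofPred_eq, norm_smul, hw', Real.norm_of_nonneg this.le, mul_one]
    exact hr

lemma Sol.pos (hN : 3 ≤ N) (h0 : 0 < R₀) (h1 : R₀ < R₁) {f u : E N → ℝ} (h : Sol N R₀ R₁ 1 f u)
    (hf : ∀ x ∈ annulus N R₀ R₁, 0 ≤ f x) (hne : ∃ x ∈ annulus N R₀ R₁, u x ≠ 0) :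
    ∀ x ∈ annulus N R₀ R₁, 0 < u x := by
  have hu : ∀ x ∈ annulus N R₀ R₁, 0 ≤ u x := fun x hx =>
    h.nonneg hN h0 h1 zero_le_one hf x (ann_sub_cA _ _ _ hx)
  have hA := isOpen_annulus N R₀ R₁
  have hb := fun {x₀ : E N} {R : ℝ} (hR : 0 < R) => barrier hN hA h.ws hu
    (fun x hx => by simpa using hf x hx) (x₀ := x₀) hR
  set S := annulus N R₀ R₁ ∩ u ⁻¹' Ioi 0
  have hS : IsOpen S := h.ws.c1.continuousOn.isOpen_inter_preimage hA isOpen_Ioi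
  have hsub := (conn_annulus (R₀ := R₀) (R₁ := R₁) hN h0).subset_of_closure_inter_subset hS ?_ ?_
  · exact fun x hx => (hsub hx).2
  · obtain ⟨x, hx, hx2⟩ := hne
    exact ⟨x, hx, hx, lt_of_le_of_ne (hu x hx) hx2.symm⟩
  · rintro x ⟨hx, hxA⟩
    obtain ⟨r, hr, hrb⟩ := Metric.isOpen_iff.1 hA x hxA
    obtain ⟨y, hyS, hy⟩ := Metric.mem_closure_iff.1 hx (r / 3) (by positivity)
    refine ⟨hxA, hb (x₀ := y) (R := r / 3) (by positivity) (fun z hz => hrb ?_) hyS.2 x ?_⟩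
    · rw [Metric.mem_closedBall] at hz
      rw [Metric.mem_ball]
      have := dist_triangle z y x
      rw [dist_comm y x] at this
      linarith
    · exact hy

end
end NR

open MeasureTheory Real Set
namespace NR
open Filter Topology

section
variable {N : ℕ} {R₀ R₁ : ℝ}

/-- energy form -/
noncomputable def En (N : ℕ) (R₀ R₁ : ℝ) (u v : E N → ℝ) : ℝ :=
  ∫ x in annulus N R₀ R₁, (inner ℝ (gradient u x) (gradient v x) + u x * v x)

lemma intA {F : E N → ℝ} (hF : ContinuousOn F (cA N R₀ R₁)) : IntegrableOn F (annulus N R₀ R₁) :=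
  (hF.integrableOn_compact (isCompact_cA _ _ _)).mono_set (ann_sub_cA _ _ _)

lemma grad_cA (h0 : 0 < R₀) {u : E N → ℝ} (hu : ContDiffOn ℝ 1 u (AO N R₀)) :
    ContinuousOn (fun x => gradient u x) (cA N R₀ R₁) :=
  (continuousOn_grad (isOpen_AO _ _) hu).mono (cA_sub_AO h0)

lemma cont_cA (h0 : 0 < R₀) {u : E N → ℝ} (hu : ContDiffOn ℝ 1 u (AO N R₀)) :
    ContinuousOn u (cA N R₀ R₁) := hu.continuousOn.mono (cA_sub_AO h0)

lemma En_int (h0 : 0 < R₀) {u v : E N → ℝ} (hu : ContDiffOn ℝ 1 u (AO N R₀)) (hv : ContDiffOn ℝ 1 v (AO N R₀)) :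
    IntegrableOn (fun x => inner ℝ (gradient u x) (gradient v x) + u x * v x) (annulus N R₀ R₁) :=
  intA (((grad_cA h0 hu).inner (grad_cA h0 hv)).add ((cont_cA h0 hu).mul (cont_cA h0 hv)))

lemma En_comm (u v : E N → ℝ) : En N R₀ R₁ u v = En N R₀ R₁ v u := by
  unfold En
  congr 1; ext x; rw [real_inner_comm, mul_comm]

lemma En_nonneg (u : E N → ℝ) : 0 ≤ En N R₀ R₁ u u := by
  refine integral_nonneg fun x => ?_
  have := real_inner_self_nonneg (x := gradient u x)
  simp only [Pi.zero_apply]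
  nlinarith [mul_self_nonneg (u x)]

lemma En_CS (h0 : 0 < R₀) {u v : E N → ℝ} (hu : ContDiffOn ℝ 1 u (AO N R₀)) (hv : ContDiffOn ℝ 1 v (AO N R₀)) :
    En N R₀ R₁ u v ^ 2 ≤ En N R₀ R₁ u u * En N R₀ R₁ v v := by
  have key : ∀ t : ℝ, 0 ≤ En N R₀ R₁ v v * (t * t) + (- 2 * En N R₀ R₁ u v) * t + En N R₀ R₁ u u := by
    intro t
    have e : En N R₀ R₁ v v * (t * t) + (- 2 * En N R₀ R₁ u v) * t + En N R₀ R₁ u u =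
        ∫ x in annulus N R₀ R₁, ((inner ℝ (gradient v x) (gradient v x) + v x * v x) * (t * t) +
          (inner ℝ (gradient u x) (gradient v x) + u x * v x) * (-2 * t) +
          (inner ℝ (gradient u x) (gradient u x) + u x * u x)) := by
      rw [integral_add, integral_add, integral_mul_const, integral_mul_const]
      · unfold En; ring
      · exact (En_int h0 hv hv).mul_const _
      · exact (En_int h0 hu hv).mul_const _
      · exact ((En_int h0 hv hv).mul_const _).add ((En_int h0 hu hv).mul_const _)
      · exact En_int h0 hu hu
    rw [e]
    refine integral_nonneg fun x => ?_
    have h1 : 0 ≤ inner ℝ (gradient u x - t • gradient v x) (gradient u x - t • gradient v x) :=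
      real_inner_self_nonneg
    have h2 : 0 ≤ (u x - t * v x) ^ 2 := sq_nonneg _
    rw [inner_sub_left, inner_sub_right, inner_sub_right, real_inner_smul_left, real_inner_smul_left,
      real_inner_smul_right, real_inner_smul_right, real_inner_comm (gradient u x) (gradient v x)] at h1
    simp only [Pi.zero_apply]
    nlinarith
  have := discrim_le_zero key
  unfold discrim at this
  nlinarith

/-- regularised positive part -/
noncomputable def Th (δ t : ℝ) : ℝ := √((max (t - δ) 0) ^ 2 + δ ^ 2) - δ

lemma Th_c1 {δ : ℝ} (hδ : 0 < δ) : ContDiff ℝ 1 (Th δ) := by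
  unfold Th
  refine (((sqpos_c1 δ).1.add contDiff_const).sqrt fun t => ?_).sub contDiff_const
  positivity

lemma Th_deriv {δ : ℝ} (hδ : 0 < δ) (t : ℝ) :
    deriv (Th δ) t = max (t - δ) 0 / √((max (t - δ) 0) ^ 2 + δ ^ 2) := by
  have h1 : HasDerivAt (fun t : ℝ => (max (t - δ) 0) ^ 2) (2 * max (t - δ) 0) t := by
    rw [← (sqpos_c1 δ).2 t]
    exact ((sqpos_c1 δ).1.differentiable one_ne_zero t).hasDerivAt
  have h2 := ((h1.add_const (δ ^ 2)).sqrt (by positivity)).sub_const δ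
  have h3 : deriv (Th δ) t = _ := h2.deriv
  rw [h3]
  have : √((max (t - δ) 0) ^ 2 + δ ^ 2) ≠ 0 := by positivity
  field_simp

lemma Th_zero {δ t : ℝ} (hδ : 0 < δ) (ht : t ≤ δ) : Th δ t = 0 := by
  unfold Th
  rw [max_eq_right (by linarith)]
  simp [Real.sqrt_sq hδ.le]

lemma Th_bd {δ t : ℝ} (hδ : 0 < δ) (ht : 0 ≤ t) : |Th δ t| ≤ t := by
  have h1 : δ ≤ √((max (t - δ) 0) ^ 2 + δ ^ 2) := Real.le_sqrt_of_sq_le (by nlinarith [sq_nonneg (max (t - δ) 0)])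
  have h2 : √((max (t - δ) 0) ^ 2 + δ ^ 2) ≤ t + δ := by
    apply Real.sqrt_le_iff.2
    refine ⟨by linarith, ?_⟩
    rcases le_total (t - δ) 0 with h | h
    · rw [max_eq_right h]; nlinarith
    · rw [max_eq_left h]; nlinarith
  unfold Th
  rw [abs_le]; constructor <;> linarith

lemma Th_dbd {δ t : ℝ} (hδ : 0 < δ) : |deriv (Th δ) t| ≤ 1 := by
  rw [Th_deriv hδ, abs_of_nonneg (by positivity), div_le_one (by positivity)]
  exact Real.le_sqrt_of_sq_le (by nlinarith)

lemma Th_lim {t : ℝ} (ht : 0 < t) : Tendsto (fun n : ℕ => Th (1 / ((n : ℝ) + 1)) t) atTop (𝓝 t) ∧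
    Tendsto (fun n : ℕ => deriv (Th (1 / ((n : ℝ) + 1))) t) atTop (𝓝 1) := by
  have h := tendsto_one_div_add_atTop_nhds_zero_nat (𝕜 := ℝ)
  constructor
  · have hc : Continuous (fun δ => Th δ t) := by unfold Th; fun_prop
    have := (hc.tendsto 0).comp h
    have e : Th 0 t = t := by simp [Th, max_eq_left ht.le, Real.sqrt_sq ht.le]
    rwa [e] at this
  · have hc : ContinuousAt (fun δ => max (t - δ) 0 / √((max (t - δ) 0) ^ 2 + δ ^ 2)) 0 := by
      refine ContinuousAt.div (by fun_prop) (by fun_prop) ?_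
      simp [max_eq_left ht.le, Real.sqrt_sq ht.le, ht.ne']
    have h2 := hc.tendsto.comp h
    have e : max (t - 0) 0 / √((max (t - 0) 0) ^ 2 + 0 ^ 2) = 1 := by
      simp [max_eq_left ht.le, Real.sqrt_sq ht.le, ht.ne']
    rw [e] at h2
    refine h2.congr fun n => ?_
    rw [Th_deriv (by positivity)]; rfl

lemma Sol.weak {f u φ : E N → ℝ} (h : Sol N R₀ R₁ 1 f u) (hφ : Tst (annulus N R₀ R₁) φ) :
    ∫ x in annulus N R₀ R₁, inner ℝ (gradient u x) (gradient φ x) =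
      ∫ x in annulus N R₀ R₁, (f x - u x) * φ x := by
  rw [setIntegral_eq_integral_of_forall_compl_eq_zero, setIntegral_eq_integral_of_forall_compl_eq_zero]
  · simpa using h.ws.wk φ hφ
  · intro x hx; rw [hφ.zero hx, mul_zero]
  · intro x hx; rw [grad_zero_of_notMem (fun h => hx (hφ.ts h)), inner_zero_right]

lemma En_aux {f u v : E N → ℝ}
    (hi : IntegrableOn (fun x => inner ℝ (gradient u x) (gradient v x)) (annulus N R₀ R₁))
    (huv : IntegrableOn (fun x => u x * v x) (annulus N R₀ R₁))
    (hfv : IntegrableOn (fun x => f x * v x) (annulus N R₀ R₁))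
    (e : ∫ x in annulus N R₀ R₁, inner ℝ (gradient u x) (gradient v x) =
      ∫ x in annulus N R₀ R₁, (f x - u x) * v x) :
    En N R₀ R₁ u v = ∫ x in annulus N R₀ R₁, f x * v x := by
  unfold En
  rw [integral_add hi huv, e]
  simp_rw [sub_mul]
  rw [integral_sub hfv huv]; ring

lemma Sol.energy (h0 : 0 < R₀) (h1 : R₀ < R₁) {f u v : E N → ℝ} (h : Sol N R₀ R₁ 1 f u)
    (hf : ContinuousOn f (cA N R₀ R₁)) (hv : ContDiffOn ℝ 1 v (AO N R₀))
    (hb : ∀ x : E N, ‖x‖ = R₀ ∨ ‖x‖ = R₁ → v x = 0) (hpos : ∀ x ∈ annulus N R₀ R₁, 0 < v x) :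
    En N R₀ R₁ u v = ∫ x in annulus N R₀ R₁, f x * v x := by
  have hgu := grad_cA (R₁ := R₁) h0 h.c1
  have hgv := grad_cA (R₁ := R₁) h0 hv
  have hcv := cont_cA (R₁ := R₁) h0 hv
  have hcu := cont_cA (R₁ := R₁) h0 h.c1
  have hA := isOpen_annulus N R₀ R₁
  have hmA := meas_annulus N R₀ R₁
  have hts : ∀ n : ℕ, _ := fun n : ℕ => testfun hA (bdd_annulus N R₀ R₁) (v := v)
    (by rw [closure_annulus h0 h1]; exact hcv) (hv.mono ((ann_sub_cA _ _ _).trans (cA_sub_AO h0)))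
    (fun x hx => (hb x (frontier_annulus h0 h1 hx)).le) (Th_c1 (δ := 1 / ((n : ℝ) + 1)) (by positivity))
    (by positivity) (fun t ht => Th_zero (by positivity) ht)
  have hw : ∀ n : ℕ, ∫ x in annulus N R₀ R₁, deriv (Th (1 / ((n : ℝ) + 1))) (v x) *
      inner ℝ (gradient u x) (gradient v x) =
      ∫ x in annulus N R₀ R₁, (f x - u x) * Th (1 / ((n : ℝ) + 1)) (v x) := by
    intro n
    have := h.weak (hts n).1
    rw [setIntegral_congr_fun hmA (g := fun x => deriv (Th (1 / ((n : ℝ) + 1))) (v x) *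
      inner ℝ (gradient u x) (gradient v x))] at this
    · rw [this]
      refine setIntegral_congr_fun hmA fun x hx => ?_
      simp [indicator_of_mem hx]
    · intro x hx
      simp only
      rw [(hts n).2 x hx, real_inner_smul_right]
  have lim1 : Tendsto (fun n : ℕ => ∫ x in annulus N R₀ R₁, deriv (Th (1 / ((n : ℝ) + 1))) (v x) *
      inner ℝ (gradient u x) (gradient v x)) atTop
      (𝓝 (∫ x in annulus N R₀ R₁, inner ℝ (gradient u x) (gradient v x))) := by
    have hci : ContinuousOn (fun x => inner ℝ (gradient u x) (gradient v x)) (cA N R₀ R₁) := hgu.inner hgv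
    refine tendsto_integral_of_dominated_convergence (fun x => ‖inner ℝ (gradient u x) (gradient v x)‖) ?_
      (intA hci).norm ?_ ?_
    · intro n
      have hd : Continuous (deriv (Th (1 / ((n : ℝ) + 1)))) := (Th_c1 (by positivity)).continuous_deriv le_rfl
      exact (intA ((hd.comp_continuousOn hcv).mul hci)).aestronglyMeasurable
    · intro n
      refine Eventually.of_forall fun x => ?_
      rw [norm_mul]
      have := Th_dbd (δ := 1 / ((n : ℝ) + 1)) (t := v x) (by positivity)
      exact mul_le_of_le_one_left (norm_nonneg _) this
    · filter_upwards [ae_restrict_mem hmA] with x hx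
      simpa using (Th_lim (hpos x hx)).2.mul_const (inner ℝ (gradient u x) (gradient v x))
  have lim2 : Tendsto (fun n : ℕ => ∫ x in annulus N R₀ R₁, (f x - u x) * Th (1 / ((n : ℝ) + 1)) (v x)) atTop
      (𝓝 (∫ x in annulus N R₀ R₁, (f x - u x) * v x)) := by
    refine tendsto_integral_of_dominated_convergence (fun x => ‖(f x - u x) * v x‖) ?_
      (intA ((hf.sub hcu).mul hcv)).norm ?_ ?_
    · intro n
      have hd : Continuous (Th (1 / ((n : ℝ) + 1))) := (Th_c1 (by positivity)).continuous
      exact (intA ((hf.sub hcu).mul (hd.comp_continuousOn hcv))).aestronglyMeasurable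
    · intro n
      filter_upwards [ae_restrict_mem hmA] with x hx
      rw [norm_mul, norm_mul]
      have := Th_bd (δ := 1 / ((n : ℝ) + 1)) (t := v x) (by positivity) (hpos x hx).le
      gcongr
      rw [Real.norm_eq_abs, Real.norm_of_nonneg (hpos x hx).le]; exact this
    · filter_upwards [ae_restrict_mem hmA] with x hx
      exact (Th_lim (hpos x hx)).1.const_mul _
  simp_rw [hw] at lim1
  have e := tendsto_nhds_unique lim1 lim2
  exact En_aux (intA (hgu.inner hgv)) (intA (hcu.mul hcv)) (intA (hf.mul hcv)) e

lemma Sol.energy_tst (h0 : 0 < R₀) {f u v : E N → ℝ} (h : Sol N R₀ R₁ 1 f u)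
    (hf : ContinuousOn f (cA N R₀ R₁)) (hv : Tst (annulus N R₀ R₁) v) :
    En N R₀ R₁ u v = ∫ x in annulus N R₀ R₁, f x * v x := by
  have hcu := cont_cA (R₁ := R₁) h0 h.c1
  have hcv : ContinuousOn v (cA N R₀ R₁) := hv.c1.continuous.continuousOn
  exact En_aux (intA ((grad_cA h0 h.c1).inner (grad_cA h0 hv.c1.contDiffOn))) (intA (hcu.mul hcv))
    (intA (hf.mul hcv)) (h.weak hv)

end
end NR

open MeasureTheory Real Set
namespace NR
open Filter Topology

section
variable {N : ℕ} {R₀ R₁ : ℝ}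

/-- polar coordinates for lower integrals -/
lemma polar (hN : 3 ≤ N) {f : E N → ENNReal} (hf : Measurable f) :
    ∫⁻ x, f x = ∫⁻ ω, (∫⁻ r in Ioi (0:ℝ), ENNReal.ofReal (r ^ (N - 1)) * f (r • (ω : E N)))
      ∂((volume : Measure (E N)).toSphere) := by
  have hd : Module.finrank ℝ (E N) = N := by simp
  have : Nontrivial (E N) := by
    apply Module.nontrivial_of_finrank_pos (R := ℝ); omega
  calc ∫⁻ x, f x = ∫⁻ x : ({(0)}ᶜ : Set (E N)), f x.1 ∂((volume : Measure (E N)).comap Subtype.val) := by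
        rw [lintegral_subtype_comap (measurableSet_singleton _).compl f,
          restrict_compl_singleton]
    _ = ∫⁻ z, f (z.2.1 • (z.1 : E N)) ∂((volume : Measure (E N)).toSphere.prod
          (Measure.volumeIoiPow (Module.finrank ℝ (E N) - 1))) := by
        rw [← (volume : Measure (E N)).measurePreserving_homeomorphUnitSphereProd.lintegral_comp_emb
          (Homeomorph.measurableEmbedding _)]
        refine lintegral_congr fun x => ?_
        have h0 : ‖(x : E N)‖ ≠ 0 := norm_ne_zero_iff.2 x.2
        simp [smul_smul, h0]
    _ = ∫⁻ ω, (∫⁻ z, f (z.1 • (ω : E N)) ∂(Measure.volumeIoiPow (Module.finrank ℝ (E N) - 1)))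
          ∂((volume : Measure (E N)).toSphere) := by
        rw [lintegral_prod]
        apply Measurable.aemeasurable
        apply hf.comp
        fun_prop
    _ = _ := by
        refine lintegral_congr fun ω => ?_
        rw [Measure.volumeIoiPow, lintegral_withDensity_eq_lintegral_mul _ (by fun_prop), hd]
        · exact lintegral_subtype_comap measurableSet_Ioi
            (fun r => ENNReal.ofReal (r ^ (N - 1)) * f (r • (ω : E N)))
        · apply hf.comp
          fun_prop

lemma path {w : E N → ℝ} (hc : ContinuousOn w (cA N R₀ R₁)) (hd : ContDiffOn ℝ 1 w (annulus N R₀ R₁))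
    {a b : E N} {T : ℝ} (hT : 0 ≤ T) (hcl : ∀ s ∈ Icc 0 T, a + s • b ∈ cA N R₀ R₁)
    (hop : ∀ s ∈ Ioo 0 T, a + s • b ∈ annulus N R₀ R₁) (hend : w (a + T • b) = 0) (hb : ‖b‖ = 1) :
    ‖w a‖ₑ ≤ ∫⁻ s in Ioo 0 T, ‖gradient w (a + s • b)‖ₑ := by
  by_cases hfin : ∫⁻ s in Ioo 0 T, ‖gradient w (a + s • b)‖ₑ = ⊤
  · rw [hfin]; exact le_top
  have hl : Continuous fun s : ℝ => a + s • b := by fun_prop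
  have hgc : ContinuousOn (fun s : ℝ => gradient w (a + s • b)) (Ioo 0 T) :=
    (continuousOn_grad (isOpen_annulus _ _ _) hd).comp hl.continuousOn hop
  have hgi : ContinuousOn (fun s : ℝ => inner ℝ (gradient w (a + s • b)) b) (Ioo 0 T) :=
    hgc.inner continuousOn_const
  have hbd : ∀ s : ℝ, ‖inner ℝ (gradient w (a + s • b)) b‖ₑ ≤ ‖gradient w (a + s • b)‖ₑ := by
    intro s
    rw [enorm_le_iff_norm_le]
    have := norm_inner_le_norm (𝕜 := ℝ) (gradient w (a + s • b)) b
    rwa [hb, mul_one] at this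
  have hintg : IntegrableOn (fun s : ℝ => inner ℝ (gradient w (a + s • b)) b) (Ioo 0 T) := by
    refine ⟨hgi.aestronglyMeasurable measurableSet_Ioo, ?_⟩
    exact (lintegral_mono hbd).trans_lt (lt_top_iff_ne_top.2 hfin)
  have hii : IntervalIntegrable (fun s : ℝ => inner ℝ (gradient w (a + s • b)) b) volume 0 T := by
    rw [intervalIntegrable_iff_integrableOn_Ioo_of_le hT]; exact hintg
  have hF := intervalIntegral.integral_eq_sub_of_hasDerivAt_of_le (f := fun s => w (a + s • b)) hT
    (hc.comp hl.continuousOn hcl) (fun s hs => by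
      have h1 : HasFDerivAt w (fderiv ℝ w (a + s • b)) (a + s • b) :=
        ((hd.differentiableOn one_ne_zero).differentiableAt
          ((isOpen_annulus _ _ _).mem_nhds (hop s hs))).hasFDerivAt
      have h2 : HasDerivAt (fun s : ℝ => a + s • b) b s := by
        simpa using ((hasDerivAt_id s).smul_const b).const_add a
      have := h1.comp_hasDerivAt s h2
      rw [inner_grad]; exact this) hii
  simp only [hend, zero_smul, add_zero, zero_sub] at hF
  have h3 : ‖w a‖ₑ = ‖∫ s in (0:ℝ)..T, inner ℝ (gradient w (a + s • b)) b‖ₑ := by rw [hF, enorm_neg]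
  rw [h3, intervalIntegral.integral_of_le hT, integral_Ioc_eq_integral_Ioo]
  exact (enorm_integral_le_lintegral_enorm _).trans (lintegral_mono hbd)

/-- extension by zero of gradient norm -/
noncomputable def gA (R₀ R₁ : ℝ) (w : E N → ℝ) : E N → ENNReal :=
  (annulus N R₀ R₁).indicator fun x => ‖gradient w x‖ₑ

lemma meas_gA {w : E N → ℝ} (hd : ContDiffOn ℝ 1 w (annulus N R₀ R₁)) : Measurable (gA R₀ R₁ w) := by
  have h := (continuousOn_grad (isOpen_annulus _ _ _) hd).enorm
  classical
  unfold gA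
  rw [← Set.piecewise_eq_indicator]
  exact h.measurable_piecewise continuousOn_const (meas_annulus N R₀ R₁)

lemma ray (h0 : 0 < R₀) {w : E N → ℝ} (hc : ContinuousOn w (cA N R₀ R₁))
    (hd : ContDiffOn ℝ 1 w (annulus N R₀ R₁)) (hz : ∀ x, ‖x‖ = R₀ ∨ ‖x‖ = R₁ → w x = 0)
    {ω : E N} (hω : ‖ω‖ = 1) {r : ℝ} (hr : r ∈ Ioo R₀ R₁) :
    ‖w (r • ω)‖ₑ ≤ ∫⁻ s in Ioi (0:ℝ), gA R₀ R₁ w (s • ω) := by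
  have hn : ∀ s : ℝ, 0 ≤ s → ‖r • ω + s • ω‖ = r + s := by
    intro s hs
    rw [← add_smul, norm_smul, hω, mul_one, Real.norm_of_nonneg]
    linarith [hr.1]
  refine (path hc hd (a := r • ω) (b := ω) (T := R₁ - r) (by linarith [hr.2]) ?_ ?_ ?_ hω).trans ?_
  · intro s hs
    simp only [cA, mem_ofPred_eq, hn s hs.1]
    constructor <;> linarith [hr.1, hs.1, hs.2]
  · intro s hs
    simp only [annulus, mem_ofPred_eq, hn s hs.1.le]
    constructor <;> linarith [hr.1, hs.1, hs.2]
  · apply hz; right; rw [hn] <;> linarith [hr.2]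
  · calc ∫⁻ s in Ioo 0 (R₁ - r), ‖gradient w (r • ω + s • ω)‖ₑ
        ≤ ∫⁻ s in Ioo 0 (R₁ - r), gA R₀ R₁ w ((r + s) • ω) := by
          refine setLIntegral_mono' measurableSet_Ioo fun s hs => ?_
          rw [add_smul, gA, indicator_of_mem]
          simp only [annulus, mem_ofPred_eq, hn s hs.1.le]
          constructor <;> linarith [hr.1, hs.1, hs.2]
      _ ≤ ∫⁻ s in Ioi (0:ℝ), gA R₀ R₁ w ((r + s) • ω) := lintegral_mono_set Ioo_subset_Ioi_self
      _ = ∫⁻ s in Ioi r, gA R₀ R₁ w (s • ω) := by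
          rw [← lintegral_indicator measurableSet_Ioi, ← lintegral_indicator measurableSet_Ioi]
          rw [← lintegral_add_left_eq_self ((Ioi r).indicator fun s => gA R₀ R₁ w (s • ω)) r]
          congr 1; ext s
          simp [indicator]
      _ ≤ _ := lintegral_mono_set (Ioi_subset_Ioi (by linarith [hr.1]))

end
end NR

open MeasureTheory Real Set
namespace NR
open Filter Topology

section
variable {N : ℕ} {R₀ R₁ : ℝ}

noncomputable def e1 (N : ℕ) (hN : 3 ≤ N) : E N := EuclideanSpace.single ⟨0, by omega⟩ 1

lemma norm_e1 (hN : 3 ≤ N) : ‖e1 N hN‖ = 1 := by simp [e1]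
lemma norm_eL (hN : 3 ≤ N) : ‖eL N hN‖ = 1 := by simp [eL]
lemma eL_e1 (hN : 3 ≤ N) : inner ℝ (eL N hN) (e1 N hN) = 0 := by
  simp [eL, e1, EuclideanSpace.inner_single_left]
  omega

/-- equatorial profile -/
noncomputable def Wr (N : ℕ) (hN : 3 ≤ N) (R₀ R₁ : ℝ) (w : E N → ℝ) : ℝ → ENNReal :=
  (Ioo R₀ R₁).indicator fun r => ‖w (r • e1 N hN)‖ₑ

lemma meas_Wr (hN : 3 ≤ N) (h0 : 0 < R₀) {w : E N → ℝ} (hc : ContinuousOn w (cA N R₀ R₁)) :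
    Measurable (Wr N hN R₀ R₁ w) := by
  have h : ContinuousOn (fun r : ℝ => ‖w (r • e1 N hN)‖ₑ) (Ioo R₀ R₁) := by
    refine (hc.comp (f := fun r : ℝ => r • e1 N hN) (by fun_prop) ?_).enorm
    intro r hr
    have : 0 < r := h0.trans hr.1
    simp [cA, norm_smul, norm_e1, abs_of_pos this, hr.1.le, hr.2.le]
  classical
  unfold Wr
  rw [← Set.piecewise_eq_indicator]
  exact h.measurable_piecewise continuousOn_const measurableSet_Ioo

/-- projection to the equatorial hyperplane -/
noncomputable def Pe (hN : 3 ≤ N) (x : E N) : E N := x - (inner ℝ (eL N hN) x) • eL N hN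

lemma Pe_inner (hN : 3 ≤ N) (x : E N) : inner ℝ (eL N hN) (Pe hN x) = 0 := by
  simp [Pe, inner_sub_right, inner_smul_right, norm_eL]

lemma Pe_norm (hN : 3 ≤ N) (x : E N) : ‖Pe hN x‖ ^ 2 = ‖x‖ ^ 2 - (inner ℝ (eL N hN) x) ^ 2 := by
  rw [Pe, norm_sub_sq_real, inner_smul_right, norm_smul, norm_eL, real_inner_comm]
  rw [mul_one, Real.norm_eq_abs, sq_abs]; ring

lemma Pe_smul (hN : 3 ≤ N) (r : ℝ) (x : E N) : Pe hN (r • x) = r • Pe hN x := by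
  simp [Pe, inner_smul_right, smul_sub, smul_smul]

lemma Pe_add (hN : 3 ≤ N) (x : E N) (s : ℝ) : ‖Pe hN x + s • eL N hN‖ ^ 2 = ‖Pe hN x‖ ^ 2 + s ^ 2 := by
  rw [norm_add_sq_real, inner_smul_right, real_inner_comm, Pe_inner, norm_smul, norm_eL]
  rw [mul_one, Real.norm_eq_abs, sq_abs]; ring

lemma Pe_cont (hN : 3 ≤ N) : Continuous (Pe hN : E N → E N) := by
  unfold Pe; fun_prop

lemma vert (hN : 3 ≤ N) (h0 : 0 < R₀) {w : E N → ℝ} (hc : ContinuousOn w (cA N R₀ R₁))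
    (hd : ContDiffOn ℝ 1 w (annulus N R₀ R₁)) (hz : ∀ x, ‖x‖ = R₀ ∨ ‖x‖ = R₁ → w x = 0)
    (hp : PC N R₀ R₁ w) {x : E N} (hx : |inner ℝ (eL N hN) x| < 1) :
    Wr N hN R₀ R₁ w ‖Pe hN x‖ ≤ ∫⁻ s in Icc (-(R₁ + 1)) (R₁ + 1), gA R₀ R₁ w (x + s • eL N hN) := by
  by_cases hm : ‖Pe hN x‖ ∈ Ioo R₀ R₁
  swap
  · rw [Wr, indicator_of_notMem hm]; exact zero_le
  rw [Wr, indicator_of_mem hm]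
  have hR1 : 0 < R₁ := h0.trans (hm.1.trans hm.2)
  have hcA : Pe hN x ∈ cA N R₀ R₁ := ⟨hm.1.le, hm.2.le⟩
  have hW : w (‖Pe hN x‖ • e1 N hN) = w (Pe hN x) := by
    apply hp.eq hcA
    · simp [norm_smul, norm_e1]
    · rw [lastCoord_eq hN, lastCoord_eq hN, Pe_inner, inner_smul_right, eL_e1, mul_zero]
  rw [hW]
  set ρ := ‖Pe hN x‖ with hρ
  set T := √(R₁ ^ 2 - ρ ^ 2) with hT
  have hpos : 0 ≤ R₁ ^ 2 - ρ ^ 2 := by nlinarith [hm.1, hm.2]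
  have hT0 : 0 ≤ T := Real.sqrt_nonneg _
  have hT2 : T ^ 2 = R₁ ^ 2 - ρ ^ 2 := Real.sq_sqrt hpos
  have hTR : T ≤ R₁ := by
    apply abs_le_of_sq_le_sq' _ hR1.le |>.2
    nlinarith [sq_nonneg ρ]
  have hnorm := Pe_add hN x
  rw [← hρ] at hnorm
  refine (path hc hd (a := Pe hN x) (b := eL N hN) (T := T) hT0 ?_ ?_ ?_ (norm_eL hN)).trans ?_
  · intro s hs
    have := hnorm s
    constructor
    · refine (pow_le_pow_iff_left₀ h0.le (norm_nonneg _) two_ne_zero).1 ?_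
      nlinarith [hm.1]
    · refine (pow_le_pow_iff_left₀ (norm_nonneg _) hR1.le two_ne_zero).1 ?_
      nlinarith [hs.1, hs.2]
  · intro s hs
    have := hnorm s
    constructor
    · refine lt_of_pow_lt_pow_left₀ 2 (norm_nonneg _) ?_
      nlinarith [hm.1]
    · refine lt_of_pow_lt_pow_left₀ 2 hR1.le ?_
      nlinarith [hs.1, hs.2]
  · apply hz; right
    have := hnorm T
    rw [← abs_of_nonneg (norm_nonneg (Pe hN x + T • eL N hN)), ← abs_of_pos hR1, ← sq_eq_sq_iff_abs_eq_abs]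
    linarith
  · set t := inner ℝ (eL N hN) x with ht
    have hst : ∀ s : ℝ, Pe hN x + s • eL N hN = x + (-t + s) • eL N hN := by
      intro s; rw [Pe, add_smul, neg_smul]; abel
    have ht' := abs_lt.1 hx
    calc ∫⁻ s in Ioo 0 T, ‖gradient w (Pe hN x + s • eL N hN)‖ₑ
        ≤ ∫⁻ s in Ioo 0 T, gA R₀ R₁ w (x + (-t + s) • eL N hN) := by
          refine setLIntegral_mono' measurableSet_Ioo fun s hs => ?_
          rw [← hst, gA, indicator_of_mem]
          have := hnorm s
          constructor
          · refine lt_of_pow_lt_pow_left₀ 2 (norm_nonneg _) ?_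
            nlinarith [hm.1]
          · refine lt_of_pow_lt_pow_left₀ 2 hR1.le ?_
            nlinarith [hs.1, hs.2]
      _ ≤ ∫⁻ s, (Icc (-(R₁ + 1)) (R₁ + 1)).indicator (fun s => gA R₀ R₁ w (x + s • eL N hN)) (-t + s) := by
          rw [← lintegral_indicator measurableSet_Ioo]
          refine lintegral_mono fun s => ?_
          by_cases hs : s ∈ Ioo 0 T
          · rw [indicator_of_mem hs, indicator_of_mem]
            constructor <;> linarith [hs.1, hs.2]
          · rw [indicator_of_notMem hs]; exact zero_le
      _ = _ := by
          rw [lintegral_add_left_eq_self (μ := volume), lintegral_indicator measurableSet_Icc]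

lemma scale_le {f : ℝ → ENNReal} (hf : Measurable f) {c : ℝ} (h0 : 0 < c) (h1 : c ≤ 1) :
    ∫⁻ r, f r ≤ ∫⁻ r, f (c * r) := by
  conv_lhs => rw [← Real.smul_map_volume_mul_left h0.ne']
  rw [lintegral_smul_measure, lintegral_map hf (by fun_prop), abs_of_pos h0, smul_eq_mul]
  have : ENNReal.ofReal c ≤ 1 := by simpa using h1
  exact mul_le_of_le_one_left' this

lemma W_bound (hN : 3 ≤ N) (h0 : 0 < R₀) (h1 : R₀ < R₁) : ∃ C : ENNReal, C ≠ ⊤ ∧ ∀ w : E N → ℝ,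
    ContinuousOn w (cA N R₀ R₁) → ContDiffOn ℝ 1 w (annulus N R₀ R₁) →
    (∀ x, ‖x‖ = R₀ ∨ ‖x‖ = R₁ → w x = 0) → PC N R₀ R₁ w →
    ∫⁻ r, Wr N hN R₀ R₁ w r ≤ C * ∫⁻ x, gA R₀ R₁ w x := by
  set κ : ℝ := min (1 / 2) (1 / (2 * R₁)) with hκ
  have hR1 : 0 < R₁ := h0.trans h1
  have hκ0 : 0 < κ := by rw [hκ]; positivity
  have hκ1 : κ ≤ 1 / 2 := min_le_left _ _
  have hκ2 : κ * (2 * R₁) ≤ 1 := by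
    have := min_le_right (1 / 2) (1 / (2 * R₁))
    rwa [← hκ, le_div_iff₀ (by positivity)] at this
  set U : Set (Metric.sphere (0 : E N) 1) := {ω | |inner ℝ (eL N hN) (ω : E N)| < κ} with hU
  have hUo : IsOpen U := isOpen_lt (by fun_prop) continuous_const
  have hUn : U.Nonempty := ⟨⟨e1 N hN, by simp [norm_e1]⟩, by simp [hU, eL_e1, hκ0]⟩
  have hUp : (volume : Measure (E N)).toSphere U ≠ 0 := (hUo.measure_pos _ hUn).ne'
  set m := (volume : Measure (E N)).toSphere U with hm
  set A0 : ENNReal := ENNReal.ofReal (R₀ ^ (N - 1)) with hA0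
  have hA0p : A0 ≠ 0 := by simp [hA0]; positivity
  refine ⟨(A0 * m)⁻¹ * ENNReal.ofReal (2 * (R₁ + 1)), ?_, ?_⟩
  · apply ENNReal.mul_ne_top (ENNReal.inv_ne_top.2 (mul_ne_zero hA0p hUp)) ENNReal.ofReal_ne_top
  intro w hc hd hz hp
  have hWm := meas_Wr hN h0 hc (R₁ := R₁)
  set S : Set (E N) := {x | |inner ℝ (eL N hN) x| < 1} with hS
  have hSm : MeasurableSet S := (isOpen_lt (by fun_prop) continuous_const).measurableSet
  set f : E N → ENNReal := S.indicator fun x => Wr N hN R₀ R₁ w ‖Pe hN x‖ with hf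
  have hfm : Measurable f := (hWm.comp (Pe_cont hN).norm.measurable).indicator hSm
  have hup : ∫⁻ x, f x ≤ ENNReal.ofReal (2 * (R₁ + 1)) * ∫⁻ x, gA R₀ R₁ w x := by
    calc ∫⁻ x, f x ≤ ∫⁻ x, ∫⁻ s in Icc (-(R₁ + 1)) (R₁ + 1), gA R₀ R₁ w (x + s • eL N hN) := by
          refine lintegral_mono fun x => ?_
          by_cases hx : x ∈ S
          · rw [hf, indicator_of_mem hx]; exact vert hN h0 hc hd hz hp hx
          · rw [hf, indicator_of_notMem hx]; exact zero_le
      _ = ∫⁻ s in Icc (-(R₁ + 1)) (R₁ + 1), ∫⁻ x, gA R₀ R₁ w (x + s • eL N hN) := by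
          rw [lintegral_lintegral_swap]
          exact ((meas_gA hd).comp (by fun_prop)).aemeasurable
      _ = ∫⁻ s in Icc (-(R₁ + 1)) (R₁ + 1), ∫⁻ x, gA R₀ R₁ w x := by
          refine lintegral_congr fun s => ?_
          rw [lintegral_add_right_eq_self (μ := volume)]
      _ = _ := by
          rw [setLIntegral_const, Real.volume_Icc, mul_comm]; congr 2; ring
  have hlow : A0 * m * ∫⁻ r, Wr N hN R₀ R₁ w r ≤ ∫⁻ x, f x := by
    rw [polar hN hfm]
    calc A0 * m * ∫⁻ r, Wr N hN R₀ R₁ w r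
        = ∫⁻ _ω in U, (A0 * ∫⁻ r, Wr N hN R₀ R₁ w r) ∂((volume : Measure (E N)).toSphere) := by
          rw [setLIntegral_const]; ring
      _ ≤ ∫⁻ ω in U, (∫⁻ r in Ioi (0:ℝ), ENNReal.ofReal (r ^ (N - 1)) * f (r • (ω : E N)))
            ∂((volume : Measure (E N)).toSphere) := by
          refine setLIntegral_mono' hUo.measurableSet fun ω hω => ?_
          have hω1 : ‖(ω : E N)‖ = 1 := by simp
          have hω2 : |inner ℝ (eL N hN) (ω : E N)| < κ := hω
          have hP := Pe_norm hN (ω : E N)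
          rw [hω1] at hP
          have hsq : (inner ℝ (eL N hN) (ω : E N)) ^ 2 ≤ 1 / 4 := by
            rw [← sq_abs]; nlinarith [abs_nonneg (inner ℝ (eL N hN) (ω : E N))]
          set c := ‖Pe hN (ω : E N)‖ with hcdef
          have hc0 : 0 ≤ c := norm_nonneg _
          have hc1 : c ≤ 1 := by nlinarith [sq_nonneg (inner ℝ (eL N hN) (ω : E N))]
          have hc2 : 1 / 2 < c := by nlinarith
          calc A0 * ∫⁻ r, Wr N hN R₀ R₁ w r ≤ A0 * ∫⁻ r, Wr N hN R₀ R₁ w (c * r) := mul_le_mul' le_rfl (scale_le hWm (by linarith) hc1)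
            _ = ∫⁻ r, A0 * Wr N hN R₀ R₁ w (c * r) := by
                have hm' : Measurable fun r => Wr N hN R₀ R₁ w (c * r) := hWm.comp (by fun_prop)
                rw [lintegral_const_mul _ hm']
            _ ≤ _ := by
                rw [← lintegral_indicator measurableSet_Ioi]
                refine lintegral_mono fun r => ?_
                by_cases hr : c * r ∈ Ioo R₀ R₁
                swap
                · rw [Wr, indicator_of_notMem hr, mul_zero]; exact zero_le
                have hr0 : 0 < r := by
                  have : 0 < c * r := h0.trans hr.1
                  exact (pos_iff_pos_of_mul_pos this).1 (by linarith)
                rw [indicator_of_mem (show r ∈ Ioi (0:ℝ) from hr0)]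
                have hrR : r < 2 * R₁ := by nlinarith [hr.2]
                have hrR0 : R₀ ≤ r := by nlinarith [hr.1]
                have hmem : r • (ω : E N) ∈ S := by
                  simp only [hS, mem_ofPred_eq, inner_smul_right, abs_mul, abs_of_pos hr0]
                  nlinarith [abs_nonneg (inner ℝ (eL N hN) (ω : E N))]
                rw [hf, indicator_of_mem hmem, Pe_smul, norm_smul, Real.norm_of_nonneg hr0.le,
                  ← hcdef, mul_comm r c, hA0]
                gcongr
      _ ≤ _ := setLIntegral_le_lintegral _ _
  have hfin : A0 * m ≠ ⊤ := ENNReal.mul_ne_top ENNReal.ofReal_ne_top (measure_ne_top _ _)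
  have hne : A0 * m ≠ 0 := mul_ne_zero hA0p hUp
  rw [mul_assoc]
  calc _ = (A0 * m)⁻¹ * (A0 * m * ∫⁻ r, Wr N hN R₀ R₁ w r) := by
        rw [← mul_assoc, ENNReal.inv_mul_cancel hne hfin, one_mul]
    _ ≤ _ := mul_le_mul' le_rfl (hlow.trans hup)

/-- sup along rays integrated -/
lemma sob (hN : 3 ≤ N) (h0 : 0 < R₀) (h1 : R₀ < R₁) : ∃ C : ENNReal, C ≠ ⊤ ∧ ∀ w : E N → ℝ,
    ContinuousOn w (cA N R₀ R₁) → ContDiffOn ℝ 1 w (annulus N R₀ R₁) →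
    (∀ x, ‖x‖ = R₀ ∨ ‖x‖ = R₁ → w x = 0) → (∀ x ∈ cA N R₀ R₁, 0 ≤ w x) → PC N R₀ R₁ w →
    ∫⁻ x in annulus N R₀ R₁, ‖w x‖ₑ ^ 2 ≤ C * (∫⁻ x, gA R₀ R₁ w x) ^ 2 := by
  obtain ⟨C, hC, hW⟩ := W_bound hN h0 h1
  have hR1 : 0 < R₁ := h0.trans h1
  set A0 : ENNReal := ENNReal.ofReal (R₀ ^ (N - 1)) with hA0
  set A1 : ENNReal := ENNReal.ofReal (R₁ ^ (N - 1)) with hA1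
  have hA0p : A0 ≠ 0 := by simp [hA0]; positivity
  refine ⟨A1 * A0⁻¹ * C, ENNReal.mul_ne_top (ENNReal.mul_ne_top ENNReal.ofReal_ne_top
    (ENNReal.inv_ne_top.2 hA0p)) hC, ?_⟩
  intro w hc hd hz hnn hp
  have hgm := meas_gA hd
  have hWm := meas_Wr hN h0 hc (R₁ := R₁)
  have hwm : Measurable ((annulus N R₀ R₁).indicator fun x => ‖w x‖ₑ ^ 2) := by
    have h := ((hc.mono (ann_sub_cA _ _ _)).enorm)
    classical
    rw [← Set.piecewise_eq_indicator]
    exact ((ENNReal.continuous_pow 2).comp_continuousOn h).measurable_piecewise continuousOn_const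
      (meas_annulus N R₀ R₁)
  rw [← lintegral_indicator (meas_annulus _ _ _), polar hN hwm]
  have hJm : Measurable fun ω : Metric.sphere (0 : E N) 1 =>
      ∫⁻ r in Ioi (0:ℝ), ENNReal.ofReal (r ^ (N - 1)) * gA R₀ R₁ w (r • (ω : E N)) := by
    apply Measurable.lintegral_prod_right'
      (f := fun z : Metric.sphere (0 : E N) 1 × ℝ => ENNReal.ofReal (z.2 ^ (N - 1)) * gA R₀ R₁ w (z.2 • (z.1 : E N)))
    apply Measurable.mul (by fun_prop)
    apply hgm.comp
    fun_prop
  have key : ∀ ω : Metric.sphere (0 : E N) 1,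
      (∫⁻ r in Ioi (0:ℝ), ENNReal.ofReal (r ^ (N - 1)) *
        (annulus N R₀ R₁).indicator (fun x => ‖w x‖ₑ ^ 2) (r • (ω : E N)))
      ≤ A1 * A0⁻¹ * (∫⁻ r, Wr N hN R₀ R₁ w r) *
        ∫⁻ r in Ioi (0:ℝ), ENNReal.ofReal (r ^ (N - 1)) * gA R₀ R₁ w (r • (ω : E N)) := by
    intro ω
    have hω : ‖(ω : E N)‖ = 1 := by simp
    set J := ∫⁻ r in Ioi (0:ℝ), ENNReal.ofReal (r ^ (N - 1)) * gA R₀ R₁ w (r • (ω : E N)) with hJ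
    have hM : ∫⁻ s in Ioi (0:ℝ), gA R₀ R₁ w (s • (ω : E N)) ≤ A0⁻¹ * J := by
      rw [hJ, ← lintegral_const_mul]
      · refine setLIntegral_mono' measurableSet_Ioi fun s hs => ?_
        have hs0 : 0 < s := hs
        by_cases hm : s • (ω : E N) ∈ annulus N R₀ R₁
        · have hsR : R₀ < s := by
            have := hm.1; rwa [norm_smul, hω, mul_one, Real.norm_of_nonneg hs0.le] at this
          calc gA R₀ R₁ w (s • (ω : E N)) = A0⁻¹ * A0 * gA R₀ R₁ w (s • (ω : E N)) := by
                rw [ENNReal.inv_mul_cancel hA0p ENNReal.ofReal_ne_top, one_mul]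
            _ ≤ _ := by rw [mul_assoc, hA0]; gcongr
        · rw [gA, indicator_of_notMem hm]; exact zero_le
      · apply Measurable.mul (by fun_prop)
        apply hgm.comp
        fun_prop
    calc _ ≤ ∫⁻ r in Ioi (0:ℝ), A1 * A0⁻¹ * J * Wr N hN R₀ R₁ w r := by
          refine setLIntegral_mono' measurableSet_Ioi fun r hr => ?_
          have hr0 : 0 < r := hr
          have hn : ‖r • (ω : E N)‖ = r := by rw [norm_smul, hω, mul_one, Real.norm_of_nonneg hr0.le]
          by_cases hm : r • (ω : E N) ∈ annulus N R₀ R₁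
          swap
          · rw [indicator_of_notMem hm, mul_zero]; exact zero_le
          have hrI : r ∈ Ioo R₀ R₁ := by
            have := hm; simp only [annulus, mem_ofPred_eq, hn] at this; exact this
          have hcA := ann_sub_cA _ _ _ hm
          have hle : ‖w (r • (ω : E N))‖ₑ ≤ Wr N hN R₀ R₁ w r := by
            rw [Wr, indicator_of_mem hrI, enorm_le_iff_norm_le]
            have hn1 : ‖r • e1 N hN‖ = r := by rw [norm_smul, norm_e1, mul_one, Real.norm_of_nonneg hr0.le]
            have hcA1 : r • e1 N hN ∈ cA N R₀ R₁ := by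
              simp only [cA, mem_ofPred_eq, hn1]; exact ⟨hrI.1.le, hrI.2.le⟩
            rw [Real.norm_of_nonneg (hnn _ hcA), Real.norm_of_nonneg (hnn _ hcA1)]
            apply hp _ hcA1 _ hcA
            · rw [hn, hn1]
            · rw [lastCoord_eq hN, inner_smul_right, eL_e1]; simp
          have hle2 : ‖w (r • (ω : E N))‖ₑ ≤ A0⁻¹ * J := (ray h0 hc hd hz hω hrI).trans hM
          rw [indicator_of_mem hm, sq]
          calc _ ≤ A1 * ((A0⁻¹ * J) * Wr N hN R₀ R₁ w r) := by
                rw [hA1]; gcongr; exact hrI.2.le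
            _ = _ := by ring
      _ ≤ ∫⁻ r, A1 * A0⁻¹ * J * Wr N hN R₀ R₁ w r := setLIntegral_le_lintegral _ _
      _ = _ := by rw [lintegral_const_mul _ hWm]; ring
  refine (lintegral_mono key).trans ?_
  rw [lintegral_const_mul _ hJm, ← polar hN hgm]
  calc _ ≤ A1 * A0⁻¹ * (C * ∫⁻ x, gA R₀ R₁ w x) * ∫⁻ x, gA R₀ R₁ w x := by
        gcongr; exact hW w hc hd hz hp
    _ = _ := by ring

end
end NR

open MeasureTheory Real Set
namespace NR
open Filter Topology

section
variable {N : ℕ} {R₀ R₁ : ℝ}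

lemma CS_A {F G : E N → ℝ} (hF : ContinuousOn F (cA N R₀ R₁)) (hG : ContinuousOn G (cA N R₀ R₁)) :
    (∫ x in annulus N R₀ R₁, F x * G x) ^ 2 ≤
      (∫ x in annulus N R₀ R₁, F x ^ 2) * ∫ x in annulus N R₀ R₁, G x ^ 2 := by
  set a := ∫ x in annulus N R₀ R₁, F x ^ 2 with ha
  set b := ∫ x in annulus N R₀ R₁, F x * G x with hb
  set c := ∫ x in annulus N R₀ R₁, G x ^ 2 with hc
  have key : ∀ t : ℝ, 0 ≤ c * (t * t) + (-2 * b) * t + a := by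
    intro t
    have h1 : IntegrableOn (fun x => F x ^ 2) (annulus N R₀ R₁) := intA (hF.pow 2)
    have h2 : IntegrableOn (fun x => (-2 * t) * (F x * G x)) (annulus N R₀ R₁) :=
      (intA (hF.mul hG)).const_mul _
    have h3 : IntegrableOn (fun x => (t * t) * G x ^ 2) (annulus N R₀ R₁) := (intA (hG.pow 2)).const_mul _
    have h12 : IntegrableOn (fun x => F x ^ 2 + (-2 * t) * (F x * G x)) (annulus N R₀ R₁) := h1.add h2
    have : 0 ≤ ∫ x in annulus N R₀ R₁, (F x ^ 2 + (-2 * t) * (F x * G x) + (t * t) * G x ^ 2) := by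
      refine integral_nonneg fun x => ?_
      simp only [Pi.zero_apply]
      nlinarith [sq_nonneg (F x - t * G x)]
    rw [integral_add h12 h3, integral_add h1 h2, integral_const_mul, integral_const_mul] at this
    rw [← ha, ← hb, ← hc] at this
    linarith
  have := discrim_le_zero key
  rw [discrim] at this
  nlinarith

lemma grad_pow {u : E N → ℝ} {x : E N} (hu : DifferentiableAt ℝ u x) (m : ℕ) :
    gradient (fun y => u y ^ (m + 1)) x = ((m + 1 : ℝ) * u x ^ m) • gradient u x := by
  apply ext_inner_right ℝ
  intro v
  rw [inner_grad, inner_smul_left, inner_grad]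
  rw [show (fun y => u y ^ (m + 1)) = u ^ (m + 1) from rfl, fderiv_pow _ hu]
  simp

lemma gradsq_le (h0 : 0 < R₀) {u : E N → ℝ} (hu : ContDiffOn ℝ 1 u (AO N R₀)) :
    ∫ x in annulus N R₀ R₁, ‖gradient u x‖ ^ 2 ≤ En N R₀ R₁ u u := by
  refine integral_mono (intA ((grad_cA h0 hu).norm.pow 2)) (En_int h0 hu hu) fun x => ?_
  simp only [real_inner_self_eq_norm_sq]
  nlinarith [mul_self_nonneg (u x)]

lemma enorm_int {F : E N → ℝ} (hF : ContinuousOn F (cA N R₀ R₁)) (hn : ∀ x ∈ cA N R₀ R₁, 0 ≤ F x) :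
    ∫⁻ x in annulus N R₀ R₁, ‖F x‖ₑ = ENNReal.ofReal (∫ x in annulus N R₀ R₁, F x) := by
  rw [ofReal_integral_eq_lintegral_ofReal (intA hF)]
  · refine setLIntegral_congr_fun (meas_annulus _ _ _) fun x hx => ?_
    exact Real.enorm_of_nonneg (hn x (ann_sub_cA _ _ _ hx))
  · exact ae_restrict_of_forall_mem (meas_annulus _ _ _) fun x hx => hn x (ann_sub_cA _ _ _ hx)

lemma pow_step (hN : 3 ≤ N) (h0 : 0 < R₀) (h1 : R₀ < R₁) : ∃ C : ℝ, 0 ≤ C ∧ ∀ (u : E N → ℝ) (m : ℕ),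
    ContDiffOn ℝ 1 u (AO N R₀) → (∀ x, ‖x‖ = R₀ ∨ ‖x‖ = R₁ → u x = 0) →
    (∀ x ∈ cA N R₀ R₁, 0 ≤ u x) → PC N R₀ R₁ u →
    ∫ x in annulus N R₀ R₁, u x ^ (2 * (m + 1)) ≤
      C * (m + 1) ^ 2 * (∫ x in annulus N R₀ R₁, u x ^ (2 * m)) * En N R₀ R₁ u u := by
  obtain ⟨C, hC, hs⟩ := sob hN h0 h1
  refine ⟨C.toReal, ENNReal.toReal_nonneg, ?_⟩
  intro u m hu hz hn hp
  have hann : annulus N R₀ R₁ ⊆ AO N R₀ := (ann_sub_cA _ _ _).trans (cA_sub_AO h0)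
  have huc := cont_cA (R₁ := R₁) h0 hu
  have hgc := grad_cA (R₁ := R₁) h0 hu
  have := hs (fun x => u x ^ (m + 1)) (huc.pow _) ((hu.mono hann).pow _)
    (fun x hx => by simp [hz x hx]) (fun x hx => pow_nonneg (hn x hx) _)
    (fun x hx x' hx' h h' => pow_le_pow_left₀ (hn x' hx') (hp x hx x' hx' h h') _)
  have e1 : ∫⁻ x in annulus N R₀ R₁, ‖u x ^ (m + 1)‖ₑ ^ 2
      = ENNReal.ofReal (∫ x in annulus N R₀ R₁, u x ^ (2 * (m + 1))) := by
    rw [← enorm_int (F := fun x => u x ^ (2 * (m + 1))) (huc.pow _) (fun x hx => pow_nonneg (hn x hx) _)]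
    congr 1; ext x
    rw [← enorm_pow, ← pow_mul, mul_comm]
  have e2 : ∫⁻ x, gA R₀ R₁ (fun x => u x ^ (m + 1)) x
      = ENNReal.ofReal (∫ x in annulus N R₀ R₁, (m + 1) * (u x ^ m * ‖gradient u x‖)) := by
    rw [← enorm_int (F := fun x => (m + 1) * (u x ^ m * ‖gradient u x‖)) ((continuousOn_const (c := (m + 1 : ℝ))).mul ((huc.pow m).mul hgc.norm)) (fun x hx => by
      have := pow_nonneg (hn x hx) m; positivity)]
    rw [← lintegral_indicator (meas_annulus _ _ _), gA]
    congr 1; ext x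
    by_cases hx : x ∈ annulus N R₀ R₁
    · rw [indicator_of_mem hx, indicator_of_mem hx, grad_pow, enorm_smul, enorm_mul, enorm_mul, enorm_mul,
        enorm_norm, mul_assoc]
      exact (hu.differentiableOn one_ne_zero).differentiableAt ((isOpen_AO _ _).mem_nhds (hann hx))
    · rw [indicator_of_notMem hx, indicator_of_notMem hx]
  have hnn : 0 ≤ ∫ x in annulus N R₀ R₁, (m + 1) * (u x ^ m * ‖gradient u x‖) := by
    refine setIntegral_nonneg (meas_annulus _ _ _) fun x hx => ?_
    have := pow_nonneg (hn x (ann_sub_cA _ _ _ hx)) m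
    positivity
  rw [e1, e2, ← ENNReal.ofReal_toReal hC, ← ENNReal.ofReal_pow hnn,
    ← ENNReal.ofReal_mul ENNReal.toReal_nonneg, ENNReal.ofReal_le_ofReal_iff (by positivity)] at this
  refine this.trans ?_
  rw [integral_const_mul, mul_pow]
  have hcs := CS_A (F := fun x => u x ^ m) (huc.pow m) hgc.norm
  have h2 : ∫ x in annulus N R₀ R₁, (u x ^ m) ^ 2 = ∫ x in annulus N R₀ R₁, u x ^ (2 * m) := by
    congr 1; ext x; rw [← pow_mul, mul_comm]
  rw [h2] at hcs
  have h3 := gradsq_le (R₁ := R₁) h0 hu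
  have h4 : 0 ≤ ∫ x in annulus N R₀ R₁, u x ^ (2 * m) := by
    refine integral_nonneg fun x => ?_
    simp only [Pi.zero_apply, pow_mul]; positivity
  calc C.toReal * ((m + 1) ^ 2 * (∫ x in annulus N R₀ R₁, u x ^ m * ‖gradient u x‖) ^ 2)
      ≤ C.toReal * ((m + 1) ^ 2 * ((∫ x in annulus N R₀ R₁, u x ^ (2 * m)) * En N R₀ R₁ u u)) := by
        gcongr
        exact hcs.trans (by gcongr)
    _ = _ := by ring

lemma pow_bound (hN : 3 ≤ N) (h0 : 0 < R₀) (h1 : R₀ < R₁) (m : ℕ) : ∃ C : ℝ, 0 ≤ C ∧ ∀ u : E N → ℝ,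
    ContDiffOn ℝ 1 u (AO N R₀) → (∀ x, ‖x‖ = R₀ ∨ ‖x‖ = R₁ → u x = 0) →
    (∀ x ∈ cA N R₀ R₁, 0 ≤ u x) → PC N R₀ R₁ u → En N R₀ R₁ u u ≤ 1 →
    ∫ x in annulus N R₀ R₁, u x ^ (2 * m) ≤ C := by
  obtain ⟨D, hD, hs⟩ := pow_step hN h0 h1
  induction m with
  | zero =>
    refine ⟨∫ x in annulus N R₀ R₁, (1:ℝ), integral_nonneg fun x => zero_le_one, ?_⟩
    intro u _ _ _ _ _
    simp
  | succ m ih =>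
    obtain ⟨C, hC, h⟩ := ih
    refine ⟨D * (m + 1) ^ 2 * C, by positivity, ?_⟩
    intro u a b c d e
    refine (hs u m a b c d).trans ?_
    have h4 : 0 ≤ ∫ x in annulus N R₀ R₁, u x ^ (2 * m) := by
      refine integral_nonneg fun x => ?_
      simp only [Pi.zero_apply, pow_mul]; positivity
    have := h u a b c d e
    calc _ ≤ D * (m + 1) ^ 2 * (∫ x in annulus N R₀ R₁, u x ^ (2 * m)) * 1 := by gcongr
      _ ≤ _ := by rw [mul_one]; gcongr

lemma En_smul (h0 : 0 < R₀) {u : E N → ℝ} (hu : ContDiffOn ℝ 1 u (AO N R₀)) (c : ℝ) :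
    En N R₀ R₁ (fun x => c * u x) (fun x => c * u x) = c ^ 2 * En N R₀ R₁ u u := by
  unfold En
  rw [← integral_const_mul]
  refine setIntegral_congr_fun (meas_annulus _ _ _) fun x hx => ?_
  have hd : DifferentiableAt ℝ u x := (hu.differentiableOn one_ne_zero).differentiableAt
    ((isOpen_AO _ _).mem_nhds (cA_sub_AO h0 (ann_sub_cA _ _ _ hx)))
  simp only [grad_smul c hd, inner_smul_left, inner_smul_right]
  simp; ring

/-- all Lebesgue norms are controlled by the energy on the cone -/
lemma Lq (hN : 3 ≤ N) (h0 : 0 < R₀) (h1 : R₀ < R₁) (q : ℝ) (hq : 0 ≤ q) : ∃ C : ℝ, 0 ≤ C ∧ ∀ u : E N → ℝ,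
    ContDiffOn ℝ 1 u (AO N R₀) → (∀ x, ‖x‖ = R₀ ∨ ‖x‖ = R₁ → u x = 0) →
    (∀ x ∈ cA N R₀ R₁, 0 ≤ u x) → PC N R₀ R₁ u → 0 < En N R₀ R₁ u u →
    ∫ x in annulus N R₀ R₁, u x ^ q ≤ C * (En N R₀ R₁ u u) ^ (q / 2) := by
  obtain ⟨m, hm⟩ := exists_nat_ge q
  obtain ⟨C, hC, h⟩ := pow_bound hN h0 h1 m
  refine ⟨(∫ x in annulus N R₀ R₁, (1:ℝ)) + C, add_nonneg (integral_nonneg fun x => zero_le_one) hC, ?_⟩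
  intro u a b c d e
  set t := √(En N R₀ R₁ u u) with ht
  have ht0 : 0 < t := Real.sqrt_pos.2 e
  have ht2 : t ^ 2 = En N R₀ R₁ u u := Real.sq_sqrt e.le
  have huc := cont_cA (R₁ := R₁) h0 a
  have hv := h (fun x => t⁻¹ * u x) (contDiffOn_const.mul a) (fun x hx => by simp [b x hx])
    (fun x hx => mul_nonneg (inv_nonneg.2 ht0.le) (c x hx))
    (fun x hx x' hx' h h' => mul_le_mul_of_nonneg_left (d x hx x' hx' h h') (inv_nonneg.2 ht0.le))
    (by rw [En_smul h0 a, ← ht2]; field_simp; rfl)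
  have hq2 : (En N R₀ R₁ u u) ^ (q / 2) = t ^ q := by
    rw [← ht2, ← Real.rpow_natCast, ← Real.rpow_mul ht0.le]; congr 1; push_cast; ring
  have hvc : ContinuousOn (fun x => t⁻¹ * u x) (cA N R₀ R₁) := continuousOn_const.mul huc
  have hle : ∫ x in annulus N R₀ R₁, (t⁻¹ * u x) ^ q ≤ ∫ x in annulus N R₀ R₁, (1 + (t⁻¹ * u x) ^ (2 * m)) := by
    refine setIntegral_mono_on (intA (hvc.rpow_const fun x _ => Or.inr hq))
      (intA (continuousOn_const.add (hvc.pow _))) (meas_annulus _ _ _) fun x hx => ?_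
    have hnn : 0 ≤ t⁻¹ * u x := mul_nonneg (inv_nonneg.2 ht0.le) (c x (ann_sub_cA _ _ _ hx))
    rcases le_total (t⁻¹ * u x) 1 with h' | h'
    · have := Real.rpow_le_one hnn h' hq
      have := pow_nonneg hnn (2 * m)
      linarith
    · have : (t⁻¹ * u x) ^ q ≤ (t⁻¹ * u x) ^ ((2 * m : ℕ) : ℝ) := by
        apply Real.rpow_le_rpow_of_exponent_le h'
        push_cast; linarith [(Nat.cast_nonneg m : (0:ℝ) ≤ m)]
      rw [Real.rpow_natCast] at this
      linarith
  have hsp : ∫ x in annulus N R₀ R₁, u x ^ q = t ^ q * ∫ x in annulus N R₀ R₁, (t⁻¹ * u x) ^ q := by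
    rw [← integral_const_mul]
    refine setIntegral_congr_fun (meas_annulus _ _ _) fun x hx => ?_
    have hnn : 0 ≤ u x := c x (ann_sub_cA _ _ _ hx)
    rw [← Real.mul_rpow ht0.le (by positivity)]
    congr 1; field_simp
  have i1 : IntegrableOn (fun _ : E N => (1:ℝ)) (annulus N R₀ R₁) := intA continuousOn_const
  have i2 : IntegrableOn (fun x : E N => (t⁻¹ * u x) ^ (2 * m)) (annulus N R₀ R₁) := intA (hvc.pow _)
  rw [integral_add i1 i2] at hle
  rw [hsp, hq2, mul_comm]
  have := Real.rpow_nonneg ht0.le q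
  gcongr
  linarith

end
end NR

open MeasureTheory Real Set
namespace NR
open Filter Topology

section
variable {N : ℕ} {R₀ R₁ : ℝ}

lemma young_ker (hN : 3 ≤ N) {z : E N} {f : ℝ} (hf : 0 ≤ f) :
    f * Gam N 0 z ≤ ‖z‖ ^ (-((N : ℝ) - 1)) + f ^ (N - 1) := by
  have hN' : (3 : ℝ) ≤ N := by exact_mod_cast hN
  rcases eq_or_ne z 0 with rfl | hz
  · have : Gam N 0 (0 : E N) = 0 := by
      simp only [Gam, norm_zero]
      rw [show ((0:ℝ) ^ 2 + 0) = 0 by norm_num, Real.zero_rpow]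
      have : (2 : ℝ) - N < 0 := by linarith
      intro h; linarith
    rw [this, mul_zero]; positivity
  have hzp : 0 < ‖z‖ := norm_pos_iff.2 hz
  have hG : Gam N 0 z ≤ ‖z‖ ^ (-((N : ℝ) - 2)) := by
    have := Gam_le2 hN le_rfl z hz
    rw [one_mul] at this
    exact (le_abs_self _).trans this
  have h1 : f * Gam N 0 z ≤ f * ‖z‖ ^ (-((N : ℝ) - 2)) := mul_le_mul_of_nonneg_left hG hf
  have hp : 0 ≤ ‖z‖ ^ (-((N : ℝ) - 1)) := by positivity
  have hq : 0 ≤ f ^ (N - 1) := by positivity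
  rcases le_or_gt f ‖z‖⁻¹ with h | h
  · have : f * ‖z‖ ^ (-((N : ℝ) - 2)) ≤ ‖z‖ ^ (-((N : ℝ) - 1)) := by
      calc _ ≤ ‖z‖⁻¹ * ‖z‖ ^ (-((N : ℝ) - 2)) := by gcongr
        _ = _ := by
          rw [← Real.rpow_neg_one, ← Real.rpow_add hzp]; congr 1; ring
    linarith
  · have : f * ‖z‖ ^ (-((N : ℝ) - 2)) ≤ f ^ (N - 1) := by
      have e : ‖z‖ ^ (-((N : ℝ) - 2)) = (‖z‖⁻¹) ^ (N - 2) := by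
        rw [← Real.rpow_natCast, Real.inv_rpow hzp.le, ← Real.rpow_neg hzp.le, Nat.cast_sub (by omega)]
        push_cast; rfl
      rw [e]
      calc _ ≤ f * f ^ (N - 2) := by gcongr
        _ = f ^ (N - 1) := by rw [← pow_succ']; congr 1; omega
    linarith

lemma sup_pow (hN : 3 ≤ N) (h0 : 0 < R₀) (h1 : R₀ < R₁) : ∃ C : ℝ, 0 ≤ C ∧ ∀ f u : E N → ℝ,
    ContinuousOn f (cA N R₀ R₁) → (∀ x ∈ cA N R₀ R₁, 0 ≤ f x) → Sol N R₀ R₁ 1 f u →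
    ∀ x ∈ cA N R₀ R₁, u x ≤ C * (1 + ∫ y in annulus N R₀ R₁, f y ^ (N - 1)) := by
  have hN' : (3 : ℝ) ≤ N := by exact_mod_cast hN
  set K := (∫ z in Metric.ball (0 : E N) 1, ‖z‖ ^ (-((N : ℝ) - 1))) + volume.real (Metric.ball (0 : E N) R₁) with hK
  have hK0 : 0 ≤ K := add_nonneg (integral_nonneg fun x => by positivity) measureReal_nonneg
  have hcN := cN_pos hN
  refine ⟨(cN N)⁻¹ * (K + 1), by positivity, ?_⟩
  intro f u hf hn hu x hx
  obtain ⟨M, hM⟩ := (isCompact_cA N R₀ R₁).exists_bound_of_continuousOn hf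
  have hfa : ContinuousOn f (annulus N R₀ R₁) := hf.mono (ann_sub_cA _ _ _)
  set g := (annulus N R₀ R₁).indicator f with hg
  have hg0 : ∀ y, 0 ≤ g y := fun y => indicator_nonneg (fun y hy => hn y (ann_sub_cA _ _ _ hy)) y
  have hM0 : 0 ≤ M := (norm_nonneg _).trans (hM x hx)
  have hD : Dens N g M R₁ := by
    refine ⟨measurable_ind hfa, hM0, ?_, ?_⟩
    · intro y
      by_cases hy : y ∈ annulus N R₀ R₁
      · rw [hg, indicator_of_mem hy]; exact hM y (ann_sub_cA _ _ _ hy)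
      · rw [hg, indicator_of_notMem hy]; simpa
    · intro y hy
      rw [hg, indicator_of_notMem]
      intro h; exact absurd h.2 (not_lt.2 hy)
  set Z : E N → ℝ := fun x => (cN N)⁻¹ * NP N g x with hZ
  have hZd : ∀ x, HasFDerivAt Z (innerSL ℝ ((cN N)⁻¹ • dNP N g x)) x := by
    intro x
    refine ((hD.hasFDerivAt_NP hN x).const_mul _).congr_fderiv ?_
    ext v; simp
  have hZc : Continuous Z := continuous_iff_continuousAt.2 fun x => (hZd x).continuousAt
  have hZg : ∀ x, gradient Z x = (cN N)⁻¹ • dNP N g x := fun x => grad_of_hasFDerivAt (hZd x)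
  have hcd : Continuous fun x => (cN N)⁻¹ • dNP N g x := by
    have hk := hD.continuous_dNP hN
    fun_prop
  have hZw : WS (annulus N R₀ R₁) Z f := by
    refine ⟨contDiffOn_one_of (isOpen_annulus _ _ _) (fun x _ => hZd x)
      hcd.continuousOn, hfa, ?_⟩
    intro φ hφ
    simp only [hZg, real_inner_smul_left]
    rw [integral_const_mul, hD.weak hN hφ.c1 hφ.cs, ← mul_assoc, inv_mul_cancel₀ hcN.ne', one_mul]
    congr 1; ext y
    by_cases hy : y ∈ annulus N R₀ R₁
    · rw [hg, indicator_of_mem hy]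
    · rw [hφ.zero hy]; simp
  have hZ0 : ∀ x, 0 ≤ Z x := by
    intro x
    refine mul_nonneg (inv_nonneg.2 hcN.le) (integral_nonneg fun y => ?_)
    exact mul_nonneg (hg0 y) (Gam_nonneg N le_rfl _)
  have hun := hu.nonneg hN h0 h1 zero_le_one (fun x hx => hn x (ann_sub_cA _ _ _ hx))
  have hcmp := (hZw.sub (isOpen_annulus _ _ _) hu.ws).MP hN (isOpen_annulus _ _ _) (bdd_annulus _ _ _)
    (hZc.continuousOn.sub (by rw [closure_annulus h0 h1]; exact hu.cont h0))
    (fun y hy => by rw [hu.bd y (frontier_annulus h0 h1 hy)]; simpa using hZ0 y) (s := 0) le_rfl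
    (fun y hy => by have := hun y (ann_sub_cA _ _ _ hy); simpa using this) x
    (by rw [closure_annulus h0 h1]; exact hx)
  have hle : NP N g x ≤ K + ∫ y in annulus N R₀ R₁, f y ^ (N - 1) := by
    obtain ⟨k1, k2⟩ := kernel_shift hN (α := (N : ℝ) - 1) (by linarith) (by linarith) R₁ x
    have hsub : annulus N R₀ R₁ ⊆ Metric.ball 0 R₁ := fun y hy => by simpa using hy.2
    have i1 : IntegrableOn (fun y : E N => ‖x - y‖ ^ (-((N : ℝ) - 1))) (annulus N R₀ R₁) := k1.mono_set hsub
    have i2 : IntegrableOn (fun y : E N => f y ^ (N - 1)) (annulus N R₀ R₁) := intA (hf.pow _)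
    calc NP N g x = ∫ y in annulus N R₀ R₁, f y * Gam N 0 (x - y) := by
          rw [← integral_indicator (meas_annulus _ _ _)]
          show ∫ y, g y • Gam N 0 (x - y) = _
          congr 1; ext y
          by_cases hy : y ∈ annulus N R₀ R₁
          · rw [hg, indicator_of_mem hy, indicator_of_mem hy, smul_eq_mul]
          · rw [hg, indicator_of_notMem hy, indicator_of_notMem hy, zero_smul]
      _ ≤ ∫ y in annulus N R₀ R₁, (‖x - y‖ ^ (-((N : ℝ) - 1)) + f y ^ (N - 1)) := by
          refine integral_mono_of_nonneg ?_ (i1.add i2) ?_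
          · exact ae_restrict_of_forall_mem (meas_annulus _ _ _) fun y hy =>
              mul_nonneg (hn y (ann_sub_cA _ _ _ hy)) (Gam_nonneg N le_rfl _)
          · exact ae_restrict_of_forall_mem (meas_annulus _ _ _) fun y hy =>
              young_ker hN (hn y (ann_sub_cA _ _ _ hy))
      _ = (∫ y in annulus N R₀ R₁, ‖x - y‖ ^ (-((N : ℝ) - 1))) + ∫ y in annulus N R₀ R₁, f y ^ (N - 1) :=
          integral_add i1 i2
      _ ≤ _ := by
          gcongr
          refine le_trans ?_ k2
          exact setIntegral_mono_set k1 (ae_of_all _ fun y => by simp only [Pi.zero_apply]; positivity) hsub.eventuallyLE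
  have hI : 0 ≤ ∫ y in annulus N R₀ R₁, f y ^ (N - 1) :=
    setIntegral_nonneg (meas_annulus _ _ _) fun y hy => pow_nonneg (hn y (ann_sub_cA _ _ _ hy)) _
  have : u x ≤ Z x := by linarith
  refine this.trans ?_
  rw [hZ, mul_assoc]
  apply mul_le_mul_of_nonneg_left _ (inv_nonneg.2 hcN.le)
  nlinarith

lemma radial_ineq (hN : 3 ≤ N) (h0 : 0 < R₀) (h1 : R₀ < R₁) : ∃ C : ℝ, 0 < C ∧ ∀ w : E N → ℝ,
    ContinuousOn w (cA N R₀ R₁) → ContDiffOn ℝ 1 w (annulus N R₀ R₁) →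
    (∀ x, ‖x‖ = R₀ ∨ ‖x‖ = R₁ → w x = 0) →
    (∀ x ∈ annulus N R₀ R₁, ∀ y ∈ annulus N R₀ R₁, ‖x‖ = ‖y‖ → w x = w y) →
    IntegrableOn (fun x => ‖gradient w x‖ ^ 2) (annulus N R₀ R₁) → ∀ x ∈ annulus N R₀ R₁,
    w x ^ 2 ≤ C * ∫ y in annulus N R₀ R₁, ‖gradient w y‖ ^ 2 := by
  set A0 : ENNReal := ENNReal.ofReal (R₀ ^ (N - 1)) with hA0
  have hA0p : A0 ≠ 0 := by simp [hA0]; positivity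
  set m := (volume : Measure (E N)).toSphere univ with hm
  have : Nontrivial (E N) := by
    apply Module.nontrivial_of_finrank_pos (R := ℝ); simp; omega
  have hmp : m ≠ 0 := by rw [hm, Ne, Measure.measure_univ_eq_zero]; simp
  have hmt : m ≠ ⊤ := measure_ne_top _ _
  have hAm : A0 * m ≠ 0 := mul_ne_zero hA0p hmp
  have hAmt : A0 * m ≠ ⊤ := ENNReal.mul_ne_top ENNReal.ofReal_ne_top hmt
  set V := volume.real (annulus N R₀ R₁) with hV
  set B := ((A0 * m)⁻¹).toReal with hB
  refine ⟨B ^ 2 * V + 1, by positivity, ?_⟩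
  intro w hc hd hz hr hi x hx
  have hgm := meas_gA hd
  have hL1 : A0 * m * ‖w x‖ₑ ≤ ∫⁻ y, gA R₀ R₁ w y := by
    rw [polar hN hgm]
    calc A0 * m * ‖w x‖ₑ = ∫⁻ _ω : Metric.sphere (0 : E N) 1, (A0 * ‖w x‖ₑ) ∂((volume : Measure (E N)).toSphere) := by
          rw [lintegral_const]; ring
      _ ≤ _ := by
          refine lintegral_mono fun ω => ?_
          have hω : ‖(ω : E N)‖ = 1 := by simp
          have hxp : 0 < ‖x‖ := h0.trans hx.1
          have hn : ‖‖x‖ • (ω : E N)‖ = ‖x‖ := by rw [norm_smul, hω, mul_one, norm_norm]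
          have e : w x = w (‖x‖ • (ω : E N)) := hr x hx _ (mem_ann_of_norm hx hn) hn.symm
          have := ray h0 hc hd hz hω (r := ‖x‖) hx
          rw [e]
          refine (mul_le_mul' le_rfl this).trans ?_
          have hm' : Measurable fun s : ℝ => gA R₀ R₁ w (s • (ω : E N)) :=
            hgm.comp (by fun_prop : Measurable fun s : ℝ => s • (ω : E N))
          rw [← lintegral_const_mul _ hm']
          refine setLIntegral_mono' measurableSet_Ioi fun s hs => ?_
          have hs0 : 0 < s := hs
          by_cases hm : s • (ω : E N) ∈ annulus N R₀ R₁
          · have hsR : R₀ < s := by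
              have := hm.1; rwa [norm_smul, hω, mul_one, Real.norm_of_nonneg hs0.le] at this
            rw [hA0]; gcongr
          · rw [gA, indicator_of_notMem hm, mul_zero]; exact zero_le
  have hgc := continuousOn_grad (isOpen_annulus _ _ _) hd
  have hmeas : AEStronglyMeasurable (fun y => ‖gradient w y‖) (volume.restrict (annulus N R₀ R₁)) :=
    hgc.norm.aestronglyMeasurable (meas_annulus _ _ _)
  have h1i : IntegrableOn (fun _ : E N => (1:ℝ)) (annulus N R₀ R₁) := intA continuousOn_const
  have hgi : IntegrableOn (fun y => ‖gradient w y‖) (annulus N R₀ R₁) := by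
    have hi2 : IntegrableOn (fun y => 1 + ‖gradient w y‖ ^ 2) (annulus N R₀ R₁) := h1i.add hi
    refine Integrable.mono' hi2 hmeas (ae_of_all _ fun y => ?_)
    rw [norm_norm]; nlinarith [sq_nonneg (‖gradient w y‖ - 1), norm_nonneg (gradient w y)]
  set G1 := ∫ y in annulus N R₀ R₁, ‖gradient w y‖ with hG1
  set G2 := ∫ y in annulus N R₀ R₁, ‖gradient w y‖ ^ 2 with hG2
  have hG10 : 0 ≤ G1 := integral_nonneg fun y => norm_nonneg _
  have hG20 : 0 ≤ G2 := integral_nonneg fun y => by simp only [Pi.zero_apply]; positivity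
  have hcs : G1 ^ 2 ≤ V * G2 := by
    have key : ∀ t : ℝ, 0 ≤ V * (t * t) + (-2 * G1) * t + G2 := by
      intro t
      have j2 : IntegrableOn (fun y => (-2 * t) * ‖gradient w y‖) (annulus N R₀ R₁) := hgi.const_mul _
      have j3 : IntegrableOn (fun _ : E N => (t * t) * (1:ℝ)) (annulus N R₀ R₁) := h1i.const_mul _
      have j12 : IntegrableOn (fun y => ‖gradient w y‖ ^ 2 + (-2 * t) * ‖gradient w y‖) (annulus N R₀ R₁) := hi.add j2
      have : 0 ≤ ∫ y in annulus N R₀ R₁, (‖gradient w y‖ ^ 2 + (-2 * t) * ‖gradient w y‖ + (t * t) * (1:ℝ)) := by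
        refine integral_nonneg fun y => ?_
        simp only [Pi.zero_apply]
        nlinarith [sq_nonneg (‖gradient w y‖ - t)]
      rw [integral_add j12 j3, integral_add hi j2, integral_const_mul, integral_const_mul] at this
      rw [setIntegral_const, smul_eq_mul, mul_one, ← hG1, ← hG2, ← hV] at this
      linarith
    have := discrim_le_zero key
    rw [discrim] at this
    nlinarith
  have hgA : ∫⁻ y, gA R₀ R₁ w y = ENNReal.ofReal G1 := by
    rw [hG1, ofReal_integral_eq_lintegral_ofReal hgi (ae_of_all _ fun y => norm_nonneg _),
      ← lintegral_indicator (meas_annulus _ _ _), gA]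
    congr 1; ext y
    by_cases hy : y ∈ annulus N R₀ R₁
    · rw [indicator_of_mem hy, indicator_of_mem hy, ofReal_norm]
    · rw [indicator_of_notMem hy, indicator_of_notMem hy]
  rw [hgA] at hL1
  have h2 : ‖w x‖ₑ ≤ (A0 * m)⁻¹ * ENNReal.ofReal G1 := by
    calc ‖w x‖ₑ = (A0 * m)⁻¹ * (A0 * m * ‖w x‖ₑ) := by
          rw [← mul_assoc, ENNReal.inv_mul_cancel hAm hAmt, one_mul]
      _ ≤ _ := mul_le_mul' le_rfl hL1
  have h3 : |w x| ≤ B * G1 := by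
    rw [← ENNReal.ofReal_toReal (ENNReal.inv_ne_top.2 hAm), ← hB, ← ENNReal.ofReal_mul ENNReal.toReal_nonneg,
      ← ofReal_norm, ENNReal.ofReal_le_ofReal_iff (by positivity)] at h2
    exact h2
  calc w x ^ 2 = |w x| ^ 2 := (sq_abs _).symm
    _ ≤ (B * G1) ^ 2 := by gcongr
    _ = B ^ 2 * G1 ^ 2 := by ring
    _ ≤ B ^ 2 * (V * G2) := by gcongr
    _ ≤ _ := by nlinarith

end
end NR

open MeasureTheory Real Set
namespace NR
open Filter Topology

section
variable {N : ℕ} {R₀ R₁ : ℝ}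

lemma slab_vol (hN : 3 ≤ N) {t : ℝ} (ht : 0 ≤ t) :
    volume {x : E N | ‖x‖ ≤ 2 ∧ |lastCoord x| < 2 * t} ≤ ENNReal.ofReal (4 ^ N * t) := by
  have hN0 : N - 1 < N := by omega
  set i0 : Fin N := ⟨N - 1, hN0⟩ with hi0
  set b : Fin N → ℝ := fun i => if i = i0 then 2 * t else 2 with hb
  have hsub : {x : E N | ‖x‖ ≤ 2 ∧ |lastCoord x| < 2 * t} ⊆
      (WithLp.ofLp : E N → (Fin N → ℝ)) ⁻¹' (Icc (fun i => - b i) b) := by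
    intro x hx
    have key : ∀ i, |x i| ≤ b i := by
      intro i
      by_cases h : i = i0
      · have := hx.2
        rw [lastCoord_coe hN] at this
        rw [h, hb]; simp only [if_true]; exact this.le
      · rw [hb]; simp only [if_neg h]
        have := EuclideanSpace.norm_eq x
        have h2 := PiLp.norm_apply_le x i
        rw [Real.norm_eq_abs] at h2
        exact h2.trans hx.1
    exact ⟨fun i => (abs_le.1 (key i)).1, fun i => (abs_le.1 (key i)).2⟩
  refine (measure_mono hsub).trans ?_
  have hmp := (PiLp.volume_preserving_ofLp (Fin N))
  rw [hmp.measure_preimage measurableSet_Icc.nullMeasurableSet, Real.volume_Icc_pi]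
  rw [← ENNReal.ofReal_prod_of_nonneg]
  · apply ENNReal.ofReal_le_ofReal
    have : ∀ i, b i - -b i = 4 * (if i = i0 then t else 1) := by
      intro i; rw [hb]; by_cases h : i = i0 <;> simp [h] <;> ring
    simp only [this]
    rw [Finset.prod_mul_distrib, Finset.prod_ite_eq']
    simp
  · intro i _
    have : 0 ≤ b i := by rw [hb]; by_cases h : i = i0 <;> simp [h, ht]
    linarith

lemma sph_vol (hN : 3 ≤ N) {t : ℝ} (ht : 0 ≤ t) :
    (volume : Measure (E N)).toSphere {ω | |lastCoord (ω : E N)| < t} ≤ ENNReal.ofReal (4 ^ N * t) := by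
  refine le_trans ?_ (slab_vol hN ht)
  have hcl := continuous_lastCoord hN
  set S : Set (E N) := {x : E N | ‖x‖ ≤ 2 ∧ |lastCoord x| < 2 * t} with hS
  have hSm : MeasurableSet S := (measurableSet_le measurable_norm measurable_const).inter
    (measurableSet_lt hcl.abs.measurable measurable_const)
  have hTm : MeasurableSet {ω : Metric.sphere (0 : E N) 1 | |lastCoord (ω : E N)| < t} :=
    measurableSet_lt (hcl.comp continuous_subtype_val).abs.measurable measurable_const
  rw [← lintegral_indicator_one hSm, polar hN (measurable_one.indicator hSm),
    ← lintegral_indicator_one hTm]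
  refine lintegral_mono fun ω => ?_
  by_cases hω : |lastCoord (ω : E N)| < t
  · have h1 : ‖(ω : E N)‖ = 1 := by simp
    rw [indicator_of_mem (by exact hω)]
    calc (1 : Metric.sphere (0 : E N) 1 → ENNReal) ω = ∫⁻ r in Icc (1:ℝ) 2, 1 := by
          simp; norm_num
      _ ≤ ∫⁻ r in Icc (1:ℝ) 2, ENNReal.ofReal (r ^ (N - 1)) * S.indicator 1 (r • (ω : E N)) := by
          refine setLIntegral_mono' measurableSet_Icc fun r hr => ?_
          have hm : r • (ω : E N) ∈ S := by
            have hr0 : 0 < r := by linarith [hr.1]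
            refine ⟨?_, ?_⟩
            · rw [norm_smul, h1, mul_one, Real.norm_of_nonneg hr0.le]; exact hr.2
            · rw [lastCoord_eq hN, inner_smul_right, ← lastCoord_eq, abs_mul, abs_of_pos hr0]
              have := abs_nonneg (lastCoord (ω : E N))
              nlinarith [hr.2]
          rw [indicator_of_mem hm]
          simp only [Pi.one_apply, mul_one]
          rw [← ENNReal.ofReal_one]
          exact ENNReal.ofReal_le_ofReal (one_le_pow₀ hr.1)
      _ ≤ _ := lintegral_mono_set fun r hr => by
          have : (1:ℝ) ≤ r := hr.1
          exact lt_of_lt_of_le one_pos this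
  · rw [indicator_of_notMem (by exact hω)]; exact zero_le

lemma tube_vol (hN : 3 ≤ N) {a : ℝ} (ha : 0 < a) : ∃ C : ℝ, 0 < C ∧ ∀ s : ℝ, 0 < s → s ≤ a ^ 2 / 4 →
    volume {x : E N | |‖x‖ ^ 2 - a ^ 2| < s ∧ |lastCoord x| < s} ≤ ENNReal.ofReal (C * s ^ 2) := by
  refine ⟨(2 * a) ^ (N - 1) * (2 / a) * (4 ^ N * (2 / a)), by positivity, ?_⟩
  intro s hs hsa
  have hcl := continuous_lastCoord hN
  set S : Set (E N) := {x : E N | |‖x‖ ^ 2 - a ^ 2| < s ∧ |lastCoord x| < s} with hS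
  have hSm : MeasurableSet S := (measurableSet_lt
    (by fun_prop : Measurable fun x : E N => |‖x‖ ^ 2 - a ^ 2|) measurable_const).inter
    (measurableSet_lt hcl.abs.measurable measurable_const)
  have hTm : MeasurableSet {ω : Metric.sphere (0 : E N) 1 | |lastCoord (ω : E N)| < 2 / a * s} :=
    measurableSet_lt (hcl.comp continuous_subtype_val).abs.measurable measurable_const
  rw [← lintegral_indicator_one hSm, polar hN (measurable_one.indicator hSm)]
  calc _ ≤ ∫⁻ ω, {ω : Metric.sphere (0 : E N) 1 | |lastCoord (ω : E N)| < 2 / a * s}.indicator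
          (fun _ => ENNReal.ofReal ((2 * a) ^ (N - 1) * (2 / a) * s)) ω ∂((volume : Measure (E N)).toSphere) := ?_
    _ ≤ ENNReal.ofReal ((2 * a) ^ (N - 1) * (2 / a) * s) * ENNReal.ofReal (4 ^ N * (2 / a * s)) := by
        rw [lintegral_indicator_const hTm]
        exact mul_le_mul' le_rfl (sph_vol hN (by positivity))
    _ = _ := by
        rw [← ENNReal.ofReal_mul (by positivity)]; congr 1; ring
  refine lintegral_mono fun ω => ?_
  have h1 : ‖(ω : E N)‖ = 1 := by simp
  have fact : ∀ r : ℝ, 0 < r → r • (ω : E N) ∈ S → |r - a| < s / a ∧ r < 2 * a ∧ |lastCoord (ω : E N)| < 2 / a * s := by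
    intro r hr hm
    obtain ⟨m1, m2⟩ := hm
    rw [norm_smul, h1, mul_one, Real.norm_of_nonneg hr.le] at m1
    rw [lastCoord_eq hN, inner_smul_right, ← lastCoord_eq, abs_mul, abs_of_pos hr] at m2
    obtain ⟨m3, m4⟩ := abs_lt.1 m1
    have hr2 : a / 2 < r := by
      by_contra h; push Not at h
      nlinarith
    have hr3 : r < 2 * a := by
      by_contra h; push Not at h
      nlinarith
    refine ⟨?_, hr3, ?_⟩
    · rw [lt_div_iff₀ ha]
      have : |r - a| * (r + a) < s := by
        have e : r ^ 2 - a ^ 2 = (r - a) * (r + a) := by ring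
        rw [e, abs_mul, abs_of_pos (by positivity : 0 < r + a)] at m1
        exact m1
      nlinarith [abs_nonneg (r - a)]
    · rw [div_mul_eq_mul_div, lt_div_iff₀ ha]
      nlinarith [abs_nonneg (lastCoord (ω : E N))]
  by_cases hω : |lastCoord (ω : E N)| < 2 / a * s
  · rw [indicator_of_mem (by exact hω)]
    calc _ ≤ ∫⁻ r in Ioi (0:ℝ), (Icc (a - s / a) (a + s / a)).indicator (fun _ => ENNReal.ofReal ((2 * a) ^ (N - 1))) r := by
          refine setLIntegral_mono' measurableSet_Ioi fun r hr => ?_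
          by_cases hm : r • (ω : E N) ∈ S
          · obtain ⟨f1, f2, -⟩ := fact r hr hm
            rw [indicator_of_mem hm, indicator_of_mem]
            · simp only [Pi.one_apply, mul_one]
              have : (0:ℝ) < r := hr
              gcongr
            · obtain ⟨f3, f4⟩ := abs_lt.1 f1
              constructor <;> linarith
          · rw [indicator_of_notMem hm, mul_zero]; exact zero_le
      _ ≤ ∫⁻ r, (Icc (a - s / a) (a + s / a)).indicator (fun _ => ENNReal.ofReal ((2 * a) ^ (N - 1))) r :=
          setLIntegral_le_lintegral _ _
      _ = _ := by
          rw [lintegral_indicator_const measurableSet_Icc, Real.volume_Icc, ← ENNReal.ofReal_mul (by positivity)]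
          congr 1; ring
  · rw [indicator_of_notMem (by exact hω)]
    have : ∫⁻ r in Ioi (0:ℝ), ENNReal.ofReal (r ^ (N - 1)) * S.indicator 1 (r • (ω : E N)) = ∫⁻ r in Ioi (0:ℝ), 0 := by
      refine setLIntegral_congr_fun measurableSet_Ioi fun r hr => ?_
      have hm : r • (ω : E N) ∉ S := fun hm => hω (fact r hr hm).2.2
      simp only [indicator_of_notMem hm, mul_zero]
    rw [this]; simp

end
end NR

open MeasureTheory Real Set
namespace NR
open Filter Topology

section
variable {N : ℕ} {R₀ R₁ : ℝ}

lemma dyadic {δ q : ℝ} (hδ : 0 < δ) (hq : 0 ≤ q) (hqδ : q < δ) (n : ℕ) :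
    1 / (q + δ / 4 ^ n) ≤ ∑ k ∈ Finset.range (n + 1), (if q < δ / 4 ^ k then 4 ^ (k + 1) / δ else 0) := by
  have nn : ∀ k : ℕ, (0:ℝ) ≤ (if q < δ / 4 ^ k then 4 ^ (k + 1) / δ else 0) := by
    intro k; split_ifs <;> positivity
  have key : ∀ n : ℕ, q < δ / 4 ^ n ∨ (0 < q ∧
      1 / q ≤ ∑ k ∈ Finset.range n, (if q < δ / 4 ^ k then 4 ^ (k + 1) / δ else 0)) := by
    intro n
    induction n with
    | zero => left; simpa using hqδ
    | succ n ih =>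
      by_cases h : q < δ / 4 ^ (n + 1)
      · left; exact h
      · right
        rw [Finset.sum_range_succ]
        push Not at h
        have hp : 0 < δ / 4 ^ (n + 1) := by positivity
        refine ⟨hp.trans_le h, ?_⟩
        rcases ih with ih | ih
        · rw [if_pos ih]
          have : 1 / q ≤ 4 ^ (n + 1) / δ := by
            rw [← one_div_div δ]; exact one_div_le_one_div_of_le hp h
          have := Finset.sum_nonneg (s := Finset.range n) fun k _ => nn k
          linarith
        · have := nn n; linarith [ih.2]
  rw [Finset.sum_range_succ]
  have hp : 0 < δ / 4 ^ n := by positivity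
  rcases key n with h | h
  · rw [if_pos h]
    have h1 : 1 / (q + δ / 4 ^ n) ≤ 4 ^ n / δ := by
      have hle : δ / 4 ^ n ≤ q + δ / 4 ^ n := by linarith
      rw [← one_div_div δ]; exact one_div_le_one_div_of_le hp hle
    have h2 : (4:ℝ) ^ n / δ ≤ 4 ^ (n + 1) / δ := by
      gcongr <;> norm_num
    have := Finset.sum_nonneg (s := Finset.range n) fun k _ => nn k
    linarith
  · have h1 : 1 / (q + δ / 4 ^ n) ≤ 1 / q := one_div_le_one_div_of_le h.1 (by linarith)
    have := nn n; linarith [h.2]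

lemma psi_deriv {δ ε q : ℝ} (hε : 0 < ε) (hq : 0 ≤ q) :
    HasDerivAt (fun q => (max (log δ - log (q + ε) - 0) 0) ^ 2)
      (2 * max (log δ - log (q + ε)) 0 * (-(q + ε)⁻¹)) q := by
  have h1 : HasDerivAt (fun q => log δ - log (q + ε)) (-(q + ε)⁻¹) q := by
    have := (((hasDerivAt_id q).add_const ε).log (by simp; positivity)).const_sub (log δ)
    simpa [one_div] using this
  have hs := sqpos_c1 0
  have h2 : HasDerivAt (fun t : ℝ => (max (t - 0) 0) ^ 2) (2 * max (log δ - log (q + ε) - 0) 0) (log δ - log (q + ε)) := by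
    rw [← hs.2]
    exact (hs.1.differentiable one_ne_zero _).hasDerivAt
  have := h2.comp q h1
  have h3 : HasDerivAt (fun q => (max (log δ - log (q + ε) - 0) 0) ^ 2)
      (2 * max (log δ - log (q + ε) - 0) 0 * (-(q + ε)⁻¹)) q := this
  rwa [sub_zero] at h3

lemma psi_bounds {δ q : ℝ} (hδ : 0 < δ) (hq : 0 ≤ q) (n : ℕ) :
    let m := max (log δ - log (q + δ / 4 ^ n)) 0
    0 ≤ m ∧ m ≤ n * log 4 ∧ m ^ 2 ≤ 2 * δ * (1 / (q + δ / 4 ^ n)) ∧ (δ ≤ q → m = 0) := by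
  intro m
  have hε : 0 < δ / 4 ^ n := by positivity
  have hp : 0 < q + δ / 4 ^ n := by positivity
  have hl : log (δ / 4 ^ n) = log δ - n * log 4 := by
    rw [log_div hδ.ne' (by positivity), log_pow]
  have hl4 : 0 ≤ log 4 := log_nonneg (by norm_num)
  refine ⟨le_max_right _ _, max_le ?_ (by positivity), ?_, ?_⟩
  · have := log_le_log hε (by linarith : δ / 4 ^ n ≤ q + δ / 4 ^ n)
    linarith
  · have hrhs : 0 ≤ 2 * δ * (1 / (q + δ / 4 ^ n)) := by positivity
    rcases le_total (log δ - log (q + δ / 4 ^ n)) 0 with h | h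
    · simp only [m]; rw [max_eq_right h]; simpa using hrhs
    · simp only [m]; rw [max_eq_left h]
      have h2 := Real.quadratic_le_exp_of_nonneg h
      rw [exp_sub, exp_log hδ, exp_log hp] at h2
      have : 2 * δ * (1 / (q + δ / 4 ^ n)) = 2 * (δ / (q + δ / 4 ^ n)) := by ring
      rw [this]; nlinarith
  · intro h
    have := log_le_log hδ (by linarith : δ ≤ q + δ / 4 ^ n)
    exact max_eq_right (by linarith)

/-- the defining function of the concentrating tube -/
noncomputable def QQ (N : ℕ) (a : ℝ) (x : E N) : ℝ := (‖x‖ ^ 2 - a ^ 2) ^ 2 + (lastCoord x) ^ 2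

lemma QQ_deriv (hN : 3 ≤ N) (a : ℝ) (x : E N) :
    HasFDerivAt (QQ N a) (innerSL ℝ ((4 * (‖x‖ ^ 2 - a ^ 2)) • x + (2 * lastCoord x) • eL N hN)) x := by
  have e : (QQ N a) = fun x => (‖x‖ ^ 2 - a ^ 2) ^ 2 + (inner ℝ (eL N hN) x) ^ 2 := by
    ext x; rw [QQ, lastCoord_eq hN]
  rw [e, lastCoord_eq hN]
  have h1 := ((hasStrictFDerivAt_norm_sq x).hasFDerivAt.sub_const (a ^ 2)).pow 2
  have h2 := ((innerSL ℝ (eL N hN)).hasFDerivAt (x := x)).pow 2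
  refine (h1.add h2).congr_fderiv ?_
  ext v
  simp [inner_add_left, inner_smul_left]
  ring

lemma QQ_smooth (hN : 3 ≤ N) (a : ℝ) : ContDiff ℝ 1 (QQ N a) := by
  have e : (QQ N a) = fun x => (‖x‖ ^ 2 - a ^ 2) ^ 2 + (inner ℝ (eL N hN) x) ^ 2 := by
    ext x; rw [QQ, lastCoord_eq hN]
  rw [e]
  have h1 : ContDiff ℝ 1 fun x : E N => ‖x‖ ^ 2 := contDiff_norm_sq ℝ
  have h2 : ContDiff ℝ 1 fun x : E N => inner ℝ (eL N hN) x := contDiff_const.inner ℝ contDiff_id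
  exact ((h1.sub contDiff_const).pow 2).add (h2.pow 2)

set_option maxHeartbeats 1600000 in
lemma competitor (hN : 3 ≤ N) (h0 : 0 < R₀) (h1 : R₀ < R₁) (η : ℝ) (hη : 0 < η) : ∃ φ : E N → ℝ,
    Tst (annulus N R₀ R₁) φ ∧ (∀ x, 0 ≤ φ x) ∧ PC N R₀ R₁ φ ∧
    ∃ x₀ ∈ annulus N R₀ R₁, 0 < φ x₀ ∧ En N R₀ R₁ φ φ ≤ η * φ x₀ ^ 2 := by
  set a := (R₀ + R₁) / 2 with ha
  have ha0 : 0 < a := by rw [ha]; linarith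
  have haR0 : R₀ < a := by rw [ha]; linarith
  have haR1 : a < R₁ := by rw [ha]; linarith
  obtain ⟨C, hC, hvol⟩ := tube_vol hN ha0
  set d := min (a ^ 2 / 4) (min ((a ^ 2 - R₀ ^ 2) / 2) ((R₁ ^ 2 - a ^ 2) / 2)) with hd
  have q0 : 0 < a ^ 2 - R₀ ^ 2 := by nlinarith
  have q1 : 0 < R₁ ^ 2 - a ^ 2 := by nlinarith
  have hd0 : 0 < d := by positivity
  have hda : d ≤ a ^ 2 / 4 := min_le_left _ _
  have hdR0 : d ≤ (a ^ 2 - R₀ ^ 2) / 2 := (min_le_right _ _).trans (min_le_left _ _)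
  have hdR1 : d ≤ (R₁ ^ 2 - a ^ 2) / 2 := (min_le_right _ _).trans (min_le_right _ _)
  set δ := d ^ 2 with hδd
  have hδ : 0 < δ := by positivity
  have hQ0 : ∀ x, 0 ≤ QQ N a x := fun x => by unfold QQ; positivity
  have hin : ∀ x, QQ N a x ≤ δ → x ∈ annulus N R₀ R₁ := by
    intro x hx
    have h2 : (‖x‖ ^ 2 - a ^ 2) ^ 2 ≤ d ^ 2 := by
      unfold QQ at hx; nlinarith [sq_nonneg (lastCoord x)]
    obtain ⟨h3, h4⟩ := abs_le.1 (abs_le_of_sq_le_sq h2 hd0.le)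
    constructor
    · refine lt_of_pow_lt_pow_left₀ 2 (norm_nonneg _) ?_; linarith
    · refine lt_of_pow_lt_pow_left₀ 2 (by linarith) ?_; linarith
  set B := 4 * (32 * R₁ ^ 2 + 8) + 2 * δ with hB
  have hB0 : 0 < B := by positivity
  obtain ⟨n, hn⟩ := exists_nat_gt (B * (4 * C) * 2 / η + 1)
  have hn1 : (1:ℝ) < n := lt_of_le_of_lt (by simp; positivity) hn
  set ε := δ / 4 ^ n with hε
  have hε0 : 0 < ε := by positivity
  set L0 := n * log 4 with hL0
  have hl4 : 1 ≤ log 4 := by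
    rw [le_log_iff_exp_le (by norm_num)]
    linarith [exp_one_lt_three]
  have hL0n : n ≤ L0 := by rw [hL0]; nlinarith
  have hL0p : 0 < L0 := by linarith
  set φ : E N → ℝ := fun x => (max (log δ - log (QQ N a x + ε) - 0) 0) ^ 2 with hφ
  have hφ1 : ContDiff ℝ 1 φ := by
    have h2 : ContDiff ℝ 1 fun x => log δ - log (QQ N a x + ε) :=
      contDiff_const.sub (((QQ_smooth hN a).add contDiff_const).log fun x => by have := hQ0 x; positivity)
    exact (sqpos_c1 0).1.comp h2
  have hφ0 : ∀ x, δ ≤ QQ N a x → φ x = 0 := by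
    intro x hx
    have := (psi_bounds hδ (hQ0 x) n).2.2.2 hx
    simp only [hφ, sub_zero]; rw [this]; norm_num
  have hQc : Continuous (QQ N a) := (QQ_smooth hN a).continuous
  have hcl : IsClosed {x | QQ N a x ≤ δ} := isClosed_le hQc continuous_const
  have hts : tsupport φ ⊆ {x | QQ N a x ≤ δ} := by
    refine closure_minimal ?_ hcl
    intro x hx
    by_contra hc
    exact hx (hφ0 x (not_le.1 hc).le)
  have hT : Tst (annulus N R₀ R₁) φ := by
    refine ⟨hφ1, ?_, hts.trans fun x hx => hin x hx⟩
    exact IsCompact.of_isClosed_subset (isCompact_cA N R₀ R₁) (isClosed_tsupport _)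
      (hts.trans fun x hx => ann_sub_cA _ _ _ (hin x hx))
  have hgr : ∀ x, gradient φ x = (2 * max (log δ - log (QQ N a x + ε)) 0 * (-(QQ N a x + ε)⁻¹)) •
      ((4 * (‖x‖ ^ 2 - a ^ 2)) • x + (2 * lastCoord x) • eL N hN) := by
    intro x
    apply grad_of_hasFDerivAt
    have := (psi_deriv (δ := δ) hε0 (hQ0 x)).comp_hasFDerivAt x (QQ_deriv hN a x)
    refine this.congr_fderiv ?_
    ext v; simp
  have hgQ : ∀ x, ‖x‖ ≤ R₁ → ‖(4 * (‖x‖ ^ 2 - a ^ 2)) • x + (2 * lastCoord x) • eL N hN‖ ^ 2 ≤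
      (32 * R₁ ^ 2 + 8) * QQ N a x := by
    intro x hx
    have t1 := norm_add_le ((4 * (‖x‖ ^ 2 - a ^ 2)) • x) ((2 * lastCoord x) • eL N hN)
    rw [norm_smul, norm_smul, norm_eL hN, mul_one, Real.norm_eq_abs, Real.norm_eq_abs] at t1
    set p := |4 * (‖x‖ ^ 2 - a ^ 2)| with hp
    set q := |2 * lastCoord x| with hq
    have e1 : p ^ 2 = 16 * (‖x‖ ^ 2 - a ^ 2) ^ 2 := by rw [hp, sq_abs]; ring
    have e2 : q ^ 2 = 4 * (lastCoord x) ^ 2 := by rw [hq, sq_abs]; ring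
    calc _ ≤ (p * ‖x‖ + q) ^ 2 := by gcongr
      _ ≤ 2 * (p ^ 2 * ‖x‖ ^ 2) + 2 * q ^ 2 := by nlinarith [sq_nonneg (p * ‖x‖ - q)]
      _ ≤ 2 * (p ^ 2 * R₁ ^ 2) + 2 * q ^ 2 := by gcongr
      _ ≤ _ := by
        rw [e1, e2, QQ]
        nlinarith [sq_nonneg (‖x‖ ^ 2 - a ^ 2), mul_nonneg (sq_nonneg R₁) (sq_nonneg (lastCoord x))]
  refine ⟨φ, hT, fun x => by positivity, ?_, a • e1 N hN, ?_, ?_, ?_⟩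
  · intro x hx x' hx' hn hl
    have hQQ : QQ N a x ≤ QQ N a x' := by
      unfold QQ; rw [hn]
      have := sq_le_sq' (by linarith [abs_nonneg (lastCoord x), abs_nonneg (lastCoord x')]) hl
      rw [sq_abs, sq_abs] at this; linarith
    have := log_le_log (by have := hQ0 x; positivity : 0 < QQ N a x + ε) (by linarith : QQ N a x + ε ≤ QQ N a x' + ε)
    simp only [hφ]
    gcongr
  · have : ‖a • e1 N hN‖ = a := by rw [norm_smul, norm_e1, mul_one, Real.norm_of_nonneg ha0.le]
    exact ⟨by rw [this]; exact haR0, by rw [this]; exact haR1⟩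
  all_goals
    have hx0 : φ (a • e1 N hN) = L0 ^ 2 := by
      have hn : ‖a • e1 N hN‖ = a := by rw [norm_smul, norm_e1, mul_one, Real.norm_of_nonneg ha0.le]
      have hq : QQ N a (a • e1 N hN) = 0 := by
        rw [QQ, hn, lastCoord_eq hN, inner_smul_right, eL_e1]; ring
      simp only [hφ, hq, sub_zero, zero_add]
      have hl : log ((4:ℝ) ^ n) = n * log 4 := by rw [log_pow]
      rw [hε, log_div hδ.ne' (by positivity), hl, sub_sub_cancel, ← hL0, max_eq_left hL0p.le]
  · rw [hx0]; positivity
  rw [hx0]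
  have hAO : ContDiffOn ℝ 1 φ (AO N R₀) := hφ1.contDiffOn
  have hme : ∀ k : ℕ, MeasurableSet {x | QQ N a x < δ / 4 ^ k} := fun k =>
    measurableSet_lt hQc.measurable measurable_const
  have hii : ∀ k : ℕ, IntegrableOn (fun x => if QQ N a x < δ / 4 ^ k then (4:ℝ) ^ (k + 1) / δ else 0) (annulus N R₀ R₁) := by
    intro k
    have hc : IntegrableOn (fun _ : E N => (4:ℝ) ^ (k + 1) / δ) (annulus N R₀ R₁) := intA continuousOn_const
    exact (hc.integrable.indicator (hme k)).congr (ae_of_all _ fun x => by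
      simp only [indicator, mem_ofPred_eq])
  have hpt : ∀ x ∈ annulus N R₀ R₁, inner ℝ (gradient φ x) (gradient φ x) + φ x * φ x ≤ (B * L0 ^ 2) *
      ∑ k ∈ Finset.range (n + 1), (if QQ N a x < δ / 4 ^ k then (4:ℝ) ^ (k + 1) / δ else 0) := by
    intro x hx
    obtain ⟨b1, b2, b3, b4⟩ := psi_bounds hδ (hQ0 x) n
    rw [real_inner_self_eq_norm_sq, hgr x, norm_smul]
    have hφx : φ x = (max (log δ - log (QQ N a x + ε)) 0) ^ 2 := by simp only [hφ, sub_zero]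
    rw [hφx]
    rw [← hε] at b1 b2 b3 b4
    set m := max (log δ - log (QQ N a x + ε)) 0 with hm
    by_cases hq : QQ N a x < δ
    · have hdy := dyadic hδ (hQ0 x) hq n
      rw [← hε] at hdy
      have hg := hgQ x hx.2.le
      have hqp : 0 < QQ N a x + ε := by have := hQ0 x; positivity
      set q := QQ N a x with hqd
      have hq0 : 0 ≤ q := hQ0 x
      set W := ‖(4 * (‖x‖ ^ 2 - a ^ 2)) • x + (2 * lastCoord x) • eL N hN‖ with hW
      have hm2 : m ^ 2 ≤ L0 ^ 2 := by gcongr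
      have s1 : (‖2 * m * -(q + ε)⁻¹‖ * W) ^ 2 ≤ 4 * (32 * R₁ ^ 2 + 8) * L0 ^ 2 * (1 / (q + ε)) := by
        rw [mul_pow, Real.norm_eq_abs, sq_abs]
        calc (2 * m * -(q + ε)⁻¹) ^ 2 * W ^ 2 = 4 * m ^ 2 * ((q + ε)⁻¹) ^ 2 * W ^ 2 := by ring
          _ ≤ 4 * L0 ^ 2 * ((q + ε)⁻¹) ^ 2 * ((32 * R₁ ^ 2 + 8) * (q + ε)) := by
              gcongr
              exact hg.trans (by gcongr; linarith)
          _ = _ := by field_simp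
      have s2 : m ^ 2 * m ^ 2 ≤ L0 ^ 2 * (2 * δ * (1 / (q + ε))) := by gcongr
      calc _ ≤ 4 * (32 * R₁ ^ 2 + 8) * L0 ^ 2 * (1 / (q + ε)) + L0 ^ 2 * (2 * δ * (1 / (q + ε))) := add_le_add s1 s2
        _ = B * L0 ^ 2 * (1 / (q + ε)) := by rw [hB]; ring
        _ ≤ _ := by gcongr
    · rw [b4 (not_lt.1 hq)]
      have : 0 ≤ ∑ k ∈ Finset.range (n + 1), (if QQ N a x < δ / 4 ^ k then (4:ℝ) ^ (k + 1) / δ else 0) :=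
        Finset.sum_nonneg fun k _ => by split_ifs <;> positivity
      simp; positivity
  have hone : ∀ k : ℕ, ∫ x in annulus N R₀ R₁, (if QQ N a x < δ / 4 ^ k then (4:ℝ) ^ (k + 1) / δ else 0) ≤ 4 * C := by
    intro k
    have e : (fun x => if QQ N a x < δ / 4 ^ k then (4:ℝ) ^ (k + 1) / δ else 0) =
        {x | QQ N a x < δ / 4 ^ k}.indicator fun _ => (4:ℝ) ^ (k + 1) / δ := by
      ext x; simp only [indicator, mem_ofPred_eq]
    have hs0 : 0 < d / 2 ^ k := by positivity
    have hsd : d / 2 ^ k ≤ d := div_le_self hd0.le (one_le_pow₀ (by norm_num))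
    have hs2 : (d / 2 ^ k) ^ 2 = δ / 4 ^ k := by
      rw [div_pow, hδd, ← pow_mul, mul_comm k 2, pow_mul]; norm_num
    have hv := hvol (d / 2 ^ k) hs0 (hsd.trans hda)
    have hsub : {x | QQ N a x < δ / 4 ^ k} ∩ annulus N R₀ R₁ ⊆
        {x : E N | |‖x‖ ^ 2 - a ^ 2| < d / 2 ^ k ∧ |lastCoord x| < d / 2 ^ k} := by
      rintro x ⟨hx, -⟩
      have hx : QQ N a x < δ / 4 ^ k := hx
      rw [← hs2, QQ] at hx
      exact ⟨abs_lt_of_sq_lt_sq (by nlinarith [sq_nonneg (lastCoord x)]) hs0.le,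
        abs_lt_of_sq_lt_sq (by nlinarith [sq_nonneg (‖x‖ ^ 2 - a ^ 2)]) hs0.le⟩
    have hv2 := (measure_mono hsub).trans hv
    rw [e, integral_indicator_const _ (hme k), smul_eq_mul, measureReal_restrict_apply (hme k)]
    have hv3 : volume.real ({x | QQ N a x < δ / 4 ^ k} ∩ annulus N R₀ R₁) ≤ C * (d / 2 ^ k) ^ 2 :=
      ENNReal.toReal_le_of_le_ofReal (by positivity) hv2
    rw [hs2] at hv3
    calc _ ≤ C * (δ / 4 ^ k) * (4 ^ (k + 1) / δ) := by gcongr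
      _ = 4 * C := by rw [pow_succ]; field_simp
  have hsum : En N R₀ R₁ φ φ ≤ (B * L0 ^ 2) * ((n + 1) * (4 * C)) := by
    calc En N R₀ R₁ φ φ ≤ ∫ x in annulus N R₀ R₁, (B * L0 ^ 2) *
          ∑ k ∈ Finset.range (n + 1), (if QQ N a x < δ / 4 ^ k then (4:ℝ) ^ (k + 1) / δ else 0) := by
          refine setIntegral_mono_on (En_int h0 hAO hAO) ?_ (meas_annulus _ _ _) hpt
          refine Integrable.const_mul ?_ _
          exact integrable_finsetSum _ fun k _ => hii k
      _ = (B * L0 ^ 2) * ∑ k ∈ Finset.range (n + 1),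
            ∫ x in annulus N R₀ R₁, (if QQ N a x < δ / 4 ^ k then (4:ℝ) ^ (k + 1) / δ else 0) := by
          rw [integral_const_mul, integral_finsetSum _ fun k _ => hii k]
      _ ≤ (B * L0 ^ 2) * ∑ k ∈ Finset.range (n + 1), (4 * C) := by
          gcongr with k _
          exact hone k
      _ = _ := by simp
  refine hsum.trans ?_
  have hkey : B * ((n + 1) * (4 * C)) ≤ η * L0 ^ 2 := by
    have h2 : B * (4 * C) * 2 < η * n := by
      have : B * (4 * C) * 2 / η < n := by linarith
      rw [div_lt_iff₀ hη] at this; linarith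
    have h3 : (n:ℝ) ^ 2 ≤ L0 ^ 2 := by gcongr
    have h4 : 0 < B * (4 * C) := by positivity
    calc B * ((n + 1) * (4 * C)) ≤ B * (4 * C) * 2 * n := by nlinarith
      _ ≤ η * n * n := by gcongr
      _ = η * n ^ 2 := by ring
      _ ≤ _ := by gcongr
  calc B * L0 ^ 2 * ((n + 1) * (4 * C)) = L0 ^ 2 * (B * ((n + 1) * (4 * C))) := by ring
    _ ≤ L0 ^ 2 * (η * L0 ^ 2) := by gcongr
    _ = _ := by ring

end
end NR

open MeasureTheory Real Set
namespace NR
open Filter Topology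

section
variable {N : ℕ} {R₀ R₁ : ℝ}

lemma rpow_two_div {b p : ℝ} (hb : 0 ≤ b) (hp : 0 < p) : (b ^ p) ^ (2 / p) = b ^ 2 := by
  rw [← rpow_mul hb, mul_div_cancel₀ _ hp.ne']
  exact_mod_cast rpow_natCast b 2

lemma gap (hN : 3 ≤ N) (h0 : 0 < R₀) (h1 : R₀ < R₁) : ∃ κ : ℝ, 0 < κ ∧ ∃ ps : ℝ, 2 < ps ∧ ∃ φ : E N → ℝ,
    Tst (annulus N R₀ R₁) φ ∧ (∀ x, 0 ≤ φ x) ∧ PC N R₀ R₁ φ ∧ (∃ x₀ ∈ annulus N R₀ R₁, 0 < φ x₀) ∧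
    ∀ p, ps < p → En N R₀ R₁ φ φ < κ * (∫ x in annulus N R₀ R₁, φ x ^ p) ^ (2 / p) ∧
    ∀ w : E N → ℝ,
    ContinuousOn w (cA N R₀ R₁) → ContDiffOn ℝ 1 w (annulus N R₀ R₁) →
    (∀ x, ‖x‖ = R₀ ∨ ‖x‖ = R₁ → w x = 0) →
    (∀ x ∈ annulus N R₀ R₁, ∀ y ∈ annulus N R₀ R₁, ‖x‖ = ‖y‖ → w x = w y) →
    IntegrableOn (fun x => ‖gradient w x‖ ^ 2) (annulus N R₀ R₁) →
    κ * (∫ x in annulus N R₀ R₁, |w x| ^ p) ^ (2 / p) ≤ ∫ y in annulus N R₀ R₁, ‖gradient w y‖ ^ 2 := by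
  obtain ⟨C, hC, hrad⟩ := radial_ineq hN h0 h1
  set V := volume.real (annulus N R₀ R₁) with hV
  have hV0 : 0 ≤ V := measureReal_nonneg
  set M := max 1 V with hM
  have hM1 : 1 ≤ M := le_max_left _ _
  set κ := (C * M)⁻¹ with hκ
  have hκ0 : 0 < κ := by positivity
  obtain ⟨φ, hT, hnn, hPC, x₀, hx₀, hφ0, hEn⟩ := competitor hN h0 h1 (κ / 32) (by positivity)
  set m := φ x₀ with hm
  have hφc : Continuous φ := hT.c1.continuous
  set U : Set (E N) := {x | m / 2 < φ x} with hU
  have hUo : IsOpen U := isOpen_lt continuous_const hφc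
  have hUA : U ⊆ annulus N R₀ R₁ := by
    intro x hx
    by_contra hc
    have : m / 2 < φ x := hx
    rw [hT.zero hc] at this; linarith
  have hUf : volume U ≠ ⊤ := ((measure_mono hUA).trans_lt (bdd_annulus _ _ _).measure_lt_top).ne
  have hUp : 0 < volume.real U := by
    rw [measureReal_def]
    refine ENNReal.toReal_pos (hUo.measure_pos _ ⟨x₀, ?_⟩).ne' hUf
    show m / 2 < φ x₀
    linarith
  obtain ⟨n, hn⟩ := exists_pow_lt_of_lt_one hUp (by norm_num : (1 / 2 : ℝ) < 1)
  refine ⟨κ, hκ0, max 3 n, lt_of_lt_of_le (by norm_num) (le_max_left _ _), φ, hT, hnn, hPC, ⟨x₀, hx₀, hφ0⟩, ?_⟩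
  intro p hp
  have hp3 : 3 < p := lt_of_le_of_lt (le_max_left _ _) hp
  have hpn : n < p := lt_of_le_of_lt (le_max_right _ _) hp
  have hp0 : 0 < p := by linarith
  refine ⟨?_, ?_⟩
  · have hintg : IntegrableOn (fun x => φ x ^ p) (annulus N R₀ R₁) :=
      intA (hφc.continuousOn.rpow_const fun x _ => Or.inr hp0.le)
    have k1 : (m / 4) ^ p ≤ ∫ x in annulus N R₀ R₁, φ x ^ p := by
      calc (m / 4) ^ p = (1 / 2 : ℝ) ^ p * (m / 2) ^ p := by
            rw [← mul_rpow (by norm_num) (by positivity)]; congr 1; ring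
        _ ≤ volume.real U * (m / 2) ^ p := by
            gcongr
            refine le_trans ?_ hn.le
            rw [← rpow_natCast]
            exact rpow_le_rpow_of_exponent_ge (by norm_num) (by norm_num) hpn.le
        _ = ∫ x in U, (m / 2) ^ p := by rw [setIntegral_const, smul_eq_mul]
        _ ≤ ∫ x in U, φ x ^ p := by
            refine setIntegral_mono_on (integrableOn_const hUf) (hintg.mono_set hUA) hUo.measurableSet fun x hx => ?_
            have : m / 2 < φ x := hx
            gcongr
        _ ≤ _ := setIntegral_mono_set hintg (ae_of_all _ fun x => rpow_nonneg (hnn x) _) hUA.eventuallyLE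
    have k2 : (m / 4) ^ 2 ≤ (∫ x in annulus N R₀ R₁, φ x ^ p) ^ (2 / p) := by
      rw [← rpow_two_div (by positivity : 0 ≤ m / 4) hp0]
      gcongr
    calc _ ≤ κ / 32 * m ^ 2 := hEn
      _ < κ * (m / 4) ^ 2 := by
        have : 0 < κ * m ^ 2 := by positivity
        nlinarith
      _ ≤ _ := by gcongr
  · intro w hc hd hz hr hi
    have hsq := hrad w hc hd hz hr hi
    set G := ∫ y in annulus N R₀ R₁, ‖gradient w y‖ ^ 2 with hG
    have hG0 : 0 ≤ G := integral_nonneg fun y => by simp only [Pi.zero_apply]; positivity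
    have hs0 : 0 ≤ √(C * G) := sqrt_nonneg _
    have j1 : ∫ x in annulus N R₀ R₁, |w x| ^ p ≤ V * √(C * G) ^ p := by
      calc _ ≤ ∫ x in annulus N R₀ R₁, √(C * G) ^ p := by
            refine setIntegral_mono_on (intA (hc.abs.rpow_const fun x _ => Or.inr hp0.le))
              (intA continuousOn_const) (meas_annulus _ _ _) fun x hx => ?_
            gcongr
            exact abs_le_sqrt (hsq x hx)
        _ = _ := by rw [setIntegral_const, smul_eq_mul]
    have j2 : (∫ x in annulus N R₀ R₁, |w x| ^ p) ^ (2 / p) ≤ M * (C * G) := by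
      have j0 : 0 ≤ ∫ x in annulus N R₀ R₁, |w x| ^ p :=
        integral_nonneg fun y => by simp only [Pi.zero_apply]; positivity
      calc _ ≤ (V * √(C * G) ^ p) ^ (2 / p) := by gcongr
        _ = V ^ (2 / p) * (C * G) := by
            rw [mul_rpow hV0 (by positivity), rpow_two_div hs0 hp0, sq_sqrt (by positivity)]
        _ ≤ M ^ (2 / p) * (C * G) := by gcongr; exact le_max_right _ _
        _ ≤ M ^ (1:ℝ) * (C * G) := by
            gcongr
            rw [div_le_one hp0]; linarith
        _ = _ := by rw [rpow_one]
    calc _ ≤ κ * (M * (C * G)) := by gcongr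
      _ = G := by rw [hκ]; field_simp

end
end NR

open MeasureTheory Real Set
namespace NR
open Filter Topology

section
variable {N : ℕ} {R₀ R₁ : ℝ}

lemma int_pos {F : E N → ℝ} (hF : ContinuousOn F (cA N R₀ R₁)) (hn : ∀ x ∈ annulus N R₀ R₁, 0 ≤ F x)
    {x₀ : E N} (hx : x₀ ∈ annulus N R₀ R₁) (hp : 0 < F x₀) : 0 < ∫ x in annulus N R₀ R₁, F x := by
  rw [setIntegral_pos_iff_support_of_nonneg_ae (ae_restrict_of_forall_mem (meas_annulus _ _ _) hn) (intA hF)]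
  have hA := isOpen_annulus N R₀ R₁
  have ho : IsOpen (annulus N R₀ R₁ ∩ F ⁻¹' (Ioi 0)) :=
    (hF.mono (ann_sub_cA _ _ _)).isOpen_inter_preimage hA isOpen_Ioi
  refine (ho.measure_pos volume ⟨x₀, hx, hp⟩).trans_le (measure_mono ?_)
  rintro x ⟨h1, h2⟩
  exact ⟨(ne_of_gt h2 : F x ≠ 0), h1⟩

lemma PC.rep (hN : 3 ≤ N) (h0 : 0 < R₀) (h1 : R₀ < R₁) {u : E N → ℝ} (hu : PC N R₀ R₁ u) :
    ∃ 𝔲 : ℝ → ℝ → ℝ,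
    IsAxiallySymmRep N R₀ R₁ u 𝔲 ∧
    (∀ r ∈ Icc R₀ R₁, ∀ θ ∈ Icc (-(π / 2)) (π / 2), 𝔲 r (-θ) = 𝔲 r θ) ∧
    (∀ r ∈ Icc R₀ R₁, AntitoneOn (𝔲 r) (Icc 0 (π / 2))) := by
  set P : ℝ → ℝ → E N := fun r θ => r • (cos θ • e1 N hN + sin θ • eL N hN) with hP
  have hn : ∀ r θ, 0 < r → ‖P r θ‖ = r := by
    intro r θ hr
    have : ‖cos θ • e1 N hN + sin θ • eL N hN‖ ^ 2 = 1 := by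
      rw [norm_add_sq_real, norm_smul, norm_smul, norm_e1, norm_eL, inner_smul_left, inner_smul_right,
        real_inner_comm, eL_e1]
      simp
    have h2 : ‖cos θ • e1 N hN + sin θ • eL N hN‖ = 1 := by
      exact (pow_eq_one_iff_of_nonneg (norm_nonneg _) two_ne_zero).1 this
    simp only [hP]
    rw [norm_smul, h2, mul_one, Real.norm_of_nonneg hr.le]
  have hl : ∀ r θ, lastCoord (P r θ) = r * sin θ := by
    intro r θ
    simp only [hP]
    rw [lastCoord_eq hN, inner_smul_right, inner_add_right, inner_smul_right, inner_smul_right, eL_e1,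
      real_inner_self_eq_norm_sq, norm_eL]
    ring
  have hmem : ∀ r ∈ Icc R₀ R₁, ∀ θ, P r θ ∈ cA N R₀ R₁ := by
    intro r hr θ
    have := hn r θ (h0.trans_le hr.1)
    exact ⟨by rw [this]; exact hr.1, by rw [this]; exact hr.2⟩
  refine ⟨fun r θ => u (P r θ), ?_, ?_, ?_⟩
  · intro x hx
    rw [closure_annulus h0 h1] at hx
    have hx0 : 0 < ‖x‖ := h0.trans_le hx.1
    have hlc : |lastCoord x| ≤ ‖x‖ := by
      rw [lastCoord_eq hN]
      have := abs_real_inner_le_norm (eL N hN) x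
      rwa [norm_eL, one_mul] at this
    obtain ⟨g1, g2⟩ := abs_le.1 hlc
    refine (hu.eq hx (hn _ _ hx0) ?_).symm
    rw [hl, angleOf, sin_arcsin, mul_div_cancel₀ _ hx0.ne']
    · rw [le_div_iff₀ hx0]; linarith
    · rw [div_le_one hx0]; exact g2
  · intro r hr θ _
    have hr0 : 0 < r := h0.trans_le hr.1
    refine hu.eq (hmem r hr θ) (by rw [hn _ _ hr0, hn _ _ hr0]) ?_
    rw [hl, hl, sin_neg, mul_neg, abs_neg]
  · intro r hr θ hθ θ' hθ' hle
    have hr0 : 0 < r := h0.trans_le hr.1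
    refine hu _ (hmem r hr θ) _ (hmem r hr θ') (by rw [hn _ _ hr0, hn _ _ hr0]) ?_
    have s1 : 0 ≤ sin θ := sin_nonneg_of_nonneg_of_le_pi hθ.1 (by linarith [hθ.2, pi_pos])
    have s2 : sin θ ≤ sin θ' := sin_le_sin_of_le_of_le_pi_div_two (by linarith [hθ.1, pi_pos]) hθ'.2 hle
    rw [hl, hl, abs_of_nonneg (by positivity), abs_of_nonneg (mul_nonneg hr0.le (s1.trans s2))]
    gcongr

lemma fdw {u : E N → ℝ} {x : E N} (hx : x ∈ annulus N R₀ R₁) :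
    fderivWithin ℝ u (closure (annulus N R₀ R₁)) x = fderiv ℝ u x :=
  fderivWithin_of_mem_nhds (mem_of_superset ((isOpen_annulus _ _ _).mem_nhds hx) subset_closure)

lemma H1sq_eq (u : E N → ℝ) : H1sq N R₀ R₁ u = En N R₀ R₁ u u := by
  unfold H1sq En
  refine setIntegral_congr_fun (meas_annulus _ _ _) fun x hx => ?_
  rw [fdw hx, ← norm_grad, real_inner_self_eq_norm_sq]; ring

lemma funcI_neh {p : ℝ} {u : E N → ℝ} (h : memNehari N R₀ R₁ (fun _ => 1) p u) :
    funcI N R₀ R₁ (fun _ => 1) p u = (1 / 2 - 1 / p) * H1sq N R₀ R₁ u := by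
  rw [funcI, ← h.2.2]; ring

/-- scaling a cone element onto the Nehari set -/
lemma to_nehari (hN : 3 ≤ N) (h0 : 0 < R₀) (h1 : R₀ < R₁) {p : ℝ} (hp : 2 < p) {φ : E N → ℝ}
    (hT : Tst (annulus N R₀ R₁) φ) (hn : ∀ x, 0 ≤ φ x) (hPC : PC N R₀ R₁ φ)
    (hx : ∃ x₀ ∈ annulus N R₀ R₁, 0 < φ x₀) : ∃ t : ℝ, 0 < t ∧
      memNehari N R₀ R₁ (fun _ => 1) p (fun x => t * φ x) ∧
      H1sq N R₀ R₁ (fun x => t * φ x) = t ^ 2 * En N R₀ R₁ φ φ ∧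
      t ^ 2 * En N R₀ R₁ φ φ = t ^ p * ∫ x in annulus N R₀ R₁, φ x ^ p := by
  obtain ⟨x₀, hx₀, hp0⟩ := hx
  have hφc := hT.c1.continuous
  have hpp : 0 < p := by linarith
  have hP : 0 < ∫ x in annulus N R₀ R₁, φ x ^ p :=
    int_pos (hφc.continuousOn.rpow_const fun x _ => Or.inr hpp.le) (fun x _ => rpow_nonneg (hn x) _) hx₀
      (rpow_pos_of_pos hp0 _)
  have hE : 0 < En N R₀ R₁ φ φ := by
    have h2 : 0 < ∫ x in annulus N R₀ R₁, φ x ^ 2 :=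
      int_pos (hφc.continuousOn.pow 2) (fun x _ => sq_nonneg _) hx₀ (by positivity)
    refine h2.trans_le ?_
    refine integral_mono (intA (hφc.continuousOn.pow 2)) (En_int h0 hT.c1.contDiffOn hT.c1.contDiffOn) fun x => ?_
    have := real_inner_self_nonneg (x := gradient φ x)
    simp only; nlinarith
  set Eφ := En N R₀ R₁ φ φ with hEd
  set Pφ := ∫ x in annulus N R₀ R₁, φ x ^ p with hPd
  set t := (Eφ / Pφ) ^ (1 / (p - 2)) with ht
  have ht0 : 0 < t := by positivity
  have hp2 : p - 2 ≠ 0 := by linarith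
  have htp : t ^ (p - 2) = Eφ / Pφ := by
    rw [ht, ← rpow_mul (by positivity), one_div_mul_cancel hp2, rpow_one]
  have hid : t ^ 2 * Eφ = t ^ p * Pφ := by
    have : t ^ p = t ^ (2:ℕ) * t ^ (p - 2) := by
      rw [← rpow_natCast, ← rpow_add ht0]; congr 1; push_cast; ring
    rw [this, htp]; field_simp
  have hH : H1sq N R₀ R₁ (fun x => t * φ x) = t ^ 2 * Eφ := by
    rw [H1sq_eq, En_smul h0 hT.c1.contDiffOn]
  have hPt : PC N R₀ R₁ (fun x => t * φ x) := fun x hx x' hx' a b =>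
    mul_le_mul_of_nonneg_left (hPC x hx x' hx' a b) ht0.le
  refine ⟨t, ht0, ⟨⟨⟨(contDiff_const.mul hT.c1).contDiffOn, fun x _ => mul_nonneg ht0.le (hn x),
    hPt.rep hN h0 h1⟩, ?_⟩, ⟨x₀, hx₀, by positivity⟩, ?_⟩, hH, hid⟩
  · intro x hx
    show t * φ x = 0
    rw [hT.zero, mul_zero]
    rintro ⟨a, b⟩
    rcases hx with h | h <;> linarith
  · rw [hH, hid, hPd, ← integral_const_mul]
    congr 1; ext x
    rw [abs_of_nonneg (mul_nonneg ht0.le (hn x)), mul_rpow ht0.le (hn x), one_mul]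

lemma part1 (hN : 3 ≤ N) (h0 : 0 < R₀) (h1 : R₀ < R₁) {p κ : ℝ} (hp : 2 < p) {φ : E N → ℝ}
    (hT : Tst (annulus N R₀ R₁) φ) (hn : ∀ x, 0 ≤ φ x) (hPC : PC N R₀ R₁ φ)
    (hx : ∃ x₀ ∈ annulus N R₀ R₁, 0 < φ x₀)
    (hE : En N R₀ R₁ φ φ < κ * (∫ x in annulus N R₀ R₁, φ x ^ p) ^ (2 / p))
    (hrad : ∀ w : E N → ℝ,
    ContinuousOn w (cA N R₀ R₁) → ContDiffOn ℝ 1 w (annulus N R₀ R₁) →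
    (∀ x, ‖x‖ = R₀ ∨ ‖x‖ = R₁ → w x = 0) →
    (∀ x ∈ annulus N R₀ R₁, ∀ y ∈ annulus N R₀ R₁, ‖x‖ = ‖y‖ → w x = w y) →
    IntegrableOn (fun x => ‖gradient w x‖ ^ 2) (annulus N R₀ R₁) →
    κ * (∫ x in annulus N R₀ R₁, |w x| ^ p) ^ (2 / p) ≤ ∫ y in annulus N R₀ R₁, ‖gradient w y‖ ^ 2)
    {u : E N → ℝ} (hu : memNehari N R₀ R₁ (fun _ => 1) p u)
    (hc : funcI N R₀ R₁ (fun _ => 1) p u = cI N R₀ R₁ (fun _ => 1) p) :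
    ∃ x ∈ annulus N R₀ R₁, ∃ y ∈ annulus N R₀ R₁, ‖x‖ = ‖y‖ ∧ u x ≠ u y := by
  by_contra hcon
  push Not at hcon
  have hpp : 0 < p := by linarith
  have hpc : 0 < 1 / 2 - 1 / p := by
    rw [sub_pos]; exact one_div_lt_one_div_of_lt (by norm_num) hp
  obtain ⟨t, ht0, htn, htH, htE⟩ := to_nehari hN h0 h1 hp hT hn hPC hx
  have hnn : ∀ v : E N → ℝ, 0 ≤ H1sq N R₀ R₁ v := fun v => by rw [H1sq_eq]; exact En_nonneg v
  have hle : funcI N R₀ R₁ (fun _ => 1) p u ≤ funcI N R₀ R₁ (fun _ => 1) p (fun x => t * φ x) := by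
    rw [hc, cI]
    refine csInf_le ⟨0, ?_⟩ ⟨_, htn, rfl⟩
    rintro c ⟨v, hv, rfl⟩
    rw [funcI_neh hv]; exact mul_nonneg hpc.le (hnn v)
  rw [funcI_neh hu, funcI_neh htn, mul_le_mul_iff_right₀ hpc] at hle
  obtain ⟨⟨⟨hc1, hunn, -⟩, hbd⟩, ⟨x₀, hx₀, hux⟩, hneh⟩ := hu
  rw [closure_annulus h0 h1] at hc1
  simp only [one_mul] at hneh
  set P := ∫ x in annulus N R₀ R₁, |u x| ^ p with hP
  have hPpos : 0 < P := int_pos (hc1.continuousOn.abs.rpow_const fun x _ => Or.inr hpp.le)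
    (fun x _ => rpow_nonneg (abs_nonneg _) _) hx₀ (by positivity)
  have hca : ContDiffOn ℝ 1 u (annulus N R₀ R₁) := hc1.mono (ann_sub_cA _ _ _)
  have hEn : En N R₀ R₁ u u = P := by rw [← H1sq_eq, hneh]
  have hintg : IntegrableOn (fun x => inner ℝ (gradient u x) (gradient u x) + u x * u x) (annulus N R₀ R₁) := by
    by_contra hni
    have : En N R₀ R₁ u u = 0 := integral_undef hni
    linarith
  have hgc := continuousOn_grad (isOpen_annulus _ _ _) hca
  have hgi : IntegrableOn (fun x => ‖gradient u x‖ ^ 2) (annulus N R₀ R₁) := by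
    refine Integrable.mono' hintg ((hgc.norm.pow 2).aestronglyMeasurable (meas_annulus _ _ _)) (ae_of_all _ fun x => ?_)
    rw [real_inner_self_eq_norm_sq, Real.norm_of_nonneg (by positivity)]
    nlinarith [mul_self_nonneg (u x)]
  have hk := hrad u hc1.continuousOn hca hbd (fun x hx y hy h => hcon x hx y hy h) hgi
  have hk2 : κ * P ^ (2 / p) ≤ P := by
    refine hk.trans ?_
    rw [← hEn]
    refine integral_mono hgi hintg fun x => ?_
    simp only [real_inner_self_eq_norm_sq]
    nlinarith [mul_self_nonneg (u x)]
  rw [hneh, htH] at hle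
  set H := t ^ 2 * En N R₀ R₁ φ φ with hH
  have hHpos : 0 < H := hPpos.trans_le hle
  have hH2 : H < κ * H ^ (2 / p) := by
    have hP0 : 0 ≤ ∫ x in annulus N R₀ R₁, φ x ^ p := integral_nonneg fun x => rpow_nonneg (hn x) _
    have e : H ^ (2 / p) = t ^ 2 * (∫ x in annulus N R₀ R₁, φ x ^ p) ^ (2 / p) := by
      rw [htE, mul_rpow (by positivity) hP0, rpow_two_div ht0.le hpp]
    rw [e, hH]
    calc _ < t ^ 2 * (κ * (∫ x in annulus N R₀ R₁, φ x ^ p) ^ (2 / p)) := by gcongr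
      _ = _ := by ring
  have split : ∀ y : ℝ, 0 < y → y = y ^ (1 - 2 / p) * y ^ (2 / p) := by
    intro y hy
    rw [← rpow_add hy]; simp
  have a1 : H ^ (1 - 2 / p) < κ := by
    have h3 : 0 < H ^ (2 / p) := by positivity
    have := split H hHpos
    rw [this] at hH2
    rw [← this] at hH2
    nlinarith
  have a2 : κ ≤ P ^ (1 - 2 / p) := by
    have h3 : 0 < P ^ (2 / p) := by positivity
    have := split P hPpos
    nlinarith
  have a3 : P ^ (1 - 2 / p) ≤ H ^ (1 - 2 / p) := by
    have : 0 ≤ 1 - 2 / p := by rw [sub_nonneg, div_le_one hpp]; exact hp.le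
    gcongr
  linarith

end
end NR

open MeasureTheory Real Set
namespace NR
open Filter Topology

section
variable {N : ℕ} {R₀ R₁ : ℝ}

lemma young_p {a b p : ℝ} (ha : 0 ≤ a) (hb : 0 ≤ b) (hp : 1 < p) :
    a ^ (p - 1) * b ≤ (1 - 1 / p) * a ^ p + (1 / p) * b ^ p ∧
    (a ^ (p - 1) * b = (1 - 1 / p) * a ^ p + (1 / p) * b ^ p → b = a) := by
  have hp0 : 0 < p := by linarith
  rcases ha.eq_or_lt with h | h
  · rw [← h, zero_rpow (by linarith), zero_rpow hp0.ne']
    simp only [zero_mul, mul_zero, zero_add]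
    refine ⟨by positivity, fun h2 => ?_⟩
    have h3 : b ^ p = 0 := by
      have : p⁻¹ ≠ 0 := by positivity
      rw [one_div] at h2
      rcases mul_eq_zero.1 h2.symm with h | h
      · exact absurd h this
      · exact h
    exact (rpow_eq_zero hb hp0.ne').1 h3
  · set r := b / a with hr
    have hr0 : 0 ≤ r := by positivity
    have hbr : b = r * a := by rw [hr]; field_simp
    have hbp : b ^ p = r ^ p * a ^ p := by rw [hbr, mul_rpow hr0 ha]
    have hap : a ^ (p - 1) * b = r * a ^ p := by
      rw [hbr, rpow_sub_one h.ne']; field_simp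
    have hA : 0 < a ^ p := rpow_pos_of_pos h p
    rw [hap, hbp]
    constructor
    · have := one_add_mul_self_le_rpow_one_add (s := r - 1) (by linarith) hp.le
      rw [add_sub_cancel] at this
      have h2 : r ≤ (1 - 1 / p) + (1 / p) * r ^ p := by
        have : (1 / p) * (1 + p * (r - 1)) ≤ (1 / p) * r ^ p := by gcongr
        have e : (1 / p) * (1 + p * (r - 1)) = 1 / p + (r - 1) := by field_simp
        linarith
      nlinarith
    · intro he
      by_contra hne
      have hr1 : r - 1 ≠ 0 := by
        intro h1; apply hne; rw [hbr]; have : r = 1 := by linarith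
        rw [this, one_mul]
      have := one_add_mul_self_lt_rpow_one_add (s := r - 1) (by linarith) hr1 hp
      rw [add_sub_cancel] at this
      have h2 : r < (1 - 1 / p) + (1 / p) * r ^ p := by
        have : (1 / p) * (1 + p * (r - 1)) < (1 / p) * r ^ p := by gcongr
        have e : (1 / p) * (1 + p * (r - 1)) = 1 / p + (r - 1) := by field_simp
        linarith
      nlinarith

lemma cpow {u : E N → ℝ} (h : ContinuousOn u (cA N R₀ R₁)) {q : ℝ} (hq : 0 ≤ q) :
    ContinuousOn (fun x => u x ^ q) (cA N R₀ R₁) := h.rpow_const fun _ _ => Or.inr hq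

lemma holder_p {p : ℝ} (hp : 2 < p) {u v : E N → ℝ} (hu : ContinuousOn u (cA N R₀ R₁))
    (hun : ∀ x ∈ cA N R₀ R₁, 0 ≤ u x) (hv : ContinuousOn v (cA N R₀ R₁)) (hvn : ∀ x ∈ cA N R₀ R₁, 0 ≤ v x)
    (hJ : ∫ x in annulus N R₀ R₁, u x ^ p = 1) {B : ℝ} (hB : 0 < B) (hb : ∫ x in annulus N R₀ R₁, v x ^ p = B ^ p) :
    ∫ x in annulus N R₀ R₁, u x ^ (p - 1) * v x ≤ B ∧
    (∫ x in annulus N R₀ R₁, u x ^ (p - 1) * v x = B → ∀ x ∈ annulus N R₀ R₁, v x = B * u x) := by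
  have hp0 : 0 < p := by linarith
  have c1 : ContinuousOn (fun x => u x ^ (p - 1) * (B⁻¹ * v x)) (cA N R₀ R₁) :=
    (cpow hu (by linarith)).mul (continuousOn_const.mul hv)
  have c2 := cpow hu hp0.le
  have c3 : ContinuousOn (fun x => (B⁻¹ * v x) ^ p) (cA N R₀ R₁) := cpow (continuousOn_const.mul hv) hp0.le
  have i2 : IntegrableOn (fun x => (1 - 1 / p) * u x ^ p) (annulus N R₀ R₁) := (intA c2).const_mul _
  have i3 : IntegrableOn (fun x => (1 / p) * (B⁻¹ * v x) ^ p) (annulus N R₀ R₁) := (intA c3).const_mul _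
  set F : E N → ℝ := fun x => (1 - 1 / p) * u x ^ p + (1 / p) * (B⁻¹ * v x) ^ p - u x ^ (p - 1) * (B⁻¹ * v x) with hF
  have hFc : ContinuousOn F (cA N R₀ R₁) :=
    ((continuousOn_const.mul c2).add (continuousOn_const.mul c3)).sub c1
  have hyo : ∀ x ∈ annulus N R₀ R₁, _ := fun x hx => young_p (hun x (ann_sub_cA _ _ _ hx))
    (mul_nonneg (inv_nonneg.2 hB.le) (hvn x (ann_sub_cA _ _ _ hx))) (by linarith : 1 < p)
  have hFn : ∀ x ∈ annulus N R₀ R₁, 0 ≤ F x := fun x hx => sub_nonneg.2 (hyo x hx).1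
  have e3 : ∫ x in annulus N R₀ R₁, (B⁻¹ * v x) ^ p = 1 := by
    have : ∫ x in annulus N R₀ R₁, (B⁻¹ * v x) ^ p = ∫ x in annulus N R₀ R₁, (B⁻¹) ^ p * v x ^ p :=
      setIntegral_congr_fun (meas_annulus _ _ _) fun x hx =>
        mul_rpow (inv_nonneg.2 hB.le) (hvn x (ann_sub_cA _ _ _ hx))
    rw [this, integral_const_mul, hb, inv_rpow hB.le, inv_mul_cancel₀ (rpow_pos_of_pos hB p).ne']
  have e1 : ∫ x in annulus N R₀ R₁, u x ^ (p - 1) * (B⁻¹ * v x) =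
      B⁻¹ * ∫ x in annulus N R₀ R₁, u x ^ (p - 1) * v x := by
    rw [← integral_const_mul]; congr 1; ext x; ring
  have hFi : ∫ x in annulus N R₀ R₁, F x = 1 - B⁻¹ * ∫ x in annulus N R₀ R₁, u x ^ (p - 1) * v x := by
    rw [hF, integral_sub (by exact i2.add i3) (intA c1), integral_add i2 i3, integral_const_mul, integral_const_mul,
      hJ, e3, e1]
    ring
  have hF0 : 0 ≤ ∫ x in annulus N R₀ R₁, F x := setIntegral_nonneg (meas_annulus _ _ _) hFn
  refine ⟨?_, fun heq x hx => ?_⟩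
  · rw [hFi] at hF0
    have : B⁻¹ * (∫ x in annulus N R₀ R₁, u x ^ (p - 1) * v x) ≤ 1 := by linarith
    rwa [inv_mul_le_iff₀ hB, mul_one] at this
  · have hz : F x = 0 := by
      by_contra hne
      have := int_pos hFc hFn hx (lt_of_le_of_ne (hFn x hx) (Ne.symm hne))
      rw [hFi, heq, inv_mul_cancel₀ hB.ne'] at this
      linarith
    have h2 := (hyo x hx).2 (sub_eq_zero.1 hz).symm
    rw [← h2]; field_simp

/-- the cone of admissible right-hand sides -/
structure Cn (N : ℕ) (R₀ R₁ : ℝ) (u : E N → ℝ) : Prop where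
  c : ContinuousOn u (cA N R₀ R₁)
  nn : ∀ x ∈ cA N R₀ R₁, 0 ≤ u x
  pc : PC N R₀ R₁ u
  ne : ∃ x ∈ annulus N R₀ R₁, 0 < u x

lemma Cn.smul {u : E N → ℝ} (h : Cn N R₀ R₁ u) {t : ℝ} (ht : 0 < t) : Cn N R₀ R₁ (fun x => t * u x) := by
  obtain ⟨x, hx, hp⟩ := h.ne
  exact ⟨continuousOn_const.mul h.c, fun x hx => mul_nonneg ht.le (h.nn x hx), fun x hx x' hx' a b =>
    mul_le_mul_of_nonneg_left (h.pc x hx x' hx' a b) ht.le, x, hx, mul_pos ht hp⟩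

lemma Cn.pow {u : E N → ℝ} (h : Cn N R₀ R₁ u) {q : ℝ} (hq : 0 ≤ q) : Cn N R₀ R₁ (fun x => u x ^ q) := by
  obtain ⟨x, hx, hp⟩ := h.ne
  exact ⟨cpow h.c hq, fun x hx => rpow_nonneg (h.nn x hx) _, fun x hx x' hx' a b =>
    rpow_le_rpow (h.nn x' hx') (h.pc x hx x' hx' a b) hq, x, hx, rpow_pos_of_pos hp _⟩

lemma Cn.J_pos {u : E N → ℝ} (h : Cn N R₀ R₁ u) {q : ℝ} (hq : 0 ≤ q) : 0 < ∫ x in annulus N R₀ R₁, u x ^ q := by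
  obtain ⟨x, hx, hp⟩ := h.ne
  exact int_pos (cpow h.c hq) (fun x hx => rpow_nonneg (h.nn x (ann_sub_cA _ _ _ hx)) _) hx (rpow_pos_of_pos hp _)

lemma Cn.sol {f v : E N → ℝ} (hN : 3 ≤ N) (h0 : 0 < R₀) (h1 : R₀ < R₁) (h : Cn N R₀ R₁ f)
    (hv : Sol N R₀ R₁ 1 f v) : Cn N R₀ R₁ v ∧ ∀ x ∈ annulus N R₀ R₁, 0 < v x := by
  have hfn : ∀ x ∈ annulus N R₀ R₁, 0 ≤ f x := fun x hx => h.nn x (ann_sub_cA _ _ _ hx)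
  have hne : ∃ x ∈ annulus N R₀ R₁, v x ≠ 0 := by
    by_contra hcon
    push Not at hcon
    obtain ⟨x₀, hx₀, hp⟩ := h.ne
    have hA := isOpen_annulus N R₀ R₁
    obtain ⟨ε, hε, hb⟩ := Metric.isOpen_iff.1 hA x₀ hx₀
    let g : ContDiffBump x₀ := ⟨ε / 4, ε / 2, by positivity, by linarith⟩
    have hT : Tst (annulus N R₀ R₁) g := by
      refine ⟨g.contDiff, g.hasCompactSupport, ?_⟩
      rw [g.tsupport_eq]
      exact (Metric.closedBall_subset_ball (by show ε / 2 < ε; linarith)).trans hb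
    have he := hv.energy_tst h0 h.c hT
    have hz : En N R₀ R₁ v g = 0 := by
      unfold En
      rw [← integral_zero (E N) ℝ (μ := volume.restrict (annulus N R₀ R₁))]
      refine setIntegral_congr_fun hA.measurableSet fun x hx => ?_
      have hev : v =ᶠ[𝓝 x] fun _ => 0 := by filter_upwards [hA.mem_nhds hx] with y hy using hcon y hy
      have hg : gradient v x = 0 := by
        rw [gradient, hev.fderiv_eq]; simp
      simp only [hg, hcon x hx, inner_zero_left, zero_mul, add_zero]
    have hpos : 0 < ∫ x in annulus N R₀ R₁, f x * g x := by
      refine int_pos (h.c.mul g.continuous.continuousOn) (fun x hx => mul_nonneg (hfn x hx) g.nonneg) hx₀ ?_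
      rw [g.one_of_mem_closedBall (Metric.mem_closedBall_self g.rIn_pos.le), mul_one]; exact hp
    linarith
  have hpos := hv.pos hN h0 h1 hfn hne
  obtain ⟨x₀, hx₀, -⟩ := h.ne
  exact ⟨⟨hv.cont h0, hv.nonneg hN h0 h1 zero_le_one hfn, hv.PC hN h0 h1 h.pc, x₀, hx₀, hpos x₀ hx₀⟩, hpos⟩

end
end NR

open MeasureTheory Real Set
namespace NR
open Filter Topology

section
variable {N : ℕ} {R₀ R₁ : ℝ}

/-- a normalized admissible function together with the solution it generates -/
structure Pr (N : ℕ) (R₀ R₁ p : ℝ) (u v : E N → ℝ) : Prop where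
  cn : Cn N R₀ R₁ u
  nm : ∫ x in annulus N R₀ R₁, u x ^ p = 1
  sol : Sol N R₀ R₁ 1 (fun x => u x ^ (p - 1)) v

lemma bdd_cA {f : E N → ℝ} (h : ContinuousOn f (cA N R₀ R₁)) : ∃ M, 0 ≤ M ∧ ∀ x ∈ cA N R₀ R₁, |f x| ≤ M := by
  obtain ⟨M, hM⟩ := (isCompact_cA N R₀ R₁).exists_bound_of_continuousOn h
  exact ⟨max M 0, le_max_right _ _, fun x hx => (hM x hx).trans (le_max_left _ _)⟩

lemma Sol.exc (hN : 3 ≤ N) (h0 : 0 < R₀) (h1 : R₀ < R₁) {f : E N → ℝ} (hf : ContinuousOn f (cA N R₀ R₁)) :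
    ∃ u, Sol N R₀ R₁ 1 f u := by
  obtain ⟨C, -, h⟩ := Sol.exists1 hN h0 h1
  obtain ⟨M, hM, hb⟩ := bdd_cA hf
  obtain ⟨u, hu, -⟩ := h f M hM hf fun x hx => hb x (ann_sub_cA _ _ _ hx)
  exact ⟨u, hu⟩

lemma J_smul {p : ℝ} {v : E N → ℝ} (hvn : ∀ x ∈ cA N R₀ R₁, 0 ≤ v x) {t : ℝ} (ht : 0 ≤ t) :
    ∫ x in annulus N R₀ R₁, (t * v x) ^ p = t ^ p * ∫ x in annulus N R₀ R₁, v x ^ p := by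
  rw [← integral_const_mul]
  exact setIntegral_congr_fun (meas_annulus _ _ _) fun x hx => mul_rpow ht (hvn x (ann_sub_cA _ _ _ hx))

lemma Pr.en (hN : 3 ≤ N) (h0 : 0 < R₀) (h1 : R₀ < R₁) {p : ℝ} (hp : 2 < p) {u v : E N → ℝ}
    (h : Pr N R₀ R₁ p u v) : En N R₀ R₁ v v = ∫ x in annulus N R₀ R₁, u x ^ (p - 1) * v x :=
  h.sol.energy h0 h1 (cpow h.cn.c (by linarith)) h.sol.c1 h.sol.bd
    (Cn.sol hN h0 h1 (h.cn.pow (by linarith)) h.sol).2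

lemma Pr.cnv (hN : 3 ≤ N) (h0 : 0 < R₀) (h1 : R₀ < R₁) {p : ℝ} (hp : 2 < p) {u v : E N → ℝ}
    (h : Pr N R₀ R₁ p u v) : Cn N R₀ R₁ v := (Cn.sol hN h0 h1 (h.cn.pow (by linarith)) h.sol).1

lemma Pr.vpos (hN : 3 ≤ N) (h0 : 0 < R₀) (h1 : R₀ < R₁) {p : ℝ} (hp : 2 < p) {u v : E N → ℝ}
    (h : Pr N R₀ R₁ p u v) : ∀ x ∈ annulus N R₀ R₁, 0 < v x :=
  (Cn.sol hN h0 h1 (h.cn.pow (by linarith)) h.sol).2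

lemma Pr.en_pos (hN : 3 ≤ N) (h0 : 0 < R₀) (h1 : R₀ < R₁) {p : ℝ} (hp : 2 < p) {u v : E N → ℝ}
    (h : Pr N R₀ R₁ p u v) : 0 < En N R₀ R₁ v v := by
  rw [h.en hN h0 h1 hp]
  obtain ⟨x, hx, hp'⟩ := h.cn.ne
  have hv := h.cnv hN h0 h1 hp
  exact int_pos ((cpow h.cn.c (by linarith)).mul hv.c) (fun x hx => mul_nonneg
    (rpow_nonneg (h.cn.nn x (ann_sub_cA _ _ _ hx)) _) (hv.nn x (ann_sub_cA _ _ _ hx))) hx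
    (mul_pos (rpow_pos_of_pos hp' _) (h.vpos hN h0 h1 hp x hx))

lemma Pr.step (hN : 3 ≤ N) (h0 : 0 < R₀) (h1 : R₀ < R₁) {p : ℝ} (hp : 2 < p) {u v : E N → ℝ}
    (h : Pr N R₀ R₁ p u v) : ∃ B, 0 < B ∧ ∫ x in annulus N R₀ R₁, v x ^ p = B ^ p ∧ En N R₀ R₁ v v ≤ B ∧
    ∃ w, Pr N R₀ R₁ p (fun x => B⁻¹ * v x) w ∧ B ^ 2 ≤ En N R₀ R₁ w w * En N R₀ R₁ v v ∧
      En N R₀ R₁ v v ≤ En N R₀ R₁ w w := by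
  have hv := h.cnv hN h0 h1 hp
  have hb := hv.J_pos (by linarith : 0 ≤ p)
  set b := ∫ x in annulus N R₀ R₁, v x ^ p with hbd
  set B := b ^ (1 / p) with hB
  have hB0 : 0 < B := rpow_pos_of_pos hb _
  have hBp : B ^ p = b := by rw [hB, ← rpow_mul hb.le, one_div_mul_cancel (by linarith), rpow_one]
  have heB : En N R₀ R₁ v v ≤ B := by
    rw [h.en hN h0 h1 hp]
    exact (holder_p hp h.cn.c h.cn.nn hv.c hv.nn h.nm hB0 hBp.symm).1
  have hcn : Cn N R₀ R₁ (fun x => B⁻¹ * v x) := hv.smul (inv_pos.2 hB0)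
  have hnm : ∫ x in annulus N R₀ R₁, (B⁻¹ * v x) ^ p = 1 := by
    rw [J_smul hv.nn (inv_pos.2 hB0).le, inv_rpow hB0.le, hBp, inv_mul_cancel₀ hb.ne']
  obtain ⟨w, hw⟩ := Sol.exc hN h0 h1 (cpow hcn.c (by linarith : 0 ≤ p - 1))
  have hP : Pr N R₀ R₁ p (fun x => B⁻¹ * v x) w := ⟨hcn, hnm, hw⟩
  have hwv : En N R₀ R₁ w v = B := by
    rw [hw.energy h0 h1 (cpow hcn.c (by linarith)) h.sol.c1 h.sol.bd (h.vpos hN h0 h1 hp)]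
    have : ∫ x in annulus N R₀ R₁, (B⁻¹ * v x) ^ (p - 1) * v x = ∫ x in annulus N R₀ R₁, B * (B⁻¹ * v x) ^ p := by
      refine setIntegral_congr_fun (meas_annulus _ _ _) fun x hx => ?_
      have hx0 : 0 < B⁻¹ * v x := mul_pos (inv_pos.2 hB0) (h.vpos hN h0 h1 hp x hx)
      rw [rpow_sub_one hx0.ne']
      have := h.vpos hN h0 h1 hp x hx
      field_simp
    rw [this, integral_const_mul, hnm, mul_one]
  have hcs := En_CS (R₁ := R₁) h0 hw.c1 h.sol.c1
  rw [hwv] at hcs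
  refine ⟨B, hB0, hBp.symm, heB, w, hP, hcs, ?_⟩
  have he := h.en_pos hN h0 h1 hp
  have : En N R₀ R₁ v v ^ 2 ≤ En N R₀ R₁ w w * En N R₀ R₁ v v := (pow_le_pow_left₀ he.le heB 2).trans hcs
  nlinarith

/-- uniform upper bound of the dual functional -/
lemma Pr.bdd (hN : 3 ≤ N) (h0 : 0 < R₀) (h1 : R₀ < R₁) {p : ℝ} (hp : 2 < p) :
    ∃ C, ∀ u v, Pr N R₀ R₁ p u v → En N R₀ R₁ v v ≤ C := by
  obtain ⟨C, hC, hL⟩ := Lq hN h0 h1 p (by linarith)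
  refine ⟨C ^ (2 / p), fun u v h => ?_⟩
  obtain ⟨B, hB, hb, heB, -⟩ := h.step hN h0 h1 hp
  have he := h.en_pos hN h0 h1 hp
  have hv := h.cnv hN h0 h1 hp
  have h3 := hL v h.sol.c1 h.sol.bd hv.nn hv.pc he
  rw [hb] at h3
  set e := En N R₀ R₁ v v
  have h4 : e ^ (p / 2) * e ^ (p / 2) ≤ C * e ^ (p / 2) := by
    rw [← rpow_add he, add_halves]
    exact (rpow_le_rpow he.le heB (by linarith)).trans h3
  have h5 : e ^ (p / 2) ≤ C := le_of_mul_le_mul_right h4 (rpow_pos_of_pos he _)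
  have h6 := rpow_le_rpow (rpow_nonneg he.le _) h5 (by positivity : 0 ≤ 2 / p)
  rwa [← rpow_mul he.le, div_mul_div_cancel₀ (by norm_num), div_self (by linarith), rpow_one] at h6

/-- existence of admissible functions, with the lower bound given by a test function -/
lemma Pr.test (hN : 3 ≤ N) (h0 : 0 < R₀) (h1 : R₀ < R₁) {p : ℝ} (hp : 2 < p) {φ : E N → ℝ}
    (hT : Tst (annulus N R₀ R₁) φ) (hn : ∀ x, 0 ≤ φ x) (hPC : PC N R₀ R₁ φ)
    (hx : ∃ x ∈ annulus N R₀ R₁, 0 < φ x) :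
    ∃ u v, Pr N R₀ R₁ p u v ∧
      (∫ x in annulus N R₀ R₁, φ x ^ p) ^ (2 / p) ≤ En N R₀ R₁ v v * En N R₀ R₁ φ φ := by
  have hc : Cn N R₀ R₁ φ := ⟨hT.c1.continuous.continuousOn, fun x _ => hn x, hPC, hx⟩
  have hb := hc.J_pos (by linarith : 0 ≤ p)
  set b := ∫ x in annulus N R₀ R₁, φ x ^ p with hbd
  set B := b ^ (1 / p) with hB
  have hB0 : 0 < B := rpow_pos_of_pos hb _
  have hBp : B ^ p = b := by rw [hB, ← rpow_mul hb.le, one_div_mul_cancel (by linarith), rpow_one]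
  have hcn : Cn N R₀ R₁ (fun x => B⁻¹ * φ x) := hc.smul (inv_pos.2 hB0)
  have hnm : ∫ x in annulus N R₀ R₁, (B⁻¹ * φ x) ^ p = 1 := by
    rw [J_smul hc.nn (inv_pos.2 hB0).le, inv_rpow hB0.le, hBp, inv_mul_cancel₀ hb.ne']
  obtain ⟨w, hw⟩ := Sol.exc hN h0 h1 (cpow hcn.c (by linarith : 0 ≤ p - 1))
  refine ⟨_, w, ⟨hcn, hnm, hw⟩, ?_⟩
  have hwv : En N R₀ R₁ w φ = B := by
    rw [hw.energy_tst h0 (cpow hcn.c (by linarith)) hT]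
    have : ∫ x in annulus N R₀ R₁, (B⁻¹ * φ x) ^ (p - 1) * φ x = ∫ x in annulus N R₀ R₁, B * (B⁻¹ * φ x) ^ p := by
      refine setIntegral_congr_fun (meas_annulus _ _ _) fun x hx => ?_
      rcases (hn x).eq_or_lt with h | h
      · rw [← h, mul_zero, mul_zero, zero_rpow (by linarith), mul_zero]
      have hx0 : 0 < B⁻¹ * φ x := mul_pos (inv_pos.2 hB0) h
      rw [rpow_sub_one hx0.ne']
      field_simp
    rw [this, integral_const_mul, hnm, mul_one]
  have hcs := En_CS (R₁ := R₁) h0 hw.c1 (v := φ) hT.c1.contDiffOn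
  rw [hwv] at hcs
  rwa [← hBp, rpow_two_div hB0.le (by linarith)]

end
end NR

open MeasureTheory Real Set
namespace NR
open Filter Topology

section
variable {N : ℕ} {R₀ R₁ : ℝ}

lemma lip_AO (h0 : 0 < R₀) {z : E N → ℝ} (hz : ContDiffOn ℝ 1 z (AO N R₀)) {G : ℝ}
    (hG : ∀ x ∈ AO N R₀, ‖gradient z x‖ ≤ G) {x y : E N} (hx : x ∈ cA N R₀ R₁) (hxy : dist y x < R₀ / 2) :
    |z y - z x| ≤ G * dist y x := by
  have hsub : Metric.ball x (R₀ / 2) ⊆ AO N R₀ := by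
    intro w hw
    rw [Metric.mem_ball, dist_eq_norm] at hw
    have h3 : R₀ ≤ ‖x‖ := hx.1
    have h4 := norm_sub_norm_le x w
    rw [norm_sub_rev] at h4
    show R₀ / 2 < ‖w‖
    linarith
  have := (convex_ball x (R₀ / 2)).norm_image_sub_le_of_norm_fderiv_le (𝕜 := ℝ) (f := z) (C := G)
    (fun w hw => (hz.differentiableOn one_ne_zero).differentiableAt ((isOpen_AO _ _).mem_nhds (hsub hw)))
    (fun w hw => by rw [← norm_grad]; exact hG w (hsub hw))
    (Metric.mem_ball_self (by positivity)) (Metric.mem_ball.2 hxy)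
  rwa [dist_eq_norm]

lemma Pr.good (hN : 3 ≤ N) (h0 : 0 < R₀) (h1 : R₀ < R₁) {p : ℝ} (hp : 2 < p) {σ : ℝ} (hσ : 0 < σ) :
    ∃ M, 0 ≤ M ∧ ∀ u v, Pr N R₀ R₁ p u v → σ ≤ En N R₀ R₁ v v → ∃ u' v', Pr N R₀ R₁ p u' v' ∧
      En N R₀ R₁ v v ≤ En N R₀ R₁ v' v' ∧ (∀ x ∈ cA N R₀ R₁, |u' x| ≤ M) ∧
      ∀ x ∈ cA N R₀ R₁, ∀ y ∈ cA N R₀ R₁, dist y x < R₀ / 2 → |u' y - u' x| ≤ M * dist y x := by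
  have hp1 : 0 ≤ p - 1 := by linarith
  set q : ℝ := (p - 1) * ((N - 1 : ℕ) : ℝ) with hq
  have hq0 : 0 ≤ q := mul_nonneg hp1 (Nat.cast_nonneg _)
  obtain ⟨C1, hC1, hL⟩ := Lq hN h0 h1 q hq0
  obtain ⟨C2, hC2, hS⟩ := sup_pow hN h0 h1
  obtain ⟨C3, hC3, hE⟩ := Sol.exists1 hN h0 h1
  set Q := C1 * (σ⁻¹) ^ (q / 2) with hQ
  set M1 := C2 * (1 + Q) with hM1
  set M2 := σ⁻¹ * M1 with hM2
  set G := C3 * M2 ^ (p - 1) with hG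
  have hσ' := inv_pos.2 hσ
  have hQ0 : 0 ≤ Q := by positivity
  have hM10 : 0 ≤ M1 := by positivity
  have hM20 : 0 ≤ M2 := by positivity
  have hG0 : 0 ≤ G := by positivity
  refine ⟨σ⁻¹ * G, by positivity, fun u v h hs => ?_⟩
  have he := h.en_pos hN h0 h1 hp
  have hv := h.cnv hN h0 h1 hp
  obtain ⟨B, hB, -, heB, v1, P1, -, hm1⟩ := h.step hN h0 h1 hp
  have hen1 : En N R₀ R₁ (fun x => B⁻¹ * v x) (fun x => B⁻¹ * v x) = B⁻¹ ^ 2 * En N R₀ R₁ v v := En_smul h0 h.sol.c1 _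
  have hen1p : 0 < En N R₀ R₁ (fun x => B⁻¹ * v x) (fun x => B⁻¹ * v x) := by rw [hen1]; positivity
  have hen1l : En N R₀ R₁ (fun x => B⁻¹ * v x) (fun x => B⁻¹ * v x) ≤ σ⁻¹ := by
    rw [hen1]
    calc B⁻¹ ^ 2 * En N R₀ R₁ v v ≤ B⁻¹ ^ 2 * B := by gcongr
      _ = B⁻¹ := by field_simp
      _ ≤ σ⁻¹ := inv_anti₀ hσ (hs.trans heB)
  have hi1 : ∫ x in annulus N R₀ R₁, (B⁻¹ * v x) ^ q ≤ Q := by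
    refine (hL (fun x => B⁻¹ * v x) (contDiffOn_const.mul h.sol.c1) (fun x hx => by rw [h.sol.bd x hx, mul_zero])
      P1.cn.nn P1.cn.pc hen1p).trans ?_
    exact mul_le_mul_of_nonneg_left (rpow_le_rpow hen1p.le hen1l (by positivity)) hC1
  have hv1 := P1.cnv hN h0 h1 hp
  have hv1b : ∀ x ∈ cA N R₀ R₁, v1 x ≤ M1 := by
    intro x hx
    refine (hS _ v1 (cpow P1.cn.c hp1) (P1.cn.pow hp1).nn P1.sol x hx).trans ?_
    have : ∫ y in annulus N R₀ R₁, ((B⁻¹ * v y) ^ (p - 1)) ^ (N - 1) = ∫ y in annulus N R₀ R₁, (B⁻¹ * v y) ^ q := by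
      refine setIntegral_congr_fun (meas_annulus _ _ _) fun y hy => ?_
      have := P1.cn.nn y (ann_sub_cA _ _ _ hy)
      simp only [hq]
      rw [rpow_mul this, rpow_natCast]
    rw [this]
    exact mul_le_mul_of_nonneg_left (by linarith) hC2
  obtain ⟨B2, hB2, -, heB2, v2, P2, -, hm2⟩ := P1.step hN h0 h1 hp
  have hB2' : B2⁻¹ ≤ σ⁻¹ := inv_anti₀ hσ ((hs.trans hm1).trans heB2)
  have hu2 : ∀ x ∈ cA N R₀ R₁, B2⁻¹ * v1 x ≤ M2 := fun x hx =>
    mul_le_mul hB2' (hv1b x hx) (hv1.nn x hx) hσ'.le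
  obtain ⟨z, hz, hzg, hzb⟩ := hE (fun x => (B2⁻¹ * v1 x) ^ (p - 1)) (M2 ^ (p - 1)) (by positivity)
    (cpow P2.cn.c hp1) (fun x hx => by
      have hx' := ann_sub_cA _ _ _ hx
      rw [abs_of_nonneg ((P2.cn.pow hp1).nn x hx')]
      exact rpow_le_rpow (P2.cn.nn x hx') (hu2 x hx') hp1)
  have hzv := P2.sol.uniq hN h0 h1 zero_le_one hz fun _ _ => rfl
  obtain ⟨B3, hB3, -, heB3, v3, P3, -, hm3⟩ := P2.step hN h0 h1 hp
  have hB3' : B3⁻¹ ≤ σ⁻¹ := inv_anti₀ hσ (((hs.trans hm1).trans hm2).trans heB3)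
  refine ⟨_, v3, P3, (hm1.trans hm2).trans hm3, fun x hx => ?_, fun x hx y hy hd => ?_⟩
  · rw [abs_mul, abs_of_pos (inv_pos.2 hB3), hzv x hx]
    exact mul_le_mul hB3' (hzb x hx) (abs_nonneg _) hσ'.le
  · rw [← mul_sub, abs_mul, abs_of_pos (inv_pos.2 hB3), hzv x hx, hzv y hy, mul_assoc]
    exact mul_le_mul hB3' (lip_AO h0 hz.c1 hzg hx hd) (abs_nonneg _) hσ'.le

end
end NR

open MeasureTheory Real Set
namespace NR
open Filter Topology

section
variable {N : ℕ} {R₀ R₁ : ℝ}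

lemma ascoli (h0 : 0 < R₀) {U : ℕ → E N → ℝ} {M : ℝ} (hM : 0 ≤ M) (hc : ∀ n, ContinuousOn (U n) (cA N R₀ R₁))
    (hb : ∀ n, ∀ x ∈ cA N R₀ R₁, |U n x| ≤ M)
    (hl : ∀ n, ∀ x ∈ cA N R₀ R₁, ∀ y ∈ cA N R₀ R₁, dist y x < R₀ / 2 → |U n y - U n x| ≤ M * dist y x) :
    ∃ y : E N → ℝ, ContinuousOn y (cA N R₀ R₁) ∧ ∃ φ : ℕ → ℕ, StrictMono φ ∧
      ∀ ε > 0, ∃ n₀, ∀ n ≥ n₀, ∀ x ∈ cA N R₀ R₁, |U (φ n) x - y x| ≤ ε := by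
  have : CompactSpace (cA N R₀ R₁) := isCompact_iff_compactSpace.1 (isCompact_cA N R₀ R₁)
  let F : ℕ → BoundedContinuousFunction (cA N R₀ R₁) ℝ := fun n =>
    BoundedContinuousFunction.mkOfCompact ⟨(cA N R₀ R₁).domRestrict (U n), (hc n).domRestrict⟩
  have hF : ∀ n (x : cA N R₀ R₁), F n x = U n x := fun n x => rfl
  have hK := BoundedContinuousFunction.arzela_ascoli (Icc (-M) M) isCompact_Icc (range F)
    (by rintro f x ⟨n, rfl⟩; exact abs_le.1 (hb n x x.2))
    (by
      intro x₀
      rw [Metric.equicontinuousAt_iff]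
      intro ε hε
      refine ⟨min (R₀ / 2) (ε / (M + 1)), by positivity, ?_⟩
      rintro x hx ⟨f, n, rfl⟩
      have h1 : dist (x : E N) x₀ < R₀ / 2 := lt_of_lt_of_le hx (min_le_left _ _)
      have h2 : dist (x : E N) x₀ < ε / (M + 1) := lt_of_lt_of_le hx (min_le_right _ _)
      rw [lt_div_iff₀ (by positivity)] at h2
      have h3 := hl n x₀ x₀.2 x x.2 h1
      rw [dist_comm, Real.dist_eq]
      show |U n x - U n x₀| < ε
      nlinarith [dist_nonneg (x := (x : E N)) (y := x₀)])
  obtain ⟨g, -, φ, hφ, ht⟩ := hK.tendsto_subseq (fun n => subset_closure (mem_range_self n))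
  refine ⟨Function.extend Subtype.val g.toContinuousMap 0, ext_cont g.toContinuousMap, φ, hφ, fun ε hε => ?_⟩
  rw [Metric.tendsto_atTop] at ht
  obtain ⟨n₀, hn⟩ := ht ε hε
  refine ⟨n₀, fun n hn' x hx => ?_⟩
  have h1 := (F (φ n)).dist_coe_le_dist (g := g) ⟨x, hx⟩
  have h2 : Function.extend Subtype.val g.toContinuousMap 0 x = g ⟨x, hx⟩ :=
    Subtype.val_injective.extend_apply g.toContinuousMap 0 ⟨x, hx⟩
  rw [h2]
  exact h1.trans (hn n hn').le

/-- uniform convergence passes to powers -/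
lemma unif_pow {U : ℕ → E N → ℝ} {y : E N → ℝ} {M q : ℝ} (hq : 0 ≤ q)
    (hb : ∀ n, ∀ x ∈ cA N R₀ R₁, |U n x| ≤ M) (hy : ∀ x ∈ cA N R₀ R₁, |y x| ≤ M)
    (h : ∀ ε > 0, ∃ n₀, ∀ n ≥ n₀, ∀ x ∈ cA N R₀ R₁, |U n x - y x| ≤ ε) :
    ∀ ε > 0, ∃ n₀, ∀ n ≥ n₀, ∀ x ∈ cA N R₀ R₁, |U n x ^ q - y x ^ q| ≤ ε := by
  intro ε hε
  have hcont : Continuous (fun t : ℝ => t ^ q) := Real.continuous_rpow_const hq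
  have huc := isCompact_Icc (a := -M) (b := M) |>.uniformContinuousOn_of_continuous hcont.continuousOn
  rw [Metric.uniformContinuousOn_iff] at huc
  obtain ⟨δ, hδ, hd⟩ := huc ε hε
  obtain ⟨n₀, hn⟩ := h (δ / 2) (by positivity)
  refine ⟨n₀, fun n hn' x hx => ?_⟩
  have := hd (U n x) (abs_le.1 (hb n x hx)) (y x) (abs_le.1 (hy x hx))
    (by rw [Real.dist_eq]; linarith [hn n hn' x hx])
  rw [Real.dist_eq] at this
  exact this.le

lemma unif_int {F : ℕ → E N → ℝ} {f : E N → ℝ} (hF : ∀ n, ContinuousOn (F n) (cA N R₀ R₁))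
    (hf : ContinuousOn f (cA N R₀ R₁))
    (h : ∀ ε > 0, ∃ n₀, ∀ n ≥ n₀, ∀ x ∈ cA N R₀ R₁, |F n x - f x| ≤ ε) :
    Tendsto (fun n => ∫ x in annulus N R₀ R₁, F n x) atTop (𝓝 (∫ x in annulus N R₀ R₁, f x)) := by
  rw [Metric.tendsto_atTop]
  intro ε hε
  set V := volume.real (annulus N R₀ R₁)
  have hV : 0 ≤ V := measureReal_nonneg
  obtain ⟨n₀, hn⟩ := h (ε / (2 * (V + 1))) (by positivity)
  refine ⟨n₀, fun n hn' => ?_⟩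
  rw [Real.dist_eq, ← integral_sub (intA (hF n)) (intA hf)]
  have h2 : ‖∫ x in annulus N R₀ R₁, (F n x - f x)‖ ≤ ε / (2 * (V + 1)) * V :=
    norm_setIntegral_le_of_norm_le_const ((bdd_annulus N R₀ R₁).measure_lt_top) fun x hx =>
      hn n hn' x (ann_sub_cA _ _ _ hx)
  refine lt_of_le_of_lt h2 ?_
  rw [div_mul_eq_mul_div, div_lt_iff₀ (by positivity)]
  nlinarith

end
end NR

open MeasureTheory Real Set
namespace NR
open Filter Topology

section
variable {N : ℕ} {R₀ R₁ : ℝ}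

lemma unif_sol (hN : 3 ≤ N) (h0 : 0 < R₀) (h1 : R₀ < R₁) {F V : ℕ → E N → ℝ} {f z : E N → ℝ}
    (hF : ∀ n, ContinuousOn (F n) (cA N R₀ R₁)) (hf : ContinuousOn f (cA N R₀ R₁))
    (hV : ∀ n, Sol N R₀ R₁ 1 (F n) (V n)) (hz : Sol N R₀ R₁ 1 f z)
    (h : ∀ ε > 0, ∃ n₀, ∀ n ≥ n₀, ∀ x ∈ cA N R₀ R₁, |F n x - f x| ≤ ε) :
    ∀ ε > 0, ∃ n₀, ∀ n ≥ n₀, ∀ x ∈ cA N R₀ R₁, |V n x - z x| ≤ ε := by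
  intro ε hε
  obtain ⟨C, hC, hE⟩ := Sol.exists1 hN h0 h1
  obtain ⟨n₀, hn⟩ := h (ε / (C + 1)) (by positivity)
  refine ⟨n₀, fun n hn' x hx => ?_⟩
  obtain ⟨w, hw, -, hwb⟩ := hE (fun x => F n x - f x) (ε / (C + 1)) (by positivity) ((hF n).sub hf)
    (fun x hx => hn n hn' x (ann_sub_cA _ _ _ hx))
  rw [((hV n).sub hz).uniq hN h0 h1 zero_le_one hw (fun _ _ => rfl) x hx]
  refine (hwb x hx).trans ?_
  rw [mul_div_assoc', div_le_iff₀ (by positivity)]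
  nlinarith

lemma unif_mul {a b : ℕ → E N → ℝ} {f z : E N → ℝ} {K L : ℝ} (hK0 : 0 ≤ K) (hL0 : 0 ≤ L)
    (ha : ∀ n, ∀ x ∈ cA N R₀ R₁, |a n x| ≤ K)
    (hz : ∀ x ∈ cA N R₀ R₁, |z x| ≤ L)
    (h : ∀ ε > 0, ∃ n₀, ∀ n ≥ n₀, ∀ x ∈ cA N R₀ R₁, |a n x - f x| ≤ ε)
    (h' : ∀ ε > 0, ∃ n₀, ∀ n ≥ n₀, ∀ x ∈ cA N R₀ R₁, |b n x - z x| ≤ ε) :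
    ∀ ε > 0, ∃ n₀, ∀ n ≥ n₀, ∀ x ∈ cA N R₀ R₁, |a n x * b n x - f x * z x| ≤ ε := by
  intro ε hε
  obtain ⟨n1, hn1⟩ := h (ε / (K + L + 1)) (by positivity)
  obtain ⟨n2, hn2⟩ := h' (ε / (K + L + 1)) (by positivity)
  refine ⟨max n1 n2, fun n hn x hx => ?_⟩
  have g1 := hn1 n (le_of_max_le_left hn) x hx
  have g2 := hn2 n (le_of_max_le_right hn) x hx
  have e : a n x * b n x - f x * z x = a n x * (b n x - z x) + (a n x - f x) * z x := by ring
  rw [e]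
  refine (abs_add_le _ _).trans ?_
  rw [abs_mul, abs_mul]
  have k1 := mul_le_mul (ha n x hx) g2 (abs_nonneg _) hK0
  have k2 := mul_le_mul g1 (hz x hx) (abs_nonneg _) (by positivity)
  have k3 : K * (ε / (K + L + 1)) + ε / (K + L + 1) * L ≤ ε := by
    have : K * (ε / (K + L + 1)) + ε / (K + L + 1) * L = ε * (K + L) / (K + L + 1) := by ring
    rw [this, div_le_iff₀ (by positivity)]
    nlinarith
  linarith

lemma maximizer (hN : 3 ≤ N) (h0 : 0 < R₀) (h1 : R₀ < R₁) {p : ℝ} (hp : 2 < p) {S : ℝ} (hS0 : 0 < S)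
    (hle : ∀ u v, Pr N R₀ R₁ p u v → En N R₀ R₁ v v ≤ S)
    (hex : ∀ s < S, ∃ u v, Pr N R₀ R₁ p u v ∧ s < En N R₀ R₁ v v) :
    ∃ y z, Pr N R₀ R₁ p y z ∧ En N R₀ R₁ z z = S := by
  have hp1 : 0 ≤ p - 1 := by linarith
  obtain ⟨M, hM, hgood⟩ := Pr.good hN h0 h1 hp (half_pos hS0)
  have hseq : ∀ n : ℕ, ∃ u v, Pr N R₀ R₁ p u v ∧ S - S / 2 * (1 / ((n : ℝ) + 1)) ≤ En N R₀ R₁ v v ∧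
      (∀ x ∈ cA N R₀ R₁, |u x| ≤ M) ∧
      ∀ x ∈ cA N R₀ R₁, ∀ y ∈ cA N R₀ R₁, dist y x < R₀ / 2 → |u y - u x| ≤ M * dist y x := by
    intro n
    obtain ⟨u, v, hP, hlt⟩ := hex (S - S / 2 * (1 / ((n : ℝ) + 1))) (by
      have : 0 < S / 2 * (1 / ((n : ℝ) + 1)) := by positivity
      linarith)
    have h3 : 1 / ((n : ℝ) + 1) ≤ 1 := by
      rw [div_le_one (by positivity)]
      have : (0 : ℝ) ≤ n := Nat.cast_nonneg n
      linarith
    obtain ⟨u', v', hP', hge, h4, h5⟩ := hgood u v hP (by nlinarith)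
    exact ⟨u', v', hP', hlt.le.trans hge, h4, h5⟩
  choose U V hP hlow hUb hUl using hseq
  obtain ⟨y, hyc, φ, hφ, hu⟩ := ascoli h0 hM (fun n => (hP n).cn.c) hUb hUl
  have hpt : ∀ x ∈ cA N R₀ R₁, Tendsto (fun n => U (φ n) x) atTop (𝓝 (y x)) := by
    intro x hx
    rw [Metric.tendsto_atTop]
    intro ε hε
    obtain ⟨n₀, hn⟩ := hu (ε / 2) (by positivity)
    refine ⟨n₀, fun n hn' => ?_⟩
    rw [Real.dist_eq]
    linarith [hn n hn' x hx]
  have hyb : ∀ x ∈ cA N R₀ R₁, |y x| ≤ M := fun x hx =>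
    le_of_tendsto (hpt x hx).abs (Eventually.of_forall fun n => hUb _ x hx)
  have hynn : ∀ x ∈ cA N R₀ R₁, 0 ≤ y x := fun x hx =>
    ge_of_tendsto (hpt x hx) (Eventually.of_forall fun n => (hP _).cn.nn x hx)
  have hyPC : PC N R₀ R₁ y := fun x hx x' hx' a b =>
    le_of_tendsto_of_tendsto (hpt x' hx') (hpt x hx)
      (Eventually.of_forall fun n => (hP _).cn.pc x hx x' hx' a b)
  have hynm : ∫ x in annulus N R₀ R₁, y x ^ p = 1 := by
    have h3 := unif_int (fun n => cpow (hP (φ n)).cn.c (by linarith : 0 ≤ p)) (cpow hyc (by linarith : 0 ≤ p))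
      (unif_pow (by linarith : 0 ≤ p) (fun n => hUb (φ n)) hyb hu)
    simp only [(hP _).nm] at h3
    exact (tendsto_nhds_unique h3 tendsto_const_nhds)
  have hyne : ∃ x ∈ annulus N R₀ R₁, 0 < y x := by
    by_contra hcon
    push Not at hcon
    have : ∫ x in annulus N R₀ R₁, y x ^ p = ∫ x in annulus N R₀ R₁, (0 : ℝ) := by
      refine setIntegral_congr_fun (meas_annulus _ _ _) fun x hx => ?_
      have : y x = 0 := le_antisymm (hcon x hx) (hynn x (ann_sub_cA _ _ _ hx))
      simp only [this]
      rw [zero_rpow (by linarith)]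
    rw [hynm] at this
    simp at this
  have hyC : Cn N R₀ R₁ y := ⟨hyc, hynn, hyPC, hyne⟩
  obtain ⟨z, hz⟩ := Sol.exc hN h0 h1 (cpow hyc hp1)
  have hPz : Pr N R₀ R₁ p y z := ⟨hyC, hynm, hz⟩
  refine ⟨y, z, hPz, le_antisymm (hle y z hPz) ?_⟩
  have hpw := unif_pow hp1 (fun n => hUb (φ n)) hyb hu
  have hVz := unif_sol hN h0 h1 (fun n => cpow (hP (φ n)).cn.c hp1) (cpow hyc hp1) (fun n => (hP (φ n)).sol) hz hpw
  obtain ⟨L, hL, hzL⟩ := bdd_cA (hz.cont h0)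
  have hmul := unif_mul (K := M ^ (p - 1)) (by positivity) hL (fun n x hx => by
    rw [abs_of_nonneg (rpow_nonneg ((hP (φ n)).cn.nn x hx) _)]
    exact rpow_le_rpow ((hP (φ n)).cn.nn x hx) ((le_abs_self _).trans (hUb (φ n) x hx)) hp1) hzL hpw hVz
  have hlim := unif_int (fun n => (cpow (hP (φ n)).cn.c hp1).mul ((hP (φ n)).sol.cont h0))
    ((cpow hyc hp1).mul (hz.cont h0)) hmul
  have hlim2 : Tendsto (fun n => En N R₀ R₁ (V (φ n)) (V (φ n))) atTop (𝓝 (En N R₀ R₁ z z)) := by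
    rw [hPz.en hN h0 h1 hp]
    refine hlim.congr fun n => ?_
    rw [(hP (φ n)).en hN h0 h1 hp]
    rfl
  have hs : Tendsto (fun n => S - S / 2 * (1 / (((φ n : ℕ) : ℝ) + 1))) atTop (𝓝 (S - S / 2 * 0)) :=
    ((tendsto_one_div_add_atTop_nhds_zero_nat (𝕜 := ℝ)).comp hφ.tendsto_atTop).const_mul (S / 2) |>.const_sub S
  rw [mul_zero, sub_zero] at hs
  exact le_of_tendsto_of_tendsto hs hlim2 (Eventually.of_forall fun n => hlow (φ n))

end
end NR

open MeasureTheory Real Set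
namespace NR
open Filter Topology

section
variable {N : ℕ} {R₀ R₁ : ℝ}

lemma ground (hN : 3 ≤ N) (h0 : 0 < R₀) (h1 : R₀ < R₁) {p : ℝ} (hp : 2 < p) {S : ℝ} (hS0 : 0 < S)
    (hle : ∀ u v, Pr N R₀ R₁ p u v → En N R₀ R₁ v v ≤ S) {y z : E N → ℝ} (h : Pr N R₀ R₁ p y z)
    (hE : En N R₀ R₁ z z = S) :
    ∃ u, Sol N R₀ R₁ 1 (fun x => u x ^ (p - 1)) u ∧ Cn N R₀ R₁ u ∧ (∀ x ∈ annulus N R₀ R₁, 0 < u x) ∧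
      En N R₀ R₁ u u * S = (∫ x in annulus N R₀ R₁, u x ^ p) ^ (2 / p) := by
  have hp1 : 0 ≤ p - 1 := by linarith
  have hz := h.cnv hN h0 h1 hp
  have hzp := h.vpos hN h0 h1 hp
  obtain ⟨B, hB, hb, heB, w, hw, hB2, -⟩ := h.step hN h0 h1 hp
  have hBS : B = S := by
    rw [hE] at heB hB2
    have h3 := hle _ w hw
    have h4 : B ^ 2 ≤ S * S := hB2.trans (mul_le_mul_of_nonneg_right h3 hS0.le)
    nlinarith
  subst hBS
  have hzy := (holder_p hp h.cn.c h.cn.nn hz.c hz.nn h.nm hB hb).2 (by rw [← h.en hN h0 h1 hp, hE])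
  set τ := B ^ (-((p - 1) / (p - 2))) with hτ
  have hτ0 : 0 < τ := rpow_pos_of_pos hB _
  have hτp : τ ^ (p - 2) * B ^ (p - 1) = 1 := by
    rw [hτ, ← rpow_mul hB.le, ← rpow_add hB]
    have : -((p - 1) / (p - 2)) * (p - 2) + (p - 1) = 0 := by
      have : p - 2 ≠ 0 := by linarith
      field_simp; ring
    rw [this, rpow_zero]
  have hτ1 : τ ^ (p - 1) * B ^ (p - 1) = τ := by
    have : p - 1 = (p - 2) + 1 := by ring
    have h5 : τ ^ (p - 1) = τ ^ (p - 2) * τ := by rw [this, rpow_add_one hτ0.ne']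
    rw [h5, mul_right_comm, hτp, one_mul]
  have hs := h.sol.smul τ
  refine ⟨fun x => τ * z x, ⟨hs.c1, hs.bd, hs.ws.congr (isOpen_annulus _ _ _) (fun _ _ => rfl) fun x hx => ?_⟩,
    hz.smul hτ0, fun x hx => mul_pos hτ0 (hzp x hx), ?_⟩
  · have hy := h.cn.nn x (ann_sub_cA _ _ _ hx)
    have : (τ * z x) ^ (p - 1) = τ * y x ^ (p - 1) := by
      rw [hzy x hx, mul_rpow hτ0.le (mul_nonneg hB.le hy), mul_rpow hB.le hy, ← mul_assoc, hτ1]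
    simp only [this]
  · rw [En_smul h0 h.sol.c1, hE, J_smul hz.nn hτ0.le, hb, ← mul_rpow hτ0.le hB.le,
      rpow_two_div (by positivity) (by linarith)]
    ring

lemma part2 (hN : 3 ≤ N) (h0 : 0 < R₀) (h1 : R₀ < R₁) {p : ℝ} (hp : 2 < p) {κ : ℝ} {φ : E N → ℝ}
    (hκ : 0 < κ)
    (hT : Tst (annulus N R₀ R₁) φ) (hn : ∀ x, 0 ≤ φ x) (hPC : PC N R₀ R₁ φ)
    (hx : ∃ x ∈ annulus N R₀ R₁, 0 < φ x)
    (hE : En N R₀ R₁ φ φ < κ * (∫ x in annulus N R₀ R₁, φ x ^ p) ^ (2 / p))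
    (hrad : ∀ w : E N → ℝ, ContinuousOn w (cA N R₀ R₁) → ContDiffOn ℝ 1 w (annulus N R₀ R₁) →
      (∀ x, ‖x‖ = R₀ ∨ ‖x‖ = R₁ → w x = 0) →
      (∀ x ∈ annulus N R₀ R₁, ∀ y ∈ annulus N R₀ R₁, ‖x‖ = ‖y‖ → w x = w y) →
      IntegrableOn (fun x => ‖gradient w x‖ ^ 2) (annulus N R₀ R₁) →
      κ * (∫ x in annulus N R₀ R₁, |w x| ^ p) ^ (2 / p) ≤ ∫ x in annulus N R₀ R₁, ‖gradient w x‖ ^ 2) :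
    ∃ u : E N → ℝ, IsWeakSolution N R₀ R₁ (fun _ => 1) p u ∧ (∀ x ∈ annulus N R₀ R₁, 0 < u x) ∧
      (∃ 𝔲 : ℝ → ℝ → ℝ, IsAxiallySymmRep N R₀ R₁ u 𝔲) ∧
      ∃ x ∈ annulus N R₀ R₁, ∃ y ∈ annulus N R₀ R₁, ‖x‖ = ‖y‖ ∧ u x ≠ u y := by
  have hp1 : 0 ≤ p - 1 := by linarith
  obtain ⟨C, hC⟩ := Pr.bdd hN h0 h1 hp
  obtain ⟨u₀, v₀, hP₀, hv₀⟩ := Pr.test hN h0 h1 hp hT hn hPC hx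
  set T : Set ℝ := {s | ∃ u v, Pr N R₀ R₁ p u v ∧ s = En N R₀ R₁ v v} with hTd
  have hbd : BddAbove T := ⟨C, by rintro s ⟨u, v, h, rfl⟩; exact hC u v h⟩
  have hne : T.Nonempty := ⟨_, u₀, v₀, hP₀, rfl⟩
  set S := sSup T with hS
  have hle : ∀ u v, Pr N R₀ R₁ p u v → En N R₀ R₁ v v ≤ S := fun u v h => le_csSup hbd ⟨u, v, h, rfl⟩
  have hS0 : 0 < S := (hP₀.en_pos hN h0 h1 hp).trans_le (hle _ _ hP₀)
  obtain ⟨y, z, hyz, hzS⟩ := maximizer hN h0 h1 hp hS0 hle (fun s hs => by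
    obtain ⟨t, ⟨u, v, h, rfl⟩, ht⟩ := exists_lt_of_lt_csSup hne hs
    exact ⟨u, v, h, ht⟩)
  obtain ⟨u, hu, hcn, hpos, hen⟩ := ground hN h0 h1 hp hS0 hle hyz hzS
  have hSκ : 1 < S * κ := by
    have hc : Cn N R₀ R₁ φ := ⟨hT.c1.continuous.continuousOn, fun x _ => hn x, hPC, hx⟩
    have hb := rpow_pos_of_pos (hc.J_pos (by linarith : 0 ≤ p)) (2 / p)
    set b := (∫ x in annulus N R₀ R₁, φ x ^ p) ^ (2 / p)
    have h3 : b ≤ S * En N R₀ R₁ φ φ :=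
      hv₀.trans (mul_le_mul_of_nonneg_right (hle _ _ hP₀) (En_nonneg φ))
    have h4 : S * En N R₀ R₁ φ φ < S * (κ * b) := mul_lt_mul_of_pos_left hE hS0
    nlinarith
  refine ⟨u, ⟨⟨?_, hu.bd⟩, fun ψ hψ => ?_⟩, hpos, ?_, ?_⟩
  · rw [closure_annulus h0 h1]
    exact hu.c1.mono (cA_sub_AO h0)
  · have hψT : Tst (annulus N R₀ R₁) ψ := ⟨hψ.1.of_le (by exact_mod_cast le_top), hψ.2.1, hψ.2.2⟩
    have := hu.energy_tst h0 (cpow hcn.c hp1) hψT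
    unfold En at this
    have e1 : ∫ x in annulus N R₀ R₁, (fderivWithin ℝ u (closure (annulus N R₀ R₁)) x (gradient ψ x) + u x * ψ x) =
        ∫ x in annulus N R₀ R₁, (inner ℝ (gradient u x) (gradient ψ x) + u x * ψ x) :=
      setIntegral_congr_fun (meas_annulus _ _ _) fun x hx => by
        rw [fdw hx, inner_grad]
    have e2 : ∫ x in annulus N R₀ R₁, 1 * |u x| ^ (p - 2) * u x * ψ x =
        ∫ x in annulus N R₀ R₁, u x ^ (p - 1) * ψ x :=
      setIntegral_congr_fun (meas_annulus _ _ _) fun x hx => by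
        have hux := hpos x hx
        have e : p - 1 = (p - 2) + 1 := by ring
        have e' : u x ^ (p - 1) = u x ^ (p - 2) * u x := by rw [e, rpow_add_one hux.ne']
        rw [abs_of_pos hux, one_mul, e']
    exact e1.trans (this.trans e2.symm)
  · obtain ⟨𝔲, h3, -⟩ := hcn.pc.rep hN h0 h1
    exact ⟨𝔲, h3⟩
  · by_contra hcon
    push Not at hcon
    have h3 := hrad u hcn.c (hu.c1.mono ((ann_sub_cA _ _ _).trans (cA_sub_AO h0))) hu.bd hcon
      (intA ((grad_cA h0 hu.c1).norm.pow 2))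
    have h4 : ∫ x in annulus N R₀ R₁, |u x| ^ p = ∫ x in annulus N R₀ R₁, u x ^ p :=
      setIntegral_congr_fun (meas_annulus _ _ _) fun x hx => by
        rw [abs_of_pos (hpos x hx)]
    rw [h4, ← hen] at h3
    have h5 := h3.trans (gradsq_le h0 hu.c1)
    have h6 : 0 < En N R₀ R₁ u u := by
      have hb := rpow_pos_of_pos (hcn.J_pos (by linarith : 0 ≤ p)) (2 / p)
      rw [← hen] at hb
      exact pos_of_mul_pos_left hb hS0.le
    nlinarith

theorem final (N : ℕ) (hN : 3 ≤ N) (R₀ R₁ : ℝ) (h0 : 0 < R₀) (h1 : R₀ < R₁) :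
    ∃ pstar : ℝ, 2 < pstar ∧ ∀ p : ℝ, pstar < p →
      (∀ u, memNehari N R₀ R₁ (fun _ => 1) p u → funcI N R₀ R₁ (fun _ => 1) p u = cI N R₀ R₁ (fun _ => 1) p →
        ∃ x ∈ annulus N R₀ R₁, ∃ y ∈ annulus N R₀ R₁, ‖x‖ = ‖y‖ ∧ u x ≠ u y) ∧
      ∃ u : E N → ℝ, IsWeakSolution N R₀ R₁ (fun _ => 1) p u ∧ (∀ x ∈ annulus N R₀ R₁, 0 < u x) ∧
      (∃ 𝔲 : ℝ → ℝ → ℝ, IsAxiallySymmRep N R₀ R₁ u 𝔲) ∧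
      ∃ x ∈ annulus N R₀ R₁, ∃ y ∈ annulus N R₀ R₁, ‖x‖ = ‖y‖ ∧ u x ≠ u y := by
  obtain ⟨κ, hκ, ps, hps, φ, hT, hn, hPC, hx, hg⟩ := gap hN h0 h1
  refine ⟨ps, hps, fun p hp => ?_⟩
  obtain ⟨hE, hrad⟩ := hg p hp
  exact ⟨fun u hu hc => part1 hN h0 h1 (hps.trans hp) hT hn hPC hx hE hrad hu hc,
    part2 hN h0 h1 (hps.trans hp) hκ hT hn hPC hx hE hrad⟩

end
end NR

/-- nonradial ground states for large exponents `p` (case `a ≡ 1`). -/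
theorem statement1 (N : ℕ) (hN : 3 ≤ N) (R₀ R₁ : ℝ) (hR₀ : 0 < R₀) (hR : R₀ < R₁) :
    ∃ pstar : ℝ, 2 < pstar ∧ ∀ p : ℝ, pstar < p →
      (∀ u, memNehari N R₀ R₁ (fun _ => 1) p u →
          funcI N R₀ R₁ (fun _ => 1) p u = cI N R₀ R₁ (fun _ => 1) p →
          ∃ x ∈ annulus N R₀ R₁, ∃ y ∈ annulus N R₀ R₁, ‖x‖ = ‖y‖ ∧ u x ≠ u y) ∧
      (∃ u : EuclideanSpace ℝ (Fin N) → ℝ,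
          IsWeakSolution N R₀ R₁ (fun _ => 1) p u ∧
          (∀ x ∈ annulus N R₀ R₁, 0 < u x) ∧
          (∃ 𝔲 : ℝ → ℝ → ℝ, IsAxiallySymmRep N R₀ R₁ u 𝔲) ∧
          ∃ x ∈ annulus N R₀ R₁, ∃ y ∈ annulus N R₀ R₁, ‖x‖ = ‖y‖ ∧ u x ≠ u y) := by
  exact NR.final N hN R₀ R₁ hR₀ hR
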